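/- (Kato–Ponce inequality) Let d ≥ 1, s ≥ 0 and 1 < r < ∞, and suppose 1/r = 1/r₁ + 1/r₂ = 1/r₃ + 1/r₄ with r₂, r₃ ∈ (1,∞) and r₁, r₄ ∈ (1,∞]. Then there is a constant C > 0, independent of f and g, such that for all f, g ∈ 𝒮(ℝ^d): ‖⟨D⟩^s(f·g)‖_{L^r} ≤ C ( ‖f‖_{L^{r₁}} ‖⟨D⟩^s g‖_{L^{r₂}} + ‖⟨D⟩^s f‖_{L^{r₃}} ‖g‖_{L^{r₄}} ). -/

import Mathlib

open MeasureTheory Complex Filter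
open scoped ENNReal RealInnerProductSpace

noncomputable section

/-- `d`-dimensional Euclidean space. -/
abbrev Ed (d : ℕ) := EuclideanSpace ℝ (Fin d)

/-- Fourier transform: `f̂(ξ) = ∫ e^{-i x·ξ} f(x) dx`. -/
def FT (d : ℕ) (f : Ed d → ℂ) (ξ : Ed d) : ℂ :=
  ∫ x, Complex.exp (-Complex.I * (⟪x, ξ⟫ : ℝ)) * f x

/-- Inverse Fourier transform: `(F⁻¹ g)(x) = (2π)^{-d} ∫ e^{i x·ξ} g(ξ) dξ`. -/
def FTinv (d : ℕ) (g : Ed d → ℂ) (x : Ed d) : ℂ :=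
  (((2 * Real.pi) ^ d : ℝ) : ℂ)⁻¹ * ∫ ξ, Complex.exp (Complex.I * (⟪x, ξ⟫ : ℝ)) * g ξ

/-- Bessel-type fractional differentiation `⟨D⟩^s f = F⁻¹((1+|ξ|²)^{s/2} f̂(ξ))`. -/
def besselD (d : ℕ) (s : ℝ) (f : Ed d → ℂ) : Ed d → ℂ :=
  FTinv d fun ξ => (((1 + ‖ξ‖ ^ 2) ^ (s / 2) : ℝ) : ℂ) * FT d f ξ

/-- Riesz-type fractional differentiation `|D|^s f = F⁻¹(|ξ|^s f̂(ξ))`. -/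
def rieszD (d : ℕ) (s : ℝ) (f : Ed d → ℂ) : Ed d → ℂ :=
  FTinv d fun ξ => ((‖ξ‖ ^ s : ℝ) : ℂ) * FT d f ξ

/-- Homogeneous Sobolev seminorm `‖f‖_{Ẇ^{s,r}} = ‖|D|^s f‖_{L^r}`. -/
def sobNorm (d : ℕ) (s : ℝ) (r : ℝ≥0∞) (f : Ed d → ℂ) : ℝ≥0∞ :=
  eLpNorm (rieszD d s f) r volume

set_option linter.unusedSectionVars false

open scoped NNReal

theorem rpow_tangent_le {p x y : ℝ} (hp : 1 ≤ p) (hx : 0 ≤ x) (hy : 0 < y) :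
    y ^ p + p * y ^ (p - 1) * (x - y) ≤ x ^ p := by
  have h := one_add_mul_self_le_rpow_one_add (s := x / y - 1) (by
    have : 0 ≤ x / y := by positivity
    linarith) hp
  have h2 : (1 + (x / y - 1)) = x / y := by ring
  rw [h2, Real.div_rpow hx hy.le, le_div_iff₀ (by positivity)] at h
  have h3 : y ^ p = y ^ (p - 1) * y := by
    rw [Real.rpow_sub_one hy.ne']; field_simp
  calc _ = (1 + p * (x / y - 1)) * y ^ p := by rw [h3]; field_simp
    _ ≤ _ := h

theorem rpow_tangent_le' {p x y : ℝ} (hp : 1 < p) (hx : 0 ≤ x) (hy : 0 ≤ y) :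
    y ^ p + p * y ^ (p - 1) * (x - y) ≤ x ^ p := by
  rcases hy.eq_or_lt with rfl | hy
  · rw [Real.zero_rpow (by linarith), Real.zero_rpow (by linarith)]
    simp; positivity
  · exact rpow_tangent_le hp.le hx hy

/-- Strong convexity of `x ^ p` for `1 < p ≤ 2`. -/
theorem rpow_strong_tangent_le {p x y R : ℝ} (hp : 1 < p) (hp2 : p ≤ 2) (hx : 0 ≤ x)
    (hy : 0 ≤ y) (hR : 0 < R) (hxR : x ≤ R) (hyR : y ≤ R) :
    y ^ p + p * y ^ (p - 1) * (x - y) + p * (p - 1) / 4 * R ^ (p - 2) * (x - y) ^ 2 ≤ x ^ p := by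
  have hderiv : ∀ t : ℝ, 0 < t → HasDerivAt
      (fun t : ℝ => t ^ p - p * (p - 1) / 4 * R ^ (p - 2) * t ^ 2)
      (p * t ^ (p - 1) - p * (p - 1) / 4 * R ^ (p - 2) * (2 * t)) t := by
    intro t ht
    have := (Real.hasDerivAt_rpow_const (p := p) (Or.inl ht.ne')).sub
      (((hasDerivAt_id t).pow 2).const_mul (p * (p - 1) / 4 * R ^ (p - 2)))
    exact this.congr_deriv (by simp)
  have hderiv2 : ∀ t : ℝ, 0 < t → HasDerivAt (fun t : ℝ =>
      (p * t ^ (p - 1) - p * (p - 1) / 4 * R ^ (p - 2) * (2 * t)))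
      (p * ((p - 1) * t ^ (p - 2)) - p * (p - 1) / 4 * R ^ (p - 2) * 2) t := by
    intro t ht
    have := ((Real.hasDerivAt_rpow_const (p := p - 1) (Or.inl ht.ne')).const_mul p).sub
      (((hasDerivAt_id t).const_mul 2).const_mul (p * (p - 1) / 4 * R ^ (p - 2)))
    exact this.congr_deriv (by rw [show p - 1 - 1 = p - 2 by ring]; ring)
  have hconv : ConvexOn ℝ (Set.Icc 0 (2 * R))
      (fun t : ℝ => t ^ p - p * (p - 1) / 4 * R ^ (p - 2) * t ^ 2) := by
    apply convexOn_of_hasDerivWithinAt2_nonneg (convex_Icc _ _)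
      (f' := fun t => p * t ^ (p - 1) - p * (p - 1) / 4 * R ^ (p - 2) * (2 * t))
      (f'' := fun t => p * ((p - 1) * t ^ (p - 2)) - p * (p - 1) / 4 * R ^ (p - 2) * 2)
    · apply Continuous.continuousOn
      have := Real.continuous_rpow_const (q := p) (by linarith)
      fun_prop
    · intro t ht; rw [interior_Icc] at ht; exact (hderiv t ht.1).hasDerivWithinAt
    · intro t ht; rw [interior_Icc] at ht; exact (hderiv2 t ht.1).hasDerivWithinAt
    · intro t ht; rw [interior_Icc] at ht
      have h1 : (2 * R) ^ (p - 2) ≤ t ^ (p - 2) :=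
        Real.rpow_le_rpow_of_nonpos ht.1 ht.2.le (by linarith)
      rw [Real.mul_rpow (by norm_num) hR.le] at h1
      have h2 : (2 : ℝ) ^ (-1 : ℝ) ≤ 2 ^ (p - 2) :=
        Real.rpow_le_rpow_of_exponent_le (by norm_num) (by linarith)
      rw [Real.rpow_neg_one] at h2
      have h3 : (0 : ℝ) ≤ R ^ (p - 2) := by positivity
      have h4 : 0 ≤ p * (p - 1) := by nlinarith
      have h5 : 2⁻¹ * R ^ (p - 2) ≤ t ^ (p - 2) := le_trans (by gcongr) h1
      nlinarith
  rcases hy.eq_or_lt with rfl | hy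
  · rw [Real.zero_rpow (by linarith), Real.zero_rpow (by linarith)]
    rcases hx.eq_or_lt with rfl | hx
    · simp; positivity
    have h1 : x ^ p = x ^ (p - 2) * x ^ 2 := by
      rw [← Real.rpow_natCast x 2, ← Real.rpow_add hx]; norm_num
    have h2 : R ^ (p - 2) ≤ x ^ (p - 2) :=
        Real.rpow_le_rpow_of_nonpos hx hxR (by linarith)
    have h4 : p * (p - 1) / 4 ≤ 1 := by nlinarith
    have h5 : 0 ≤ p * (p - 1) / 4 := by nlinarith
    have h3 : (0 : ℝ) ≤ R ^ (p - 2) := by positivity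
    rw [h1]
    have : p * (p - 1) / 4 * R ^ (p - 2) * x ^ 2 ≤ 1 * x ^ (p - 2) * x ^ 2 := by gcongr
    simp
    linarith
  · have hy2 : y ∈ Set.Icc 0 (2 * R) := ⟨hy.le, by linarith⟩
    have hx2 : x ∈ Set.Icc 0 (2 * R) := ⟨hx, by linarith⟩
    have key : (y ^ p - p * (p - 1) / 4 * R ^ (p - 2) * y ^ 2) +
        (p * y ^ (p - 1) - p * (p - 1) / 4 * R ^ (p - 2) * (2 * y)) * (x - y) ≤
        x ^ p - p * (p - 1) / 4 * R ^ (p - 2) * x ^ 2 := by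
      rcases lt_trichotomy x y with h | rfl | h
      · have := hconv.slope_le_of_hasDerivAt hx2 hy2 h (hderiv y hy)
        rw [slope_def_field, div_le_iff₀ (by linarith)] at this
        nlinarith
      · simp
      · have := hconv.le_slope_of_hasDerivAt hy2 hx2 h (hderiv y hy)
        rw [slope_def_field, le_div_iff₀ (by linarith)] at this
        nlinarith
    nlinarith

/-- One-step gain for the function `‖u‖ ^ p`, `1 < p ≤ 2`. -/
theorem norm_rpow_gain {p : ℝ} (hp : 1 < p) (hp2 : p ≤ 2) (b : ℂ) :
    ∃ c : ℂ, ∀ a : ℂ, ‖b‖ ^ p + (c * (a - b)).re +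
      p * (p - 1) / 4 * (‖a‖ + ‖b‖) ^ (p - 2) * ‖a - b‖ ^ 2 ≤ ‖a‖ ^ p := by
  rcases eq_or_ne b 0 with rfl | hb
  · refine ⟨0, fun a => ?_⟩
    rcases eq_or_ne a 0 with rfl | ha
    · simp
    have := rpow_strong_tangent_le hp hp2 (norm_nonneg a) le_rfl (norm_pos_iff.2 ha) le_rfl
      (norm_nonneg a)
    simpa [Real.zero_rpow (by linarith : p - 1 ≠ 0)] using this
  · have hb' : 0 < ‖b‖ := norm_pos_iff.2 hb
    refine ⟨((p * ‖b‖ ^ (p - 2) : ℝ) : ℂ) * (starRingEnd ℂ) b, fun a => ?_⟩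
    have h := rpow_strong_tangent_le hp hp2 (norm_nonneg a) hb'.le
      (R := ‖a‖ + ‖b‖) (by positivity) (by linarith) (by linarith [norm_nonneg a])
    set m := ((starRingEnd ℂ) b * a).re with hm
    have hmle : m ≤ ‖a‖ * ‖b‖ := by
      calc m ≤ ‖(starRingEnd ℂ) b * a‖ := Complex.re_le_norm _
        _ = _ := by rw [norm_mul, RCLike.norm_conj, mul_comm]
    have e1 : (((p * ‖b‖ ^ (p - 2) : ℝ) : ℂ) * (starRingEnd ℂ) b * (a - b)).re
        = p * ‖b‖ ^ (p - 2) * (m - ‖b‖ ^ 2) := by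
      rw [mul_assoc, Complex.re_ofReal_mul, mul_sub, Complex.sub_re, ← hm,
        Complex.conj_mul']
      norm_cast
    have e2 : ‖a - b‖ ^ 2 = ‖a‖ ^ 2 + ‖b‖ ^ 2 - 2 * m := by
      rw [← Complex.normSq_eq_norm_sq, ← Complex.normSq_eq_norm_sq, ← Complex.normSq_eq_norm_sq,
        Complex.normSq_sub, hm]
      congr 2
      simp [Complex.mul_re]; ring
    have e3 : ‖b‖ ^ (p - 1) = ‖b‖ ^ (p - 2) * ‖b‖ := by
      rw [← Real.rpow_add_one hb'.ne']; congr 1; ring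
    have h2 : (‖a‖ + ‖b‖) ^ (p - 2) ≤ ‖b‖ ^ (p - 2) :=
      Real.rpow_le_rpow_of_nonpos hb' (by linarith [norm_nonneg a]) (by linarith)
    have h3 : 0 ≤ (‖a‖ + ‖b‖) ^ (p - 2) := by positivity
    have h4 : p * (p - 1) / 4 * (‖a‖ + ‖b‖) ^ (p - 2) * 2 ≤ p * ‖b‖ ^ (p - 2) := by
      have : p * (p - 1) / 4 * (‖a‖ + ‖b‖) ^ (p - 2) ≤ p / 4 * ‖b‖ ^ (p - 2) := by
        have : p * (p - 1) / 4 ≤ p / 4 := by nlinarith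
        gcongr
      have : 0 ≤ p * ‖b‖ ^ (p - 2) := by positivity
      linarith
    rw [e1, e2]
    rw [e3] at h
    have h5 := mul_le_mul_of_nonneg_right h4 (sub_nonneg.2 hmle)
    nlinarith

/-- One-step gain for `(‖u‖ ^ 2 + w ^ τ) ^ (p / 2)`, `2 < p ≤ 4`. -/
theorem norm_sq_add_rpow_gain {σ : ℝ} (hσ : 1 < σ) (hσ2 : σ ≤ 2) (b : ℂ) {β : ℝ} (hβ : 0 ≤ β) :
    ∃ c : ℂ, ∃ e : ℝ, ∀ (a : ℂ) (α : ℝ), 0 ≤ α →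
      (‖b‖ ^ 2 + β ^ (σ - 1)⁻¹) ^ σ + (c * (a - b)).re + e * (α - β) +
      σ * β * ‖a - b‖ ^ 2 ≤ (‖a‖ ^ 2 + α ^ (σ - 1)⁻¹) ^ σ := by
  set τ := (σ - 1)⁻¹ with hτ
  have hτ1 : 1 ≤ τ := by rw [hτ]; exact (one_le_inv₀ (by linarith)).2 (by linarith)
  have hτ0 : 0 ≤ τ := by linarith
  set Y := ‖b‖ ^ 2 + β ^ τ with hY
  have hY0 : 0 ≤ Y := by positivity
  have hYβ : β ≤ Y ^ (σ - 1) := by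
    calc β = (β ^ τ) ^ (σ - 1) := by
          rw [← Real.rpow_mul hβ, hτ, inv_mul_cancel₀ (by linarith), Real.rpow_one]
      _ ≤ _ := by
        have : β ^ τ ≤ Y := by rw [hY]; nlinarith [sq_nonneg ‖b‖]
        have : 0 ≤ σ - 1 := by linarith
        gcongr
  refine ⟨((σ * Y ^ (σ - 1) * 2 : ℝ) : ℂ) * (starRingEnd ℂ) b,
    σ * Y ^ (σ - 1) * (τ * β ^ (τ - 1)), fun a α hα => ?_⟩
  have hw : β ^ τ + τ * β ^ (τ - 1) * (α - β) ≤ α ^ τ := by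
    rcases hτ1.eq_or_lt with h | h
    · rw [← h]; simp
    · exact rpow_tangent_le' h hα hβ
  have h1 := rpow_tangent_le' (x := ‖a‖ ^ 2 + α ^ τ) hσ (by positivity) hY0
  set m := ((starRingEnd ℂ) b * a).re with hm
  have e1 : (((σ * Y ^ (σ - 1) * 2 : ℝ) : ℂ) * (starRingEnd ℂ) b * (a - b)).re
      = σ * Y ^ (σ - 1) * 2 * (m - ‖b‖ ^ 2) := by
    rw [mul_assoc, Complex.re_ofReal_mul, mul_sub, Complex.sub_re, ← hm,
      Complex.conj_mul']
    norm_cast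
  have e2 : ‖a - b‖ ^ 2 = ‖a‖ ^ 2 + ‖b‖ ^ 2 - 2 * m := by
    rw [← Complex.normSq_eq_norm_sq, ← Complex.normSq_eq_norm_sq, ← Complex.normSq_eq_norm_sq,
      Complex.normSq_sub, hm]
    congr 2
    simp [Complex.mul_re]; ring
  have h5 : 0 ≤ σ * Y ^ (σ - 1) := by positivity
  have h2 : σ * β * ‖a - b‖ ^ 2 ≤ σ * Y ^ (σ - 1) * ‖a - b‖ ^ 2 := by gcongr
  rw [e1]
  have h3 : σ * Y ^ (σ - 1) * (2 * (m - ‖b‖ ^ 2) + τ * β ^ (τ - 1) * (α - β) + ‖a - b‖ ^ 2)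
     ≤ σ * Y ^ (σ - 1) * (‖a‖ ^ 2 + α ^ τ - Y) := by
    gcongr
    rw [e2, hY]; linarith
  linarith

theorem quadratic_remainder_le {N M Q x δ m : ℝ} (hM : 0 ≤ M) (hR : 0 < N + M) (hQ : 0 ≤ Q)
    (hm : |m| ≤ x * δ) (hx2 : x ^ 2 ≤ Q * (N + M))
    (hδ : δ ^ 2 ≤ 4 * (Q * (N + M))) :
    1 / 8 * (N + M) * δ ^ 2 ≤ 2 * m * (M - N) + δ ^ 2 * M + 12 * Q * (M - N) ^ 2 := by
  have hamgm : -(1 / 8 * (N + M) * δ ^ 2 + 8 * Q * (M - N) ^ 2) ≤ 2 * m * (M - N) := by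
    have h1 : |2 * m * (M - N)| ≤ 2 * (x * δ) * |M - N| := by
      rw [abs_mul, abs_mul, abs_two]; gcongr
    have h2 : 2 * (x * δ) * |M - N| * (N + M) ≤
        (1 / 8 * (N + M) * δ ^ 2 + 8 * Q * (M - N) ^ 2) * (N + M) := by
      have h3 : 2 * (x * δ) * |M - N| * (N + M) ≤
          1 / 8 * ((N + M) * δ) ^ 2 + 8 * (x * |M - N|) ^ 2 := by
        have := sq_nonneg ((N + M) * δ - 8 * (x * |M - N|))
        linarith
      rw [mul_pow x, sq_abs] at h3
      have h4 := mul_le_mul_of_nonneg_right hx2 (sq_nonneg (M - N))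
      linarith
    have h5 := le_of_mul_le_mul_right h2 hR
    exact (abs_le.1 (h1.trans h5)).1
  have hK0 : 0 ≤ Q * (M - N) ^ 2 := by positivity
  rcases le_total ((N + M) / 4) M with h | h
  · have := mul_le_mul_of_nonneg_left h (sq_nonneg δ)
    linarith
  · have h1 : ((N + M) / 2) ^ 2 ≤ (N - M) ^ 2 := by
      gcongr; linarith
    have h2 := mul_le_mul_of_nonneg_left h1 hQ
    have h4 := mul_le_mul_of_nonneg_left hδ hR.le
    have h5 : 0 ≤ δ ^ 2 * M := by positivity
    linarith

/-- One-step gain for `‖u‖ ^ 2 * N + C * N ^ q` with `N = ‖u‖ ^ (p - 2) + w`, `4 ≤ p`,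
written with `k = p - 2` and `q = 1 + 2 / k`. -/
theorem norm_sq_mul_add_rpow_gain {k q : ℝ} (hk : 2 ≤ k) (hq : q = 1 + 2 / k) (b : ℂ)
    {β : ℝ} (hβ : 0 ≤ β) :
    ∃ c : ℂ, ∃ e : ℝ, ∀ (a : ℂ) (α : ℝ), 0 ≤ α →
      (‖b‖ ^ 2 * (‖b‖ ^ k + β) + 48 / (q * (q - 1)) * (‖b‖ ^ k + β) ^ q) +
        (c * (a - b)).re + e * (α - β) + 1 / 8 * β * ‖a - b‖ ^ 2 ≤
      ‖a‖ ^ 2 * (‖a‖ ^ k + α) + 48 / (q * (q - 1)) * (‖a‖ ^ k + α) ^ q := by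
  have hk0 : 0 < k := by linarith
  have hq1 : 1 < q := by rw [hq]; have : 0 < 2 / k := by positivity
                         linarith
  have hq2 : q ≤ 2 := by
    rw [hq]; have : 2 / k ≤ 1 := (div_le_one hk0).2 hk
    linarith
  set C := 48 / (q * (q - 1)) with hC
  have hqq : 0 < q * (q - 1) := mul_pos (by linarith) (by linarith)
  have hC0 : 0 < C := by positivity
  have hCq : C * (q * (q - 1) / 4) = 12 := by
    rw [hC]; field_simp [(by linarith : q - 1 ≠ 0)]; norm_num
  set N := ‖b‖ ^ k + β with hN
  have hN0 : 0 ≤ N := by positivity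
  have sq_le : ∀ (u : ℂ) (w : ℝ), 0 ≤ w → ‖u‖ ^ 2 ≤ (‖u‖ ^ k + w) ^ (q - 1) := by
    intro u w hw
    calc ‖u‖ ^ 2 = (‖u‖ ^ k) ^ (q - 1) := by
          rw [← Real.rpow_mul (norm_nonneg _), hq, ← Real.rpow_natCast]
          congr 1; push_cast; field_simp; ring
      _ ≤ _ := by
        have : 0 ≤ q - 1 := by linarith
        gcongr
        linarith
  refine ⟨(((‖b‖ ^ 2 + C * q * N ^ (q - 1)) * (k * ‖b‖ ^ (k - 2)) + 2 * N : ℝ) : ℂ) *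
    (starRingEnd ℂ) b, ‖b‖ ^ 2 + C * q * N ^ (q - 1), fun a α hα => ?_⟩
  set M := ‖a‖ ^ k + α with hM
  have hM0 : 0 ≤ M := by positivity
  set m := ((starRingEnd ℂ) b * a).re - ‖b‖ ^ 2 with hm
  have hmle : m ≤ (‖a‖ - ‖b‖) * ‖b‖ := by
    have : ((starRingEnd ℂ) b * a).re ≤ ‖a‖ * ‖b‖ := by
      calc _ ≤ ‖(starRingEnd ℂ) b * a‖ := Complex.re_le_norm _
        _ = _ := by rw [norm_mul, RCLike.norm_conj, mul_comm]
    rw [hm]; linarith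
  have e1 : ∀ t : ℝ, ((t : ℂ) * (starRingEnd ℂ) b * (a - b)).re = t * m := by
    intro t
    rw [mul_assoc, Complex.re_ofReal_mul, mul_sub, Complex.sub_re, Complex.conj_mul', hm]
    norm_cast
  have e2 : ‖a - b‖ ^ 2 = ‖a‖ ^ 2 - ‖b‖ ^ 2 - 2 * m := by
    rw [← Complex.normSq_eq_norm_sq, ← Complex.normSq_eq_norm_sq, Complex.normSq_sub, hm,
      ← Complex.normSq_eq_norm_sq]
    have : ((starRingEnd ℂ) b * a).re = (a * (starRingEnd ℂ) b).re := by rw [mul_comm]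
    rw [this]; ring
  have hmabs : |m| ≤ ‖b‖ * ‖a - b‖ := by
    have : m = ((starRingEnd ℂ) b * (a - b)).re := by
      have := e1 1
      simpa using this.symm
    rw [this]
    calc _ ≤ ‖(starRingEnd ℂ) b * (a - b)‖ := Complex.abs_re_le_norm _
      _ = _ := by rw [norm_mul, RCLike.norm_conj]
  set δ := ‖a - b‖ with hδ
  have hδ0 : 0 ≤ δ := norm_nonneg _
  have hδle : δ ^ 2 ≤ 2 * ‖a‖ ^ 2 + 2 * ‖b‖ ^ 2 := by
    have : δ ≤ ‖a‖ + ‖b‖ := norm_sub_le _ _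
    nlinarith [sq_nonneg (‖a‖ - ‖b‖), norm_nonneg a, norm_nonneg b]
  have hKL : k * ‖b‖ ^ (k - 2) * m + (α - β) ≤ M - N := by
    have h1 := rpow_tangent_le' (p := k) (by linarith) (norm_nonneg a) (norm_nonneg b)
    have h2 : k * ‖b‖ ^ (k - 2) * m ≤ k * ‖b‖ ^ (k - 1) * (‖a‖ - ‖b‖) := by
      rcases (norm_nonneg b).eq_or_lt with h | h
      · have hb : b = 0 := by simpa using h.symm
        have : m = 0 := by simp [hm, hb]
        rw [this, ← h]; simp [Real.zero_rpow (by linarith : k - 1 ≠ 0)]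
      · have : ‖b‖ ^ (k - 1) = ‖b‖ ^ (k - 2) * ‖b‖ := by
          rw [← Real.rpow_add_one h.ne']; congr 1; ring
        rw [this]
        have : k * ‖b‖ ^ (k - 2) * m ≤ k * ‖b‖ ^ (k - 2) * ((‖a‖ - ‖b‖) * ‖b‖) := by gcongr
        linarith
    rw [hM, hN]; linarith
  rw [e1]
  rcases (add_nonneg hN0 hM0).eq_or_lt with hR | hR
  · have hN' : N = 0 := by linarith
    have hM' : M = 0 := by linarith
    have hb0 : ‖b‖ ^ 2 ≤ 0 := by
      have := sq_le b β hβ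
      rwa [← hN, hN', Real.zero_rpow (by linarith)] at this
    have ha0 : ‖a‖ ^ 2 ≤ 0 := by
      have := sq_le a α hα
      rwa [← hM, hM', Real.zero_rpow (by linarith)] at this
    have hb1 : ‖b‖ = 0 := by nlinarith [norm_nonneg b]
    have hβ' : β = 0 := by
      have : 0 ≤ ‖b‖ ^ k := by positivity
      linarith
    rw [hN', hM', hb1, hβ']
    simp [Real.zero_rpow (by linarith : q - 1 ≠ 0)]
  set R := N + M with hRdef
  have hq3 := rpow_strong_tangent_le hq1 hq2 hM0 hN0 hR (by linarith) (by linarith)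
  have hRq : R ^ (q - 1) = R ^ (q - 2) * R := by
    rw [← Real.rpow_add_one hR.ne']; congr 1; ring
  have hRq0 : 0 ≤ R ^ (q - 2) := by positivity
  have hb2 : ‖b‖ ^ 2 ≤ R ^ (q - 2) * R := by
    rw [← hRq]
    exact (sq_le b β hβ).trans (Real.rpow_le_rpow hN0 (by linarith) (by linarith))
  have ha2 : ‖a‖ ^ 2 ≤ R ^ (q - 2) * R := by
    rw [← hRq]
    exact (sq_le a α hα).trans (Real.rpow_le_rpow hM0 (by linarith) (by linarith))
  have hβN : β ≤ R := by
    have : 0 ≤ ‖b‖ ^ k := by positivity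
    linarith
  have hrem : 1 / 8 * R * δ ^ 2 ≤ 2 * m * (M - N) + δ ^ 2 * M + 12 * R ^ (q - 2) * (M - N) ^ 2 :=
    quadratic_remainder_le hM0 hR hRq0 hmabs hb2 (by linarith)
  have hrem2 : 1 / 8 * β * δ ^ 2 ≤ 1 / 8 * R * δ ^ 2 := by gcongr
  have hlin := mul_le_mul_of_nonneg_left hKL
    (by positivity : 0 ≤ ‖b‖ ^ 2 + C * q * N ^ (q - 1))
  have hq4 := mul_le_mul_of_nonneg_left hq3 hC0.le
  have hq5 : C * (q * (q - 1) / 4 * R ^ (q - 2) * (M - N) ^ 2) =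
      12 * R ^ (q - 2) * (M - N) ^ 2 := by rw [← hCq]; ring
  have ea : ‖a‖ ^ 2 = ‖b‖ ^ 2 + 2 * m + δ ^ 2 := by linarith
  rw [ea]
  linarith

section Averages

variable {E : Type*} [NormedAddCommGroup E] [InnerProductSpace ℝ E] [FiniteDimensional ℝ E]
  [MeasurableSpace E] [BorelSpace E]
variable {V : Type*} [NormedAddCommGroup V] [NormedSpace ℝ V]

/-- Average of `u` around `x` at scale `t` with respect to `π`. -/
def avg (π : Measure E) (t : ℝ) (u : E → V) (x : E) : V := ∫ z, u (x - t • z) ∂π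

/-- Average of an extended nonnegative function around `x` at scale `t`. -/
def lavg (π : Measure E) (t : ℝ) (u : E → ℝ≥0∞) (x : E) : ℝ≥0∞ := ∫⁻ z, u (x - t • z) ∂π

theorem measurable_sub_smul (t : ℝ) : Measurable fun q : E × E => q.1 - t • q.2 := by
  fun_prop

theorem measurable_avg [MeasurableSpace V] [BorelSpace V] [SecondCountableTopology V]
    (π : Measure E) [SFinite π] (t : ℝ) {u : E → V} (hu : Measurable u) :
    Measurable (avg π t u) := by
  have : StronglyMeasurable fun q : E × E => u (q.1 - t • q.2) :=
    (hu.comp (measurable_sub_smul t)).stronglyMeasurable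
  exact this.integral_prod_right.measurable

theorem measurable_lavg (π : Measure E) [SFinite π] (t : ℝ) {u : E → ℝ≥0∞} (hu : Measurable u) :
    Measurable (lavg π t u) :=
  (hu.comp (measurable_sub_smul t)).lintegral_prod_right'

theorem norm_avg_le (π : Measure E) [IsProbabilityMeasure π] (t : ℝ) {u : E → V} {M : ℝ}
    (hM : ∀ x, ‖u x‖ ≤ M) (x : E) : ‖avg π t u x‖ ≤ M := by
  have := norm_integral_le_of_norm_le_const (μ := π) (f := fun z => u (x - t • z)) (C := M)
    (Eventually.of_forall fun z => hM _)
  simpa [avg] using this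

theorem enorm_avg_le (π : Measure E) (t : ℝ) (u : E → V) (x : E) :
    ‖avg π t u x‖ₑ ≤ lavg π t (fun y => ‖u y‖ₑ) x :=
  enorm_integral_le_lintegral_enorm _

theorem avg_nonneg (π : Measure E) (t : ℝ) {u : E → ℝ} (hu : ∀ x, 0 ≤ u x) (x : E) :
    0 ≤ avg π t u x := integral_nonneg fun _ => hu _

theorem integrable_translate [MeasurableSpace V] [BorelSpace V] [SecondCountableTopology V]
    (π : Measure E) [IsFiniteMeasure π] (t : ℝ) {u : E → V}
    (hu : Measurable u) {M : ℝ} (hM : ∀ x, ‖u x‖ ≤ M) (x : E) :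
    Integrable (fun z => u (x - t • z)) π :=
  Integrable.of_bound (hu.comp (by fun_prop)).aestronglyMeasurable M
    (Eventually.of_forall fun _ => hM _)

theorem lintegral_lavg (π : Measure E) [IsProbabilityMeasure π] (t : ℝ) {u : E → ℝ≥0∞}
    (hu : Measurable u) : ∫⁻ x, lavg π t u x = ∫⁻ x, u x := by
  unfold lavg
  rw [lintegral_lintegral_swap]
  · simp [lintegral_sub_right_eq_self]
  · exact (hu.comp (measurable_sub_smul t)).aemeasurable

theorem lintegral_mul_lavg_comm {π : Measure E} [SFinite π]
    (hsymm : π.map (fun z => -z) = π) (t : ℝ) {u v : E → ℝ≥0∞}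
    (hu : Measurable u) (hv : Measurable v) :
    ∫⁻ x, lavg π t u x * v x = ∫⁻ x, u x * lavg π t v x := by
  have hm := measurable_sub_smul (E := E) t
  have hl : ∀ x, lavg π t u x = ∫⁻ z, u (x + t • z) ∂π := by
    intro x
    unfold lavg
    conv_lhs => rw [← hsymm]
    rw [lintegral_map (by fun_prop) (by fun_prop)]
    simp
  have hm2 : Measurable fun q : E × E => q.1 + t • q.2 := by fun_prop
  calc ∫⁻ x, lavg π t u x * v x = ∫⁻ x, ∫⁻ z, u (x + t • z) * v x ∂π := by
        refine lintegral_congr fun x => ?_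
        rw [hl, lintegral_mul_const _ (by fun_prop)]
    _ = ∫⁻ z, (∫⁻ x, u (x + t • z) * v x) ∂π := by
        rw [lintegral_lintegral_swap]
        exact ((hu.comp hm2).mul (hv.comp measurable_fst)).aemeasurable
    _ = ∫⁻ z, (∫⁻ x, u x * v (x - t • z)) ∂π := by
        refine lintegral_congr fun z => ?_
        rw [← lintegral_sub_right_eq_self (fun x => u (x + t • z) * v x) (t • z)]
        simp
    _ = ∫⁻ x, ∫⁻ z, u x * v (x - t • z) ∂π := by
        rw [lintegral_lintegral_swap]
        exact ((hu.comp measurable_snd).mul (hv.comp (hm.comp measurable_swap))).aemeasurable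
    _ = _ := by
        refine lintegral_congr fun x => ?_
        rw [lavg, lintegral_const_mul _ (by fun_prop)]

theorem avg_avg [MeasurableSpace V] [BorelSpace V] [SecondCountableTopology V]
    {π : Measure E} [IsProbabilityMeasure π]
    (hπ : π.conv π = π.map fun z => (2 : ℝ) • z) (t : ℝ) {u : E → V} (hu : Measurable u)
    {M : ℝ} (hM : ∀ x, ‖u x‖ ≤ M) (x : E) :
    avg π t (avg π t u) x = avg π (2 * t) u x := by
  have h1 : ∫ w, u (x - t • w) ∂(π.conv π) = avg π (2 * t) u x := by
    rw [hπ, integral_map (by fun_prop)]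
    · simp only [avg, smul_smul]
      congr 1; ext z; rw [mul_comm]
    · exact (hu.comp (by fun_prop)).aestronglyMeasurable
  rw [← h1, integral_conv]
  · simp only [avg, smul_add, sub_sub]
  · exact integrable_translate _ t hu hM x

/-- Integrated form of a pointwise concavity inequality. -/
theorem bellman_step {Φ : ℂ → ℝ → ℝ} {gain : ℂ → ℂ → ℝ → ℝ}
    (hΦm : Measurable fun q : ℂ × ℝ => Φ q.1 q.2)
    (hΦ0 : ∀ a α, 0 ≤ α → 0 ≤ Φ a α)
    (hgm : Measurable fun q : ℂ × ℂ × ℝ => gain q.1 q.2.1 q.2.2)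
    (hg0 : ∀ a b β, 0 ≤ β → 0 ≤ gain a b β)
    (h : ∀ b β, 0 ≤ β → ∃ c : ℂ, ∃ e : ℝ, ∀ a α, 0 ≤ α →
      Φ b β + (c * (a - b)).re + e * (α - β) + gain a b β ≤ Φ a α)
    {μ : Measure E} [IsProbabilityMeasure μ] {A : E → ℂ} {α : E → ℝ}
    (hA : Measurable A) (hα : Measurable α) (hAi : Integrable A μ) (hαi : Integrable α μ)
    (hα0 : ∀ x, 0 ≤ α x) :
    ENNReal.ofReal (Φ (∫ z, A z ∂μ) (∫ z, α z ∂μ)) +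
      ∫⁻ z, ENNReal.ofReal (gain (A z) (∫ z, A z ∂μ) (∫ z, α z ∂μ)) ∂μ ≤
      ∫⁻ z, ENNReal.ofReal (Φ (A z) (α z)) ∂μ := by
  set b := ∫ z, A z ∂μ with hb
  set β := ∫ z, α z ∂μ with hβ
  have hβ0 : 0 ≤ β := integral_nonneg hα0
  obtain ⟨c, e, hce⟩ := h b β hβ0
  rcases eq_or_ne (∫⁻ z, ENNReal.ofReal (Φ (A z) (α z)) ∂μ) ∞ with htop | hfin
  · rw [htop]; exact le_top
  have hΦi : Integrable (fun z => Φ (A z) (α z)) μ := by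
    refine ⟨(hΦm.comp (hA.prodMk hα)).aestronglyMeasurable, ?_⟩
    rw [hasFiniteIntegral_iff_ofReal (Eventually.of_forall fun z => hΦ0 _ _ (hα0 z))]
    exact lt_top_iff_ne_top.2 hfin
  have hl1 : Integrable (fun z => (c * (A z - b)).re) μ :=
    ((hAi.sub (integrable_const b)).const_mul c).re
  have hl2 : Integrable (fun z => e * (α z - β)) μ :=
    (hαi.sub (integrable_const β)).const_mul e
  have hi1 : ∫ z, (c * (A z - b)).re ∂μ = 0 := by
    have := integral_re ((hAi.sub (integrable_const b)).const_mul c)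
    have e2 : ∫ z, c * (A z - b) ∂μ = 0 := by
      rw [integral_const_mul, integral_sub hAi (integrable_const b)]; simp [hb]
    simp only [Pi.sub_apply] at this
    rw [e2] at this
    simpa using this
  have hi2 : ∫ z, e * (α z - β) ∂μ = 0 := by
    rw [integral_const_mul, integral_sub hαi (integrable_const β)]; simp [hβ]
  have hgmeas : Measurable fun z => gain (A z) b β := by
    exact hgm.comp (hA.prodMk (measurable_const (a := (b, β))))
  have hR : Integrable (fun z => Φ (A z) (α z) - Φ b β - (c * (A z - b)).re - e * (α z - β)) μ :=
    ((hΦi.sub (integrable_const _)).sub hl1).sub hl2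
  have hgle : ∀ z, gain (A z) b β ≤ Φ (A z) (α z) - Φ b β - (c * (A z - b)).re - e * (α z - β) := by
    intro z
    have := hce (A z) (α z) (hα0 z)
    linarith
  have hgi : Integrable (fun z => gain (A z) b β) μ :=
    hR.mono' hgmeas.aestronglyMeasurable (Eventually.of_forall fun z => by
      rw [Real.norm_of_nonneg (hg0 _ _ _ hβ0)]; exact hgle z)
  have hInt := integral_mono hgi hR hgle
  have hΦb : Integrable (fun z => Φ (A z) (α z) - Φ b β) μ := hΦi.sub (integrable_const _)
  have hΦc : Integrable (fun z => Φ (A z) (α z) - Φ b β - (c * (A z - b)).re) μ := hΦb.sub hl1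
  rw [integral_sub hΦc hl2, integral_sub hΦb hl1, integral_sub hΦi (integrable_const _),
    hi1, hi2] at hInt
  simp only [integral_const, probReal_univ, smul_eq_mul, one_mul, sub_zero] at hInt
  rw [← ofReal_integral_eq_lintegral_ofReal hgi (Eventually.of_forall fun z => hg0 _ _ _ hβ0),
    ← ofReal_integral_eq_lintegral_ofReal hΦi (Eventually.of_forall fun z => hΦ0 _ _ (hα0 z)),
    ← ENNReal.ofReal_add (hΦ0 _ _ hβ0) (integral_nonneg fun z => hg0 _ _ _ hβ0)]
  exact ENNReal.ofReal_le_ofReal (by linarith)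

/-- The dyadic scale `2 ^ (-j)`. -/
def dy (j : ℕ) : ℝ := (2⁻¹ : ℝ) ^ j

theorem two_mul_dy_succ (j : ℕ) : 2 * dy (j + 1) = dy j := by
  rw [dy, dy, pow_succ]; ring

theorem dy_pos (j : ℕ) : 0 < dy j := by unfold dy; positivity

theorem dy_le_one (j : ℕ) : dy j ≤ 1 := by
  unfold dy; exact pow_le_one₀ (by norm_num) (by norm_num)

theorem bellman_sum {Φ : ℂ → ℝ → ℝ} {gain : ℂ → ℂ → ℝ → ℝ}
    (hΦm : Measurable fun q : ℂ × ℝ => Φ q.1 q.2)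
    (hΦ0 : ∀ a α, 0 ≤ α → 0 ≤ Φ a α)
    (hgm : Measurable fun q : ℂ × ℂ × ℝ => gain q.1 q.2.1 q.2.2)
    (hg0 : ∀ a b β, 0 ≤ β → 0 ≤ gain a b β)
    (h : ∀ b β, 0 ≤ β → ∃ c : ℂ, ∃ e : ℝ, ∀ a α, 0 ≤ α →
      Φ b β + (c * (a - b)).re + e * (α - β) + gain a b β ≤ Φ a α)
    {π : Measure E} [IsProbabilityMeasure π]
    (hπ : π.conv π = π.map fun z => (2 : ℝ) • z) {A : E → ℂ} {α : E → ℝ} {M : ℝ}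
    (hA : Measurable A) (hα : Measurable α) (hAM : ∀ x, ‖A x‖ ≤ M) (hαM : ∀ x, ‖α x‖ ≤ M)
    (hα0 : ∀ x, 0 ≤ α x) (n : ℕ) :
    ∑ j ∈ Finset.range n, ∫⁻ x, ∫⁻ z, ENNReal.ofReal
      (gain (avg π (dy (j + 1)) A (x - dy (j + 1) • z)) (avg π (dy j) A x) (avg π (dy j) α x)) ∂π ≤
    ∫⁻ x, ENNReal.ofReal (Φ (avg π (dy n) A x) (avg π (dy n) α x)) := by
  have hstep : ∀ j, (∫⁻ x, ENNReal.ofReal (Φ (avg π (dy j) A x) (avg π (dy j) α x))) +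
      ∫⁻ x, ∫⁻ z, ENNReal.ofReal (gain (avg π (dy (j + 1)) A (x - dy (j + 1) • z))
        (avg π (dy j) A x) (avg π (dy j) α x)) ∂π ≤
      ∫⁻ x, ENNReal.ofReal (Φ (avg π (dy (j + 1)) A x) (avg π (dy (j + 1)) α x)) := by
    intro j
    set t := dy (j + 1) with ht
    have hA1 := measurable_avg π t hA
    have hα1 := measurable_avg π t hα
    have hA0 := measurable_avg π (dy j) hA
    have hα0' := measurable_avg π (dy j) hα
    have hA1M := norm_avg_le π t hAM
    have hα1M := norm_avg_le π t hαM
    have hmΦ : Measurable fun x => ENNReal.ofReal (Φ (avg π t A x) (avg π t α x)) :=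
      (hΦm.comp (hA1.prodMk hα1)).ennreal_ofReal
    rw [← lintegral_lavg π t hmΦ, ← lintegral_add_left]
    · refine lintegral_mono fun x => ?_
      have eA : avg π (dy j) A x = ∫ z, avg π t A (x - t • z) ∂π := by
        rw [← two_mul_dy_succ, ← avg_avg hπ _ hA hAM]; rfl
      have eα : avg π (dy j) α x = ∫ z, avg π t α (x - t • z) ∂π := by
        rw [← two_mul_dy_succ, ← avg_avg hπ _ hα hαM]; rfl
      rw [eA, eα]
      exact bellman_step hΦm hΦ0 hgm hg0 h (A := fun z => avg π t A (x - t • z))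
        (α := fun z => avg π t α (x - t • z)) (by fun_prop) (by fun_prop)
        (integrable_translate π t hA1 hA1M x) (integrable_translate π t hα1 hα1M x)
        (fun z => avg_nonneg π t hα0 _)
    · exact (hΦm.comp (hA0.prodMk hα0')).ennreal_ofReal
  have : ∀ n, (∫⁻ x, ENNReal.ofReal (Φ (avg π (dy 0) A x) (avg π (dy 0) α x))) +
      ∑ j ∈ Finset.range n, ∫⁻ x, ∫⁻ z, ENNReal.ofReal
      (gain (avg π (dy (j + 1)) A (x - dy (j + 1) • z)) (avg π (dy j) A x) (avg π (dy j) α x)) ∂π ≤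
    ∫⁻ x, ENNReal.ofReal (Φ (avg π (dy n) A x) (avg π (dy n) α x)) := by
    intro n
    induction n with
    | zero => simp
    | succ n ih =>
      rw [Finset.sum_range_succ, ← add_assoc]
      exact (add_le_add_left ih _).trans (hstep n)
  exact le_add_self.trans (this n)

end Averages

theorem ENNReal.add_sq_le_two_mul (x y : ℝ≥0∞) : (x + y) ^ 2 ≤ 2 * (x ^ 2 + y ^ 2) := by
  have := ENNReal.rpow_add_le_mul_rpow_add_rpow x y (p := 2) (by norm_num)
  have e : (2 : ℝ) - 1 = 1 := by norm_num
  rw [e, ENNReal.rpow_one] at this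
  exact_mod_cast this

theorem lintegral_rpow_inv_le {α : Type*} [MeasurableSpace α] {μ : Measure α}
    [IsProbabilityMeasure μ] {r : ℝ} (hr : 1 < r) {G : α → ℝ≥0∞} (hG : AEMeasurable G μ) :
    ∫⁻ z, G z ^ (1 / r) ∂μ ≤ (∫⁻ z, G z ∂μ) ^ (1 / r) := by
  have h := ENNReal.lintegral_mul_le_Lp_mul_Lq μ (Real.HolderConjugate.conjExponent hr)
    (hG.pow_const (1 / r)) (g := fun _ => 1) aemeasurable_const
  have hr0 : r ≠ 0 := by linarith
  simpa [← ENNReal.rpow_mul, hr0] using h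

theorem norm_sub_le_of_gain {p l : ℝ} (hp : 1 < p) (hp2 : p ≤ 2) {a b : ℂ} (hb : ‖b‖ ≤ l) :
    ‖a - b‖ ≤ 12 / (p * (p - 1)) * (l ^ ((2 - p) / 2) *
      (p * (p - 1) / 4 * (‖a‖ + ‖b‖) ^ (p - 2) * ‖a - b‖ ^ 2) ^ (1 / 2 : ℝ) +
      (p * (p - 1) / 4 * (‖a‖ + ‖b‖) ^ (p - 2) * ‖a - b‖ ^ 2) ^ (1 / p)) := by
  have hl : 0 ≤ l := (norm_nonneg _).trans hb
  set δ := ‖a - b‖ with hδ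
  have hk : 0 < p * (p - 1) := mul_pos (by linarith) (by linarith)
  have hk2 : p * (p - 1) ≤ 2 := by nlinarith
  set κ := p * (p - 1) / 12 with hκ
  have hκ0 : 0 < κ := by positivity
  have hκ1 : κ ≤ 1 := by rw [hκ]; linarith
  set g := p * (p - 1) / 4 * (‖a‖ + ‖b‖) ^ (p - 2) * δ ^ 2 with hg
  have hg0 : 0 ≤ g := by positivity
  rcases (norm_nonneg (a - b)).eq_or_lt with h0 | h0
  · rw [← hδ] at h0
    rw [← h0]; positivity
  have hp0 : 0 < p := by linarith
  have hR0 : 0 < ‖a‖ + ‖b‖ := h0.trans_le (norm_sub_le a b)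
  have ha : ‖a‖ ≤ δ + ‖b‖ := by
    have := norm_add_le (a - b) b
    simpa using this
  have h3 : (1 / 3 : ℝ) ≤ 3 ^ (p - 2) := by
    calc (1 / 3 : ℝ) = 3 ^ (-1 : ℝ) := by rw [Real.rpow_neg_one]; norm_num
      _ ≤ _ := Real.rpow_le_rpow_of_exponent_le (by norm_num) (by linarith)
  have hgm : ∀ m, 0 < m → δ ≤ m → ‖b‖ ≤ m → κ * m ^ (p - 2) * δ ^ 2 ≤ g := by
    intro m hm h1 h2
    have h4 : (3 * m) ^ (p - 2) ≤ (‖a‖ + ‖b‖) ^ (p - 2) :=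
      Real.rpow_le_rpow_of_nonpos hR0 (by linarith) (by linarith)
    rw [Real.mul_rpow (by norm_num) hm.le] at h4
    have h5 : 1 / 3 * m ^ (p - 2) ≤ (‖a‖ + ‖b‖) ^ (p - 2) := le_trans (by gcongr) h4
    rw [hg, hκ]
    calc _ = p * (p - 1) / 4 * (1 / 3 * m ^ (p - 2)) * δ ^ 2 := by ring
      _ ≤ _ := by gcongr
  have hinv : 12 / (p * (p - 1)) = κ⁻¹ := by rw [hκ, inv_div]
  rw [hinv, inv_mul_eq_div, le_div_iff₀ hκ0]
  rcases le_or_gt δ l with h | h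
  · have hl0 : 0 < l := lt_of_lt_of_le h0 h
    have h1 := hgm l hl0 h hb
    have h2 : κ * δ ≤ l ^ ((2 - p) / 2) * g ^ (1 / 2 : ℝ) := by
      refine le_of_sq_le_sq ?_ (by positivity)
      have e1 : (l ^ ((2 - p) / 2)) ^ 2 = l ^ (2 - p) := by
        rw [← Real.rpow_natCast, ← Real.rpow_mul hl]; congr 1; push_cast; ring
      have e2 : (g ^ (1 / 2 : ℝ)) ^ 2 = g := by
        rw [← Real.rpow_natCast, ← Real.rpow_mul hg0]; norm_num
      have e3 : l ^ (2 - p) * l ^ (p - 2) = 1 := by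
        rw [← Real.rpow_add hl0]; simp
      rw [mul_pow _ (g ^ _), e1, e2, mul_pow]
      calc κ ^ 2 * δ ^ 2 ≤ κ * δ ^ 2 := by
            gcongr; nlinarith
        _ = l ^ (2 - p) * (κ * l ^ (p - 2) * δ ^ 2) := by
            linear_combination (-κ * δ ^ 2) * e3
        _ ≤ _ := by gcongr
    have : 0 ≤ g ^ (1 / p) := by positivity
    linarith
  · have h1 := hgm δ h0 le_rfl (hb.trans h.le)
    have e : δ ^ (p - 2) * δ ^ 2 = δ ^ p := by
      rw [← Real.rpow_natCast, ← Real.rpow_add h0]; congr 1; push_cast; ring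
    rw [mul_assoc, e] at h1
    have h2 : κ * δ ≤ g ^ (1 / p) := by
      calc κ * δ ≤ κ ^ (1 / p) * δ := by
            gcongr
            apply Real.self_le_rpow_of_le_one hκ0.le hκ1
            rw [div_le_one hp0]; exact hp.le
        _ = (κ * δ ^ p) ^ (1 / p) := by
            rw [Real.mul_rpow hκ0.le (by positivity), ← Real.rpow_mul h0.le]
            rw [mul_one_div_cancel hp0.ne', Real.rpow_one]
        _ ≤ _ := by gcongr
    have : 0 ≤ l ^ ((2 - p) / 2) * g ^ (1 / 2 : ℝ) := by positivity
    linarith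

theorem ENNReal.sum_sq_rpow_half_le {p : ℝ} (hp : 1 < p) (hp2 : p ≤ 2) {ι : Type*}
    (s : Finset ι) {o I : ι → ℝ≥0∞} {c L : ℝ≥0∞}
    (h : ∀ j, o j ≤ c * (L ^ ((2 - p) / 2) * I j ^ (1 / 2 : ℝ) + I j ^ (1 / p))) :
    (∑ j ∈ s, o j ^ 2) ^ (p / 2) ≤ (2 * c ^ 2) ^ (p / 2) * (L ^ p + 2 * ∑ j ∈ s, I j) := by
  have hp0 : 0 < p := by linarith
  have hp2' : 0 ≤ p / 2 := by linarith
  have hq : 0 ≤ 2 / p - 1 := by rw [sub_nonneg, le_div_iff₀ hp0]; linarith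
  set J := ∑ j ∈ s, I j with hJ
  have hIJ : ∀ j ∈ s, I j ≤ J := fun j hj =>
    Finset.single_le_sum (f := I) (fun _ _ => zero_le) hj
  have e1 : ∀ y : ℝ≥0∞, y ^ (2 / p) = y * y ^ (2 / p - 1) := by
    intro y
    conv_rhs => enter [1]; rw [← ENNReal.rpow_one y]
    rw [← ENNReal.rpow_add_of_nonneg _ _ zero_le_one hq]
    congr 1; ring
  have h1 : ∑ j ∈ s, o j ^ 2 ≤ 2 * c ^ 2 * (L ^ (2 - p) * J + J ^ (2 / p)) := by
    calc ∑ j ∈ s, o j ^ 2 ≤ ∑ j ∈ s, 2 * c ^ 2 * (L ^ (2 - p) * I j + I j * J ^ (2 / p - 1)) := by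
          refine Finset.sum_le_sum fun j hj => ?_
          calc o j ^ 2 ≤ (c * (L ^ ((2 - p) / 2) * I j ^ (1 / 2 : ℝ) + I j ^ (1 / p))) ^ 2 := by
                gcongr; exact h j
            _ = c ^ 2 * (L ^ ((2 - p) / 2) * I j ^ (1 / 2 : ℝ) + I j ^ (1 / p)) ^ 2 := by
                rw [mul_pow]
            _ ≤ c ^ 2 * (2 * ((L ^ ((2 - p) / 2) * I j ^ (1 / 2 : ℝ)) ^ 2 +
                (I j ^ (1 / p)) ^ 2)) := by gcongr; exact ENNReal.add_sq_le_two_mul _ _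
            _ = 2 * c ^ 2 * (L ^ (2 - p) * I j + I j ^ (2 / p)) := by
                have e2 : (L ^ ((2 - p) / 2)) ^ 2 = L ^ (2 - p) := by
                  rw [← ENNReal.rpow_natCast, ← ENNReal.rpow_mul]; congr 1; push_cast; ring
                have e3 : (I j ^ (1 / 2 : ℝ)) ^ 2 = I j := by
                  rw [← ENNReal.rpow_natCast, ← ENNReal.rpow_mul]; norm_num
                have e4 : (I j ^ (1 / p)) ^ 2 = I j ^ (2 / p) := by
                  rw [← ENNReal.rpow_natCast, ← ENNReal.rpow_mul]; congr 1; push_cast; ring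
                rw [mul_pow, e2, e3, e4]; ring
            _ ≤ _ := by
                rw [e1 (I j)]
                have := hIJ j hj
                gcongr
      _ = _ := by
          rw [← Finset.mul_sum, Finset.sum_add_distrib, ← Finset.mul_sum, ← Finset.sum_mul,
            ← hJ, ← e1]
  have e5 : (J ^ (2 / p)) ^ (p / 2) = J := by
    rw [← ENNReal.rpow_mul]; field_simp; rw [ENNReal.rpow_one]
  have e6 : (L ^ (2 - p)) ^ (p / 2) = (L ^ p) ^ (1 - p / 2) := by
    rw [← ENNReal.rpow_mul, ← ENNReal.rpow_mul]; congr 1; ring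
  have e7 : (L ^ p) ^ (1 - p / 2) * J ^ (p / 2) ≤ L ^ p + J := by
    have : 0 ≤ 1 - p / 2 := by linarith
    calc (L ^ p) ^ (1 - p / 2) * J ^ (p / 2)
        ≤ (L ^ p + J) ^ (1 - p / 2) * (L ^ p + J) ^ (p / 2) := by
          gcongr
          · exact le_self_add
          · exact le_add_self
      _ = _ := by
          rw [← ENNReal.rpow_add_of_nonneg _ _ this hp2']; simp
  calc (∑ j ∈ s, o j ^ 2) ^ (p / 2)
      ≤ (2 * c ^ 2 * (L ^ (2 - p) * J + J ^ (2 / p))) ^ (p / 2) := by gcongr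
    _ = (2 * c ^ 2) ^ (p / 2) * (L ^ (2 - p) * J + J ^ (2 / p)) ^ (p / 2) := by
        rw [ENNReal.mul_rpow_of_nonneg _ _ hp2']
    _ ≤ (2 * c ^ 2) ^ (p / 2) * ((L ^ (2 - p) * J) ^ (p / 2) + (J ^ (2 / p)) ^ (p / 2)) := by
        gcongr; exact ENNReal.rpow_add_le_add_rpow _ _ hp2' (by linarith)
    _ ≤ _ := by
        rw [e5, ENNReal.mul_rpow_of_nonneg _ J hp2', e6, two_mul J, ← add_assoc]
        gcongr

theorem measurable_gain_lt_two (p : ℝ) : Measurable fun q : ℂ × ℂ × ℝ =>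
    p * (p - 1) / 4 * (‖q.1‖ + ‖q.2.1‖) ^ (p - 2) * ‖q.1 - q.2.1‖ ^ 2 := by
  fun_prop

theorem lintegral_enorm_sub_le_of_gain {p : ℝ} (hp : 1 < p) (hp2 : p ≤ 2) {α : Type*}
    [MeasurableSpace α] {μ : Measure α} [IsProbabilityMeasure μ] {a : α → ℂ} (ha : Measurable a)
    {b : ℂ} {L : ℝ≥0∞} (hL : L ≠ ∞) (hb : ‖b‖ₑ ≤ L) {I : ℝ≥0∞}
    (hI : ∫⁻ z, ENNReal.ofReal (p * (p - 1) / 4 * (‖a z‖ + ‖b‖) ^ (p - 2) * ‖a z - b‖ ^ 2) ∂μ = I) :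
    ∫⁻ z, ‖a z - b‖ₑ ∂μ ≤ (12 / (p * (p - 1))).toNNReal *
      (L ^ ((2 - p) / 2) * I ^ (1 / 2 : ℝ) + I ^ (1 / p)) := by
  have hp0 : 0 < p := by linarith
  have hpp : 0 < p * (p - 1) := mul_pos hp0 (by linarith)
  have hc0 : 0 ≤ 12 / (p * (p - 1)) := by positivity
  set c := 12 / (p * (p - 1)) with hc
  set g : α → ℝ := fun z => p * (p - 1) / 4 * (‖a z‖ + ‖b‖) ^ (p - 2) * ‖a z - b‖ ^ 2 with hg
  have hg0 : ∀ z, 0 ≤ g z := fun z => by simp only [hg]; positivity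
  have hgm : Measurable g := by fun_prop
  have hbL : ‖b‖ ≤ L.toReal := by
    rw [← toReal_enorm]
    exact ENNReal.toReal_mono hL hb
  have hpt : ∀ z, ‖a z - b‖ₑ ≤ c.toNNReal * (L ^ ((2 - p) / 2) *
      ENNReal.ofReal (g z) ^ (1 / 2 : ℝ) + ENNReal.ofReal (g z) ^ (1 / p)) := by
    intro z
    have h : ‖a z - b‖ ≤ c * (L.toReal ^ ((2 - p) / 2) * g z ^ (1 / 2 : ℝ) + g z ^ (1 / p)) :=
      norm_sub_le_of_gain hp hp2 hbL
    have h0 := hg0 z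
    have h2 := ENNReal.ofReal_le_ofReal h
    rw [ofReal_norm, ENNReal.ofReal_mul hc0, ENNReal.ofReal_add (by positivity)
      (by positivity), ENNReal.ofReal_mul (by positivity),
      ← ENNReal.ofReal_rpow_of_nonneg (by positivity) (by linarith),
      ← ENNReal.ofReal_rpow_of_nonneg h0 (by norm_num),
      ← ENNReal.ofReal_rpow_of_nonneg h0 (by positivity),
      ENNReal.ofReal_toReal hL] at h2
    exact h2
  have hGz : Measurable fun z => ENNReal.ofReal (g z) := hgm.ennreal_ofReal
  calc ∫⁻ z, ‖a z - b‖ₑ ∂μ ≤ _ := lintegral_mono hpt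
    _ = c.toNNReal * (L ^ ((2 - p) / 2) * (∫⁻ z, ENNReal.ofReal (g z) ^ (1 / 2 : ℝ) ∂μ) +
        ∫⁻ z, ENNReal.ofReal (g z) ^ (1 / p) ∂μ) := by
        rw [lintegral_const_mul _ (by fun_prop), lintegral_add_right _ (by fun_prop),
          lintegral_const_mul _ (by fun_prop)]
    _ ≤ _ := by
        rw [← hI]
        gcongr
        · exact lintegral_rpow_inv_le (by norm_num) hGz.aemeasurable
        · exact lintegral_rpow_inv_le hp hGz.aemeasurable

section SquareFunction

variable {E : Type*} [NormedAddCommGroup E] [InnerProductSpace ℝ E] [FiniteDimensional ℝ E]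
  [MeasurableSpace E] [BorelSpace E]

/-- The dyadic maximal function attached to `π`. -/
def pmax (π : Measure E) (u : E → ℝ≥0∞) (x : E) : ℝ≥0∞ := ⨆ j : ℕ, lavg π (dy j) u x

/-- The mean oscillation between consecutive scales. -/
def osc (π : Measure E) (F : E → ℂ) (j : ℕ) (x : E) : ℝ≥0∞ :=
  ∫⁻ z, ‖avg π (dy (j + 1)) F (x - dy (j + 1) • z) - avg π (dy j) F x‖ₑ ∂π

theorem lavg_le_pmax (π : Measure E) (u : E → ℝ≥0∞) (j : ℕ) (x : E) :
    lavg π (dy j) u x ≤ pmax π u x := le_iSup (fun j => lavg π (dy j) u x) j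

theorem measurable_pmax (π : Measure E) [SFinite π] {u : E → ℝ≥0∞} (hu : Measurable u) :
    Measurable (pmax π u) := Measurable.iSup fun j => measurable_lavg π (dy j) hu

theorem measurable_osc (π : Measure E) [SFinite π] {F : E → ℂ} (hF : Measurable F) (j : ℕ) :
    Measurable (osc π F j) := by
  have h1 := measurable_avg π (dy (j + 1)) hF
  have h0 := measurable_avg π (dy j) hF
  refine Measurable.lintegral_prod_right' (f := fun q : E × E =>
    ‖avg π (dy (j + 1)) F (q.1 - dy (j + 1) • q.2) - avg π (dy j) F q.1‖ₑ) ?_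
  exact ((h1.comp (measurable_sub_smul _)).sub (h0.comp measurable_fst)).enorm

theorem pmax_lt_top (π : Measure E) [IsProbabilityMeasure π] {F : E → ℂ} {M : ℝ}
    (hM : ∀ x, ‖F x‖ ≤ M) (x : E) : pmax π (fun y => ‖F y‖ₑ) x < ∞ := by
  refine lt_of_le_of_lt (iSup_le fun j => ?_) (ENNReal.ofReal_lt_top (r := M))
  calc lavg π (dy j) (fun y => ‖F y‖ₑ) x ≤ ∫⁻ z, ENNReal.ofReal M ∂π := by
        refine lintegral_mono fun z => ?_
        show ‖F _‖ₑ ≤ _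
        rw [← ofReal_norm]
        exact ENNReal.ofReal_le_ofReal (hM _)
    _ = _ := by simp

theorem lintegral_osc_sq_le_of_le_two {p : ℝ} (hp : 1 < p) (hp2 : p ≤ 2)
    {π : Measure E} [IsProbabilityMeasure π]
    (hπ : π.conv π = π.map fun z => (2 : ℝ) • z) {K : ℝ≥0}
    (hK : ∀ u : E → ℝ≥0∞, Measurable u → ∫⁻ x, pmax π u x ^ p ≤ K * ∫⁻ x, u x ^ p) :
    ∃ C : ℝ≥0, ∀ (F : E → ℂ) (M : ℝ), Measurable F → (∀ x, ‖F x‖ ≤ M) → ∀ n : ℕ,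
      ∫⁻ x, (∑ j ∈ Finset.range n, osc π F j x ^ 2) ^ (p / 2) ≤ C * ∫⁻ x, ‖F x‖ₑ ^ p := by
  have hp0 : 0 < p := by linarith
  set c : ℝ := 12 / (p * (p - 1)) with hc
  have hpp : 0 < p * (p - 1) := mul_pos hp0 (by linarith)
  have hc0 : 0 ≤ c := by positivity
  set c' : ℝ≥0 := c.toNNReal with hc'
  refine ⟨(2 * c' ^ 2) ^ (p / 2) * (3 * K), fun F M hF hM n => ?_⟩
  set L : E → ℝ≥0∞ := pmax π fun y => ‖F y‖ₑ with hL
  have hLm : Measurable L := measurable_pmax π hF.enorm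
  have hLtop : ∀ x, L x < ∞ := pmax_lt_top π hM
  set gain : ℂ → ℂ → ℝ → ℝ := fun a b _ =>
    p * (p - 1) / 4 * (‖a‖ + ‖b‖) ^ (p - 2) * ‖a - b‖ ^ 2 with hgain
  set G : ℕ → E → E → ℝ≥0∞ := fun j x z => ENNReal.ofReal
    (gain (avg π (dy (j + 1)) F (x - dy (j + 1) • z)) (avg π (dy j) F x) 0) with hG
  have hGm : ∀ j, Measurable fun q : E × E => G j q.1 q.2 := by
    intro j
    have h1 := measurable_avg π (dy (j + 1)) hF
    have h0 := measurable_avg π (dy j) hF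
    exact ((measurable_gain_lt_two p).comp ((h1.comp (measurable_sub_smul _)).prodMk
      ((h0.comp measurable_fst).prodMk (measurable_const (a := (0 : ℝ)))))).ennreal_ofReal
  set I : ℕ → E → ℝ≥0∞ := fun j x => ∫⁻ z, G j x z ∂π with hI
  have hIm : ∀ j, Measurable (I j) := fun j => (hGm j).lintegral_prod_right'
  set J : E → ℝ≥0∞ := fun x => ∑ j ∈ Finset.range n, I j x with hJ
  have hJint : ∫⁻ x, J x ≤ K * ∫⁻ x, ‖F x‖ₑ ^ p := by
    have hb := bellman_sum (Φ := fun a _ => ‖a‖ ^ p) (gain := gain) (π := π) (A := F)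
      (α := fun _ => 0) (M := M) (by fun_prop) (fun a α _ => by positivity)
      (measurable_gain_lt_two p) (fun a b β _ => by simp only [hgain]; positivity) (fun b β _ => by
        obtain ⟨c, hc⟩ := norm_rpow_gain hp hp2 b
        exact ⟨c, 0, fun a α _ => by simpa using hc a⟩) hπ hF measurable_const hM
      (fun x => by simpa using (norm_nonneg _).trans (hM x)) (fun _ => le_rfl) n
    have h1 : ∫⁻ x, J x = ∑ j ∈ Finset.range n, ∫⁻ x, I j x :=
      lintegral_finsetSum _ fun j _ => hIm j
    rw [h1]
    refine (hb.trans (lintegral_mono fun x => ?_)).trans (hK _ hF.enorm)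
    rw [← ENNReal.ofReal_rpow_of_nonneg (norm_nonneg _) hp0.le, ofReal_norm]
    gcongr
    exact (enorm_avg_le π _ F x).trans (lavg_le_pmax _ _ _ _)
  have hosc : ∀ j x, osc π F j x ≤ c' * (L x ^ ((2 - p) / 2) * I j x ^ (1 / 2 : ℝ) +
      I j x ^ (1 / p)) := by
    intro j x
    refine lintegral_enorm_sub_le_of_gain hp hp2 ?_ (hLtop x).ne
      ((enorm_avg_le π _ F x).trans (lavg_le_pmax _ _ _ _)) rfl
    exact (measurable_avg π (dy (j + 1)) hF).comp (by fun_prop)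
  have hpt : ∀ x, (∑ j ∈ Finset.range n, osc π F j x ^ 2) ^ (p / 2) ≤
      (2 * c' ^ 2) ^ (p / 2) * (L x ^ p + 2 * J x) := by
    intro x
    exact ENNReal.sum_sq_rpow_half_le hp hp2 _ fun j => hosc j x
  calc _ ≤ ∫⁻ x, (2 * c' ^ 2) ^ (p / 2) * (L x ^ p + 2 * J x) := lintegral_mono hpt
    _ = (2 * c' ^ 2) ^ (p / 2) * ((∫⁻ x, L x ^ p) + 2 * ∫⁻ x, J x) := by
        have hJm : Measurable J := Finset.measurable_sum _ fun j _ => hIm j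
        rw [lintegral_const_mul _ (by fun_prop), lintegral_add_left (by fun_prop),
          lintegral_const_mul _ (by fun_prop)]
    _ ≤ (2 * c' ^ 2) ^ (p / 2) * (K * (∫⁻ x, ‖F x‖ₑ ^ p) + 2 * (K * ∫⁻ x, ‖F x‖ₑ ^ p)) := by
        gcongr
        exact hK _ hF.enorm
    _ = _ := by
        rw [ENNReal.coe_mul, ENNReal.coe_rpow_of_nonneg _ (by positivity)]
        push_cast
        ring

end SquareFunction

/-- A Bellman function for the weighted square function bound. -/
theorem exists_bellman_of_two_lt {p q : ℝ} (hp : 2 < p) (hq : q = p / (p - 2)) :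
    ∃ (Φ : ℂ → ℝ → ℝ) (c C : ℝ), 0 < c ∧ 0 < C ∧ (Measurable fun z : ℂ × ℝ => Φ z.1 z.2) ∧
      (∀ a α, 0 ≤ α → 0 ≤ Φ a α) ∧ (∀ a α, 0 ≤ α → Φ a α ≤ C * (‖a‖ ^ p + α ^ q)) ∧
      (∀ b β, 0 ≤ β → ∃ c' : ℂ, ∃ e : ℝ, ∀ a α, 0 ≤ α →
        Φ b β + (c' * (a - b)).re + e * (α - β) + c * β * ‖a - b‖ ^ 2 ≤ Φ a α) := by
  have hp2 : 0 < p - 2 := by linarith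
  have key : ∀ {x y r : ℝ}, 0 ≤ x → 0 ≤ y → 1 ≤ r →
      (x + y) ^ r ≤ 2 ^ (r - 1) * (x ^ r + y ^ r) := by
    intro x y r hx hy hr
    lift x to ℝ≥0 using hx
    lift y to ℝ≥0 using hy
    exact_mod_cast NNReal.rpow_add_le_mul_rpow_add_rpow x y hr
  rcases le_or_gt p 4 with h4 | h4
  · refine ⟨fun a α => (‖a‖ ^ 2 + α ^ (p / 2 - 1)⁻¹) ^ (p / 2), p / 2, 2 ^ (p / 2 - 1),
      by linarith, by positivity, by fun_prop, fun a α hα => by positivity, fun a α hα => ?_,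
      fun b β hβ => norm_sq_add_rpow_gain (by linarith) (by linarith) b hβ⟩
    have h1 : (0 : ℝ) ≤ α ^ (p / 2 - 1)⁻¹ := by positivity
    refine (key (by positivity) h1 (by linarith)).trans_eq ?_
    have e1 : (p / 2 - 1)⁻¹ * (p / 2) = q := by
      have : p / 2 - 1 ≠ 0 := by linarith
      have : p - 2 ≠ 0 := hp2.ne'
      rw [hq]; field_simp
    have e2 : ((2 : ℕ) : ℝ) * (p / 2) = p := by push_cast; ring
    rw [← Real.rpow_mul hα, ← Real.rpow_natCast, ← Real.rpow_mul (norm_nonneg a), e1, e2]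
  · have hk0 : p - 2 ≠ 0 := hp2.ne'
    have hq' : q = 1 + 2 / (p - 2) := by rw [hq]; field_simp; ring
    have hq1 : 1 < q := by rw [hq']; have : 0 < 2 / (p - 2) := by positivity
                           linarith
    have hq0 : 0 < q * (q - 1) := mul_pos (by linarith) (by linarith)
    refine ⟨fun a α => ‖a‖ ^ 2 * (‖a‖ ^ (p - 2) + α) +
      48 / (q * (q - 1)) * (‖a‖ ^ (p - 2) + α) ^ q, 1 / 8,
      (1 + 48 / (q * (q - 1))) * 2 ^ (q - 1), by norm_num, by positivity, by fun_prop,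
      fun a α hα => by positivity, fun a α hα => ?_,
      fun b β hβ => norm_sq_mul_add_rpow_gain (by linarith) hq' b hβ⟩
    set m := ‖a‖ ^ (p - 2) + α with hm
    have hm0 : 0 ≤ m := by positivity
    have h1 : ‖a‖ ^ 2 ≤ m ^ (2 / (p - 2)) := by
      calc ‖a‖ ^ 2 = (‖a‖ ^ (p - 2)) ^ (2 / (p - 2)) := by
            rw [← Real.rpow_mul (norm_nonneg a), mul_div_cancel₀ _ hk0]; norm_num
        _ ≤ _ := Real.rpow_le_rpow (by positivity) (by rw [hm]; linarith) (by positivity)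
    have h2 : ‖a‖ ^ 2 * m ≤ m ^ q := by
      calc ‖a‖ ^ 2 * m ≤ m ^ (2 / (p - 2)) * m ^ (1 : ℝ) := by rw [Real.rpow_one]; gcongr
        _ = m ^ q := by
          rw [← Real.rpow_add_of_nonneg hm0 (by positivity) zero_le_one, hq', add_comm]
    have h3 : m ^ q ≤ 2 ^ (q - 1) * (‖a‖ ^ p + α ^ q) := by
      refine (key (by positivity) hα hq1.le).trans_eq ?_
      rw [← Real.rpow_mul (norm_nonneg a), hq, mul_div_cancel₀ _ hk0]
    calc ‖a‖ ^ 2 * m + 48 / (q * (q - 1)) * m ^ q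
        ≤ m ^ q + 48 / (q * (q - 1)) * m ^ q := add_le_add_left h2 _
      _ = (1 + 48 / (q * (q - 1))) * m ^ q := by ring
      _ ≤ (1 + 48 / (q * (q - 1))) * (2 ^ (q - 1) * (‖a‖ ^ p + α ^ q)) := by gcongr
      _ = _ := by ring

section SquareFunction

variable {E : Type*} [NormedAddCommGroup E] [InnerProductSpace ℝ E] [FiniteDimensional ℝ E]
  [MeasurableSpace E] [BorelSpace E]

theorem osc_sq_le (π : Measure E) [IsProbabilityMeasure π] {F : E → ℂ} (hF : Measurable F)
    (j : ℕ) (x : E) : osc π F j x ^ 2 ≤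
      ∫⁻ z, ‖avg π (dy (j + 1)) F (x - dy (j + 1) • z) - avg π (dy j) F x‖ₑ ^ 2 ∂π := by
  have h1 := measurable_avg π (dy (j + 1)) hF
  have hm : Measurable fun z =>
      ‖avg π (dy (j + 1)) F (x - dy (j + 1) • z) - avg π (dy j) F x‖ₑ := by fun_prop
  have h := lintegral_rpow_inv_le (μ := π) (r := 2) (by norm_num) (hm.pow_const 2).aemeasurable
  have e : ∀ y : ℝ≥0∞, (y ^ 2) ^ (1 / 2 : ℝ) = y := fun y => by
    rw [← ENNReal.rpow_natCast, ← ENNReal.rpow_mul]; norm_num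
  have e' : ∀ y : ℝ≥0∞, (y ^ (1 / 2 : ℝ)) ^ 2 = y := fun y => by
    rw [← ENNReal.rpow_natCast, ← ENNReal.rpow_mul]; norm_num
  simp only [e] at h
  calc _ ≤ _ := pow_le_pow_left' h 2
    _ = _ := e' _

theorem sum_lintegral_osc_sq_mul_le {p q : ℝ} (hp : 2 < p) (hq : q = p / (p - 2))
    {π : Measure E} [IsProbabilityMeasure π]
    (hπ : π.conv π = π.map fun z => (2 : ℝ) • z) {K : ℝ≥0}
    (hKp : ∀ u : E → ℝ≥0∞, Measurable u → ∫⁻ x, pmax π u x ^ p ≤ K * ∫⁻ x, u x ^ p)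
    (hKq : ∀ u : E → ℝ≥0∞, Measurable u → ∫⁻ x, pmax π u x ^ q ≤ K * ∫⁻ x, u x ^ q) :
    ∃ C : ℝ≥0, ∀ (F : E → ℂ) (w : E → ℝ) (M : ℝ), Measurable F → Measurable w →
      (∀ x, ‖F x‖ ≤ M) → (∀ x, w x ≤ M) → (∀ x, 0 ≤ w x) → ∀ n : ℕ,
      ∑ j ∈ Finset.range n, ∫⁻ x, lavg π (dy j) (fun y => ENNReal.ofReal (w y)) x *
        osc π F j x ^ 2 ≤
      C * ((∫⁻ x, ‖F x‖ₑ ^ p) + ∫⁻ x, ENNReal.ofReal (w x) ^ q) := by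
  have hp0 : 0 < p := by linarith
  have hq0 : 0 < q := by rw [hq]; exact div_pos hp0 (by linarith)
  obtain ⟨Φ, c, C, hc, hC, hΦm, hΦ0, hΦC, hΦ⟩ := exists_bellman_of_two_lt hp hq
  refine ⟨c⁻¹.toNNReal * C.toNNReal * K, fun F w M hF hw hFM hwM hw0 n => ?_⟩
  have hwM' : ∀ x, ‖w x‖ ≤ M := fun x => by rw [Real.norm_of_nonneg (hw0 x)]; exact hwM x
  have hb := bellman_sum (Φ := Φ) (gain := fun a b β => c * β * ‖a - b‖ ^ 2) hΦm hΦ0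
    (by fun_prop) (fun a b β hβ => by positivity) hΦ hπ hF hw hFM hwM' hw0 n
  have havg : ∀ t x, ENNReal.ofReal (avg π t w x) =
      lavg π t (fun y => ENNReal.ofReal (w y)) x := fun t x =>
    ofReal_integral_eq_lintegral_ofReal (integrable_translate π t hw hwM' x)
      (Eventually.of_forall fun z => hw0 _)
  have hcc : (c⁻¹.toNNReal : ℝ≥0∞) * ENNReal.ofReal c = 1 := by
    change ENNReal.ofReal _ * _ = _
    rw [← ENNReal.ofReal_mul (by positivity), inv_mul_cancel₀ hc.ne', ENNReal.ofReal_one]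
  have hright : ∫⁻ x, ENNReal.ofReal (Φ (avg π (dy n) F x) (avg π (dy n) w x)) ≤
      C.toNNReal * (K * ((∫⁻ x, ‖F x‖ₑ ^ p) + ∫⁻ x, ENNReal.ofReal (w x) ^ q)) := by
    set u : E → ℝ≥0∞ := fun y => ‖F y‖ₑ with hu
    set v : E → ℝ≥0∞ := fun y => ENNReal.ofReal (w y) with hv
    have hum : Measurable u := hF.enorm
    have hvm : Measurable v := hw.ennreal_ofReal
    have hpu := measurable_pmax π hum
    have hpv := measurable_pmax π hvm
    calc _ ≤ ∫⁻ x, C.toNNReal * (pmax π u x ^ p + pmax π v x ^ q) := by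
          refine lintegral_mono fun x => ?_
          have h0 := avg_nonneg π (dy n) hw0 x
          refine (ENNReal.ofReal_le_ofReal (hΦC _ _ h0)).trans ?_
          rw [ENNReal.ofReal_mul hC.le, ENNReal.ofReal_add (by positivity) (by positivity),
            ← ENNReal.ofReal_rpow_of_nonneg (norm_nonneg _) hp0.le, ofReal_norm,
            ← ENNReal.ofReal_rpow_of_nonneg h0 hq0.le, havg]
          change ENNReal.ofReal C * _ ≤ ENNReal.ofReal C * _
          gcongr
          · exact (enorm_avg_le π _ F x).trans (lavg_le_pmax _ _ _ _)
          · exact lavg_le_pmax _ _ _ _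
      _ = C.toNNReal * ((∫⁻ x, pmax π u x ^ p) + ∫⁻ x, pmax π v x ^ q) := by
          rw [lintegral_const_mul _ (by fun_prop), lintegral_add_left (by fun_prop)]
      _ ≤ _ := by
          gcongr
          rw [mul_add]
          exact add_le_add (hKp u hum) (hKq v hvm)
  calc _ ≤ ∑ j ∈ Finset.range n, c⁻¹.toNNReal * ∫⁻ x, ∫⁻ z, ENNReal.ofReal
        (c * avg π (dy j) w x *
          ‖avg π (dy (j + 1)) F (x - dy (j + 1) • z) - avg π (dy j) F x‖ ^ 2) ∂π := by
        refine Finset.sum_le_sum fun j _ => ?_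
        rw [← lintegral_const_mul' _ _ ENNReal.coe_ne_top]
        refine lintegral_mono fun x => ?_
        have h0 := avg_nonneg π (dy j) hw0 x
        have e : ∀ z, ENNReal.ofReal (c * avg π (dy j) w x *
            ‖avg π (dy (j + 1)) F (x - dy (j + 1) • z) - avg π (dy j) F x‖ ^ 2) =
            ENNReal.ofReal c * ENNReal.ofReal (avg π (dy j) w x) *
            ‖avg π (dy (j + 1)) F (x - dy (j + 1) • z) - avg π (dy j) F x‖ₑ ^ 2 := by
          intro z
          rw [ENNReal.ofReal_mul (by positivity), ENNReal.ofReal_mul hc.le,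
            ENNReal.ofReal_pow (norm_nonneg _), ofReal_norm]
        simp only [e]
        rw [lintegral_const_mul' _ _ (ENNReal.mul_ne_top ENNReal.ofReal_ne_top
          ENNReal.ofReal_ne_top), ← mul_assoc, ← mul_assoc, hcc, one_mul, havg]
        gcongr
        exact osc_sq_le π hF j x
    _ = c⁻¹.toNNReal * ∑ j ∈ Finset.range n, ∫⁻ x, ∫⁻ z, ENNReal.ofReal
        (c * avg π (dy j) w x *
          ‖avg π (dy (j + 1)) F (x - dy (j + 1) • z) - avg π (dy j) F x‖ ^ 2) ∂π := by
        rw [Finset.mul_sum]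
    _ ≤ c⁻¹.toNNReal * (C.toNNReal * (K * ((∫⁻ x, ‖F x‖ₑ ^ p) +
        ∫⁻ x, ENNReal.ofReal (w x) ^ q))) := by
        gcongr
        exact hb.trans hright
    _ = _ := by push_cast; ring

end SquareFunction

section SquareFunction

variable {E : Type*} [NormedAddCommGroup E] [InnerProductSpace ℝ E] [FiniteDimensional ℝ E]
  [MeasurableSpace E] [BorelSpace E]

theorem osc_le_pmax (π : Measure E) [IsProbabilityMeasure π] (F : E → ℂ) (j : ℕ) (x : E) :
    osc π F j x ≤ pmax π (pmax π fun y => ‖F y‖ₑ) x + pmax π (fun y => ‖F y‖ₑ) x := by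
  have h : ∀ i y, ‖avg π (dy i) F y‖ₑ ≤ pmax π (fun y => ‖F y‖ₑ) y := fun i y =>
    (enorm_avg_le π _ F y).trans (lavg_le_pmax _ _ _ _)
  calc osc π F j x ≤ ∫⁻ z, pmax π (fun y => ‖F y‖ₑ) (x - dy (j + 1) • z) +
        pmax π (fun y => ‖F y‖ₑ) x ∂π :=
        lintegral_mono fun z => (enorm_sub_le).trans (add_le_add (h _ _) (h _ _))
    _ = lavg π (dy (j + 1)) (pmax π fun y => ‖F y‖ₑ) x + pmax π (fun y => ‖F y‖ₑ) x := by
        rw [lintegral_add_right _ measurable_const]; simp [lavg]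
    _ ≤ _ := by gcongr; exact lavg_le_pmax _ _ _ _

theorem exists_small_rpow {q : ℝ} (hq : 1 < q) (B : ℝ≥0) :
    ∃ θ : ℝ≥0, 0 < θ ∧ B * θ ^ q ≤ θ / 2 := by
  have hq0 : q - 1 ≠ 0 := by linarith
  refine ⟨(2 * B + 1)⁻¹ ^ (q - 1)⁻¹, by positivity, ?_⟩
  set θ : ℝ≥0 := (2 * B + 1)⁻¹ ^ (q - 1)⁻¹ with hθ
  have hθ0 : 0 < θ := by positivity
  have h1 : θ ^ q = θ * (2 * B + 1)⁻¹ := by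
    have : θ ^ (q - 1) = (2 * B + 1)⁻¹ := by
      rw [hθ, ← NNReal.rpow_mul, inv_mul_cancel₀ hq0, NNReal.rpow_one]
    rw [← this]
    conv_rhs => enter [1]; rw [← NNReal.rpow_one θ]
    rw [← NNReal.rpow_add hθ0.ne']; congr 1; ring
  rw [h1, ← mul_assoc, ← div_eq_mul_inv, div_le_div_iff₀ (by positivity) (by norm_num)]
  calc B * θ * 2 = θ * (2 * B) := by ring
    _ ≤ _ := by gcongr; exact le_self_add

theorem ENNReal.le_of_mul_le_add {X A : ℝ≥0∞} {θ B η : ℝ≥0} (hX : X ≠ ∞) (hθ : 0 < θ)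
    (hη : η ≤ θ / 2) (h : θ * X ≤ B * A + η * X) : X ≤ (2 * B / θ : ℝ≥0) * A + A := by
  by_cases hA : A = ∞
  · simp [hA]
  lift X to ℝ≥0 using hX
  lift A to ℝ≥0 using hA
  norm_cast at h ⊢
  have h2 : θ * X ≤ B * A + θ / 2 * X := h.trans (by gcongr)
  have h3 : X ≤ 2 * B / θ * A := by
    rw [div_mul_eq_mul_div, le_div_iff₀ hθ]
    have h4 : (θ : ℝ) * X ≤ B * A + θ / 2 * X := by exact_mod_cast h2
    have : (X : ℝ) * θ ≤ 2 * B * A := by linarith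
    exact_mod_cast this
  exact h3.trans le_self_add

theorem lintegral_square_function_le {π : Measure E} [IsProbabilityMeasure π]
    (hπ : π.conv π = π.map fun z => (2 : ℝ) • z) (hsymm : π.map (fun z => -z) = π)
    (hK : ∀ p : ℝ, 1 < p → ∃ K : ℝ≥0,
      ∀ u : E → ℝ≥0∞, Measurable u → ∫⁻ x, pmax π u x ^ p ≤ K * ∫⁻ x, u x ^ p)
    {p : ℝ} (hp : 1 < p) (c : ℝ≥0) :
    ∃ C : ℝ≥0, ∀ (F : E → ℂ) (M : ℝ) (D : ℕ → E → ℂ), Measurable F → (∀ x, ‖F x‖ ≤ M) →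
      (∀ j, Measurable (D j)) → (∀ j x, ‖D j x‖ₑ ≤ c * osc π F j x) →
      (∀ j x, ‖D j x‖ₑ ^ 2 ≤ c * lavg π (dy j) (fun y => ‖D j y‖ₑ ^ 2) x) → ∀ n : ℕ,
      ∫⁻ x, (∑ j ∈ Finset.range n, ‖D j x‖ₑ ^ 2) ^ (p / 2) ≤ C * ∫⁻ x, ‖F x‖ₑ ^ p := by
  have hp0 : 0 < p := by linarith
  obtain ⟨K, hKp⟩ := hK p hp
  rcases le_or_gt p 2 with hp2 | hp2
  · obtain ⟨C, hC⟩ := lintegral_osc_sq_le_of_le_two hp hp2 hπ hKp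
    refine ⟨(c ^ 2) ^ (p / 2) * C, fun F M D hF hM hDm hD1 _ n => ?_⟩
    have hosc : ∀ j, Measurable (osc π F j) := measurable_osc π hF
    calc _ ≤ ∫⁻ x, (c ^ 2 : ℝ≥0∞) ^ (p / 2) *
          (∑ j ∈ Finset.range n, osc π F j x ^ 2) ^ (p / 2) := by
          refine lintegral_mono fun x => ?_
          rw [← ENNReal.mul_rpow_of_nonneg _ _ (by linarith), Finset.mul_sum]
          simp only [← mul_pow]
          gcongr with j
          exact hD1 j x
      _ = (c ^ 2 : ℝ≥0∞) ^ (p / 2) *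
          ∫⁻ x, (∑ j ∈ Finset.range n, osc π F j x ^ 2) ^ (p / 2) := by
          rw [lintegral_const_mul _ (by fun_prop)]
      _ ≤ (c ^ 2 : ℝ≥0∞) ^ (p / 2) * (C * ∫⁻ x, ‖F x‖ₑ ^ p) := by gcongr; exact hC F M hF hM n
      _ = _ := by
          rw [ENNReal.coe_mul, ENNReal.coe_rpow_of_nonneg _ (by positivity)]
          push_cast; ring
  set q := p / (p - 2) with hq
  have hp2' : 0 < p - 2 := by linarith
  have hq1 : 1 < q := by rw [hq, one_lt_div hp2']; linarith
  obtain ⟨K', hKq⟩ := hK q hq1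
  have hmono : ∀ {a b : ℝ≥0} (X : ℝ≥0∞), a ≤ b → (a : ℝ≥0∞) * X ≤ b * X := fun X h => by gcongr
  obtain ⟨C₀, hC₀⟩ := sum_lintegral_osc_sq_mul_le hp2 hq hπ (K := max K K')
    (fun u hu => (hKp u hu).trans (hmono _ (le_max_left _ _)))
    (fun u hu => (hKq u hu).trans (hmono _ (le_max_right _ _)))
  obtain ⟨θ, hθ0, hθ⟩ := exists_small_rpow hq1 (c ^ 3 * C₀)
  refine ⟨2 * (c ^ 3 * C₀) / θ + 1, fun F M D hF hM hDm hD1 hD2 n => ?_⟩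
  have hosc : ∀ j, Measurable (osc π F j) := measurable_osc π hF
  set u : E → ℝ≥0∞ := fun y => ‖F y‖ₑ with hu
  have hum : Measurable u := hF.enorm
  have hpm := measurable_pmax π hum
  have hppm := measurable_pmax π hpm
  set A := ∫⁻ x, ‖F x‖ₑ ^ p with hA
  rw [ENNReal.coe_add, add_mul, ENNReal.coe_one, one_mul]
  by_cases hAtop : A = ∞
  · simp [hAtop]
  set U : E → ℝ≥0∞ := fun x => ∑ j ∈ Finset.range n, ‖D j x‖ₑ ^ 2 with hU
  have hUm : Measurable U := by fun_prop
  set P : E → ℝ≥0∞ := fun x => pmax π (pmax π u) x + pmax π u x with hP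
  have hUP : ∀ x, U x ≤ (n * c ^ 2 : ℝ≥0) * P x ^ 2 := by
    intro x
    calc U x ≤ ∑ j ∈ Finset.range n, (c * P x) ^ 2 := by
          refine Finset.sum_le_sum fun j _ => ?_
          gcongr
          exact (hD1 j x).trans (by gcongr; exact osc_le_pmax π F j x)
      _ = _ := by simp only [Finset.sum_const, Finset.card_range, nsmul_eq_mul]; push_cast; ring
  have hXtop : ∫⁻ x, U x ^ (p / 2) ≠ ∞ := by
    have h1 : ∫⁻ x, P x ^ p < ∞ := by
      calc _ ≤ ∫⁻ x, 2 ^ (p - 1) * (pmax π (pmax π u) x ^ p + pmax π u x ^ p) :=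
            lintegral_mono fun x => ENNReal.rpow_add_le_mul_rpow_add_rpow _ _ hp.le
        _ = 2 ^ (p - 1) * ((∫⁻ x, pmax π (pmax π u) x ^ p) + ∫⁻ x, pmax π u x ^ p) := by
            rw [lintegral_const_mul _ (by fun_prop), lintegral_add_left (by fun_prop)]
        _ ≤ 2 ^ (p - 1) * (K * (K * A) + K * A) := by
            gcongr
            · exact (hKp _ hpm).trans (by gcongr; exact hKp u hum)
            · exact hKp u hum
        _ < ∞ := by
            have := lt_top_iff_ne_top.2 hAtop
            have h2 : (2 : ℝ≥0∞) ^ (p - 1) < ∞ :=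
              ENNReal.rpow_lt_top_of_nonneg (by linarith) (by simp)
            finiteness
    refine ne_of_lt ?_
    calc _ ≤ ∫⁻ x, ((n * c ^ 2 : ℝ≥0) : ℝ≥0∞) ^ (p / 2) * P x ^ p := by
          refine lintegral_mono fun x => ?_
          have e : P x ^ p = (P x ^ 2) ^ (p / 2) := by
            rw [← ENNReal.rpow_natCast, ← ENNReal.rpow_mul]; congr 1; push_cast; ring
          rw [e, ← ENNReal.mul_rpow_of_nonneg _ _ (by linarith)]
          gcongr
          exact hUP x
      _ = ((n * c ^ 2 : ℝ≥0) : ℝ≥0∞) ^ (p / 2) * ∫⁻ x, P x ^ p := by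
          rw [lintegral_const_mul _ (by fun_prop)]
      _ < ∞ := ENNReal.mul_lt_top
          (ENNReal.rpow_lt_top_of_nonneg (by linarith) ENNReal.coe_ne_top) h1
  have hPb : ∀ x, U x ≤ (n * (c * ENNReal.ofReal (M + M)) ^ 2) := by
    intro x
    calc U x ≤ ∑ j ∈ Finset.range n, (c * ENNReal.ofReal (M + M)) ^ 2 := by
          refine Finset.sum_le_sum fun j _ => ?_
          gcongr
          refine (hD1 j x).trans ?_
          gcongr
          refine (lintegral_mono fun z => ?_).trans_eq
            (b := ∫⁻ z, ENNReal.ofReal (M + M) ∂π) (by simp)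
          rw [← ofReal_norm]
          exact ENNReal.ofReal_le_ofReal ((norm_sub_le _ _).trans
            (add_le_add (norm_avg_le π _ hM _) (norm_avg_le π _ hM _)))
      _ = _ := by simp
  set T : ℝ≥0 := n * (c * (M + M).toNNReal) ^ 2 with hT
  have hUT : ∀ x, U x ≤ T := fun x => by
    rw [hT]; push_cast; exact hPb x
  have hUtop : ∀ x, U x ≠ ∞ := fun x => ne_top_of_le_ne_top ENNReal.coe_ne_top (hUT x)
  set w : E → ℝ≥0 := fun x => θ * (U x).toNNReal ^ (p / 2 - 1) with hw
  have hwm : Measurable w := by fun_prop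
  have hwe : ∀ x, ENNReal.ofReal (w x) = θ * U x ^ (p / 2 - 1) := fun x => by
    rw [ENNReal.ofReal_coe_nnreal, hw, ENNReal.coe_mul,
      ENNReal.coe_rpow_of_nonneg _ (by linarith), ENNReal.coe_toNNReal (hUtop x)]
  have hwb : ∀ x, (w x : ℝ) ≤ max M (θ * T ^ (p / 2 - 1) : ℝ≥0) := fun x => by
    refine le_max_of_le_right ?_
    rw [NNReal.coe_le_coe]
    have : (U x).toNNReal ≤ T := by
      rw [← ENNReal.coe_le_coe, ENNReal.coe_toNNReal (hUtop x)]; exact hUT x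
    have : 0 ≤ p / 2 - 1 := by linarith
    simp only [hw]
    gcongr
  have hmain := hC₀ F (fun x => w x) _ hF hwm.coe_nnreal_real
    (fun x => (hM x).trans (le_max_left M _)) hwb (fun x => (w x).2) n
  simp only [hwe] at hmain
  set W : E → ℝ≥0∞ := fun x => θ * U x ^ (p / 2 - 1) with hW
  have hWm : Measurable W := by fun_prop
  have hWq : ∫⁻ x, W x ^ q = θ ^ q * ∫⁻ x, U x ^ (p / 2) := by
    rw [← lintegral_const_mul _ (by fun_prop)]
    refine lintegral_congr fun x => ?_
    rw [hW, ENNReal.mul_rpow_of_nonneg _ _ (by linarith), ← ENNReal.rpow_mul]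
    congr 2
    rw [hq]; field_simp
  have hleft : θ * ∫⁻ x, U x ^ (p / 2) ≤
      ∑ j ∈ Finset.range n, c ^ 3 * ∫⁻ x, lavg π (dy j) W x * osc π F j x ^ 2 := by
    calc θ * ∫⁻ x, U x ^ (p / 2) = ∫⁻ x, U x * W x := by
          rw [← lintegral_const_mul _ (by fun_prop)]
          refine lintegral_congr fun x => ?_
          have : U x ^ (p / 2) = U x * U x ^ (p / 2 - 1) := by
            conv_rhs => enter [1]; rw [← ENNReal.rpow_one (U x)]
            rw [← ENNReal.rpow_add_of_nonneg _ _ zero_le_one (by linarith)]; congr 1; ring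
          rw [hW, this]; ring
      _ = ∑ j ∈ Finset.range n, ∫⁻ x, ‖D j x‖ₑ ^ 2 * W x := by
          simp only [hU, Finset.sum_mul]
          exact lintegral_finsetSum _ fun j _ => by fun_prop
      _ ≤ _ := by
          refine Finset.sum_le_sum fun j _ => ?_
          have hDj : Measurable fun y => ‖D j y‖ₑ ^ 2 := by fun_prop
          have hl := measurable_lavg π (dy j) hWm
          calc ∫⁻ x, ‖D j x‖ₑ ^ 2 * W x
              ≤ ∫⁻ x, c * (lavg π (dy j) (fun y => ‖D j y‖ₑ ^ 2) x * W x) := by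
                refine lintegral_mono fun x => ?_
                exact (mul_le_mul' (hD2 j x) le_rfl).trans_eq (mul_assoc _ _ _)
            _ = c * ∫⁻ x, ‖D j x‖ₑ ^ 2 * lavg π (dy j) W x := by
                rw [lintegral_const_mul' _ _ ENNReal.coe_ne_top,
                  lintegral_mul_lavg_comm hsymm _ hDj hWm]
            _ ≤ c * ∫⁻ x, c ^ 2 * (lavg π (dy j) W x * osc π F j x ^ 2) := by
                refine mul_le_mul' le_rfl (lintegral_mono fun x => ?_)
                calc ‖D j x‖ₑ ^ 2 * lavg π (dy j) W x
                    ≤ (c * osc π F j x) ^ 2 * lavg π (dy j) W x :=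
                      mul_le_mul' (pow_le_pow_left' (hD1 j x) 2) le_rfl
                  _ = c ^ 2 * (lavg π (dy j) W x * osc π F j x ^ 2) := by ring
            _ = _ := by
                rw [lintegral_const_mul _ (by fun_prop)]; ring
  refine ENNReal.le_of_mul_le_add (η := c ^ 3 * C₀ * θ ^ q) hXtop hθ0 hθ ?_
  calc _ ≤ _ := hleft
    _ = c ^ 3 * ∑ j ∈ Finset.range n, ∫⁻ x, lavg π (dy j) W x * osc π F j x ^ 2 := by
        rw [Finset.mul_sum]
    _ ≤ c ^ 3 * (C₀ * (A + ∫⁻ x, W x ^ q)) := by gcongr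
    _ = _ := by
        rw [hWq]; push_cast
        rw [ENNReal.coe_rpow_of_nonneg _ (by linarith)]; ring

end SquareFunction

theorem lintegral_Ioi_ite_rpow {p : ℝ} (hp : 0 < p) (y : ℝ≥0∞) :
    ∫⁻ t in Set.Ioi (0 : ℝ), (if ENNReal.ofReal t < y then ENNReal.ofReal (p * t ^ (p - 1)) else 0)
      = y ^ p := by
  have hfin : ∀ r : ℝ, 0 ≤ r → ∫⁻ t in Set.Ioi (0 : ℝ),
      (if ENNReal.ofReal t < ENNReal.ofReal r then ENNReal.ofReal (p * t ^ (p - 1)) else 0)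
      = ENNReal.ofReal r ^ p := by
    intro r hr
    have e1 : ∀ t ∈ Set.Ioi (0 : ℝ), (if ENNReal.ofReal t < ENNReal.ofReal r then
        ENNReal.ofReal (p * t ^ (p - 1)) else 0) =
        (Set.Iio r).indicator (fun t => ENNReal.ofReal (p * t ^ (p - 1))) t := by
      intro t ht
      rw [Set.indicator_apply]
      simp only [ENNReal.ofReal_lt_ofReal_iff_of_nonneg (le_of_lt ht), Set.mem_Iio]
    rw [setLIntegral_congr_fun measurableSet_Ioi e1, lintegral_indicator measurableSet_Iio,
      Measure.restrict_restrict measurableSet_Iio, Set.inter_comm, Set.Ioi_inter_Iio]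
    have h1 : IntervalIntegrable (fun t : ℝ => p * t ^ (p - 1)) volume 0 r :=
      (intervalIntegral.intervalIntegrable_rpow' (by linarith)).const_mul p
    rw [← ofReal_integral_eq_lintegral_ofReal, ← integral_Ioc_eq_integral_Ioo,
      ← intervalIntegral.integral_of_le hr, intervalIntegral.integral_const_mul,
      integral_rpow (Or.inl (by linarith)), ENNReal.ofReal_rpow_of_nonneg hr hp.le]
    · congr 1
      rw [sub_add_cancel, Real.zero_rpow hp.ne']
      field_simp; ring
    · exact ((intervalIntegrable_iff_integrableOn_Ioc_of_le hr).1 h1).mono_set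
        Set.Ioo_subset_Ioc_self
    · refine (ae_restrict_iff' measurableSet_Ioo).2 (Eventually.of_forall fun t ht => ?_)
      have := ht.1
      show (0 : ℝ) ≤ p * t ^ (p - 1)
      positivity
  by_cases hy : y = ∞
  · subst hy
    rw [ENNReal.top_rpow_of_pos hp]
    refine ENNReal.eq_top_of_forall_nnreal_le ?_
    intro r
    have h := hfin ((r : ℝ) ^ (1 / p)) (by positivity)
    rw [ENNReal.ofReal_rpow_of_nonneg (by positivity) hp.le, ← Real.rpow_mul r.coe_nonneg,
      one_div_mul_cancel hp.ne', Real.rpow_one, ENNReal.ofReal_coe_nnreal] at h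
    rw [← h]
    refine lintegral_mono fun t => ?_
    dsimp only
    split_ifs <;> simp_all
  · have := hfin y.toReal ENNReal.toReal_nonneg
    rwa [ENNReal.ofReal_toReal hy] at this

theorem lintegral_rpow_le_of_weak {α : Type*} [MeasurableSpace α] {μ : Measure α} [SFinite μ]
    {p : ℝ} (hp : 1 < p) {u v : α → ℝ≥0∞} (hu : Measurable u) (hv : Measurable v) {C : ℝ≥0}
    (h : ∀ t : ℝ, 0 < t → ENNReal.ofReal t * μ {x | ENNReal.ofReal t < v x} ≤
      C * ∫⁻ x, (if ENNReal.ofReal t < 2 * u x then u x else 0) ∂μ) :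
    ∫⁻ x, v x ^ p ∂μ ≤ C * (ENNReal.ofReal (p / (p - 1)) * 2 ^ (p - 1)) * ∫⁻ x, u x ^ p ∂μ := by
  have hp0 : 0 < p := by linarith
  have hp1 : 0 < p - 1 := by linarith
  have hm : ∀ {w : α → ℝ≥0∞} {g : α → ℝ → ℝ≥0∞}, Measurable w →
      (Measurable fun q : α × ℝ => g q.1 q.2) → Measurable fun q : α × ℝ =>
      if ENNReal.ofReal q.2 < w q.1 then g q.1 q.2 else 0 := fun hw hg =>
    Measurable.ite (measurableSet_lt (by fun_prop) (by fun_prop)) hg measurable_const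
  have hL : ∫⁻ x, v x ^ p ∂μ =
      ∫⁻ t in Set.Ioi (0 : ℝ), ENNReal.ofReal (p * t ^ (p - 1)) *
        μ {x | ENNReal.ofReal t < v x} := by
    simp_rw [← lintegral_Ioi_ite_rpow hp0]
    rw [lintegral_lintegral_swap
      (hm (g := fun _ t => ENNReal.ofReal (p * t ^ (p - 1))) hv (by fun_prop)).aemeasurable]
    refine lintegral_congr fun t => ?_
    have hs : MeasurableSet {x | ENNReal.ofReal t < v x} := measurableSet_lt measurable_const hv
    rw [← lintegral_indicator_const hs]
    refine lintegral_congr fun x => ?_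
    simp [Set.indicator_apply]
  have hR : ∀ x, ∫⁻ t in Set.Ioi (0 : ℝ), (if ENNReal.ofReal t < 2 * u x then
      ENNReal.ofReal (p * t ^ (p - 2)) * u x else 0) =
      ENNReal.ofReal (p / (p - 1)) * 2 ^ (p - 1) * u x ^ p := by
    intro x
    have e := lintegral_Ioi_ite_rpow hp1 (2 * u x)
    have e2 : ∀ t ∈ Set.Ioi (0 : ℝ), (if ENNReal.ofReal t < 2 * u x then
        ENNReal.ofReal (p * t ^ (p - 2)) * u x else 0) =
        (ENNReal.ofReal (p / (p - 1)) * u x) * (if ENNReal.ofReal t < 2 * u x then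
          ENNReal.ofReal ((p - 1) * t ^ (p - 1 - 1)) else 0) := by
      intro t ht
      split_ifs
      · have e3 : p * t ^ (p - 2) = p / (p - 1) * ((p - 1) * t ^ (p - 1 - 1)) := by
          have e4 : p - 1 - 1 = p - 2 := by ring
          rw [e4]; field_simp
        rw [e3, ENNReal.ofReal_mul (by positivity)]; ring
      · simp
    rw [setLIntegral_congr_fun measurableSet_Ioi e2, lintegral_const_mul, e,
      ENNReal.mul_rpow_of_nonneg _ _ hp1.le]
    · have e5 : u x ^ p = u x * u x ^ (p - 1) := by
        conv_rhs => enter [1]; rw [← ENNReal.rpow_one (u x)]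
        rw [← ENNReal.rpow_add_of_nonneg _ _ zero_le_one hp1.le]; congr 1; ring
      rw [e5]; ring
    · exact Measurable.ite (measurableSet_lt (by fun_prop) (by fun_prop)) (by fun_prop)
        measurable_const
  rw [hL]
  calc _ ≤ ∫⁻ t in Set.Ioi (0 : ℝ), C * ∫⁻ x, (if ENNReal.ofReal t < 2 * u x then
        ENNReal.ofReal (p * t ^ (p - 2)) * u x else 0) ∂μ := by
        refine setLIntegral_mono' measurableSet_Ioi fun t ht => ?_
        have ht : 0 < t := ht
        have e : p * t ^ (p - 1) = p * t ^ (p - 2) * t := by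
          have : t ^ (p - 1) = t ^ (p - 2) * t ^ (1 : ℝ) := by
            rw [← Real.rpow_add ht]; congr 1; ring
          rw [this, Real.rpow_one]; ring
        rw [e, ENNReal.ofReal_mul (by positivity), mul_assoc]
        calc _ ≤ ENNReal.ofReal (p * t ^ (p - 2)) *
              (C * ∫⁻ x, (if ENNReal.ofReal t < 2 * u x then u x else 0) ∂μ) :=
              mul_le_mul' le_rfl (h t ht)
          _ = C * (ENNReal.ofReal (p * t ^ (p - 2)) *
              ∫⁻ x, (if ENNReal.ofReal t < 2 * u x then u x else 0) ∂μ) := by ring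
          _ = _ := by
              rw [← lintegral_const_mul' _ _ ENNReal.ofReal_ne_top]
              simp only [mul_ite, mul_zero]
    _ = C * ∫⁻ x, ENNReal.ofReal (p / (p - 1)) * 2 ^ (p - 1) * u x ^ p ∂μ := by
        rw [lintegral_const_mul' _ _ ENNReal.coe_ne_top, ← lintegral_lintegral_swap]
        · simp_rw [hR]
        · exact (hm (w := fun x => 2 * u x) (g := fun x t => ENNReal.ofReal (p * t ^ (p - 2)) * u x)
            (by fun_prop) (by fun_prop)).aemeasurable
    _ = _ := by
        rw [lintegral_const_mul _ (by fun_prop)]; ring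

section Maximal

variable {E : Type*} [NormedAddCommGroup E] [InnerProductSpace ℝ E] [FiniteDimensional ℝ E]
  [MeasurableSpace E] [BorelSpace E]

theorem lintegral_sub_smul_eq {t : ℝ} (ht : 0 < t) {g : E → ℝ≥0∞} (hg : Measurable g) (x : E) :
    ∫⁻ z, g (x - t • z) = ENNReal.ofReal (t ^ Module.finrank ℝ E)⁻¹ * ∫⁻ y, g y := by
  have h : ∫⁻ y, g (x - y) ∂(Measure.map (fun z : E => t • z) volume) = ∫⁻ z, g (x - t • z) :=
    lintegral_map (by fun_prop) (by fun_prop)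
  rw [← h, Measure.map_addHaar_smul volume ht.ne', lintegral_smul_measure,
    abs_of_pos (by positivity), lintegral_sub_left_eq_self, smul_eq_mul]

/-- A measure dominated by a radially decreasing integrable power. -/
def PolyDecay (π : Measure E) (c : ℝ) : Prop :=
  π ≤ volume.withDensity fun z => ENNReal.ofReal (c * (1 + ‖z‖) ^ (-(Module.finrank ℝ E + 1 : ℝ)))

theorem lavg_le_of_closedBall {π : Measure E} {c : ℝ} (hc : 0 ≤ c) (hπ : PolyDecay π c)
    {t : ℝ} (ht : 0 < t) {u : E → ℝ≥0∞} (hu : Measurable u) {x : E} {l : ℝ≥0∞}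
    (h : ∀ r : ℝ, 0 < r → ∫⁻ y in Metric.closedBall x r, u y ≤
      l * volume (Metric.closedBall x r)) :
    lavg π t u x ≤ ENNReal.ofReal (c * 2 ^ (Module.finrank ℝ E + 1)) *
      volume (Metric.closedBall (0 : E) 1) * l := by
  set D := Module.finrank ℝ E with hD
  set V := volume (Metric.closedBall (0 : E) 1) with hV
  set w : E → ℝ≥0∞ := fun z => ENNReal.ofReal (c * (1 + ‖z‖) ^ (-(D + 1 : ℝ))) with hw
  have hwm : Measurable w := by fun_prop
  have hux : Measurable fun z => u (x - t • z) := hu.comp (by fun_prop)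
  have hw_le : ∀ z, w z ≤ ∑' n : ℕ, ENNReal.ofReal (c * (2⁻¹ ^ (D + 1)) ^ n) *
      (Metric.closedBall (0 : E) (2 ^ (n + 1))).indicator 1 z := by
    intro z
    obtain ⟨n, hn1, hn2⟩ := exists_nat_pow_near (x := 1 + ‖z‖) (y := 2) (by simp) (by norm_num)
    refine le_trans ?_ (ENNReal.le_tsum n)
    have hz : z ∈ Metric.closedBall (0 : E) (2 ^ (n + 1)) := by
      rw [mem_closedBall_zero_iff]; linarith
    rw [Set.indicator_of_mem hz, Pi.one_apply, mul_one]
    apply ENNReal.ofReal_le_ofReal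
    gcongr
    calc (1 + ‖z‖) ^ (-(D + 1 : ℝ)) ≤ ((2 : ℝ) ^ n) ^ (-(D + 1 : ℝ)) :=
          Real.rpow_le_rpow_of_nonpos (by positivity) hn1 (by
            have : (0 : ℝ) ≤ D := Nat.cast_nonneg _
            linarith)
      _ = _ := by
          rw [Real.rpow_neg (by positivity)]
          have : (D + 1 : ℝ) = ((D + 1 : ℕ) : ℝ) := by push_cast; ring
          rw [this, Real.rpow_natCast, ← inv_pow, ← inv_pow, ← pow_mul, ← pow_mul, mul_comm]
  have hball : ∀ R : ℝ, 0 < R → ∫⁻ z, (Metric.closedBall (0 : E) R).indicator 1 z *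
      u (x - t • z) ≤ ENNReal.ofReal (R ^ D) * V * l := by
    intro R hR
    have e1 : ∀ z, (Metric.closedBall (0 : E) R).indicator 1 z * u (x - t • z) =
        (Metric.closedBall x (t * R)).indicator u (x - t • z) := by
      intro z
      have : z ∈ Metric.closedBall (0 : E) R ↔ x - t • z ∈ Metric.closedBall x (t * R) := by
        rw [mem_closedBall_zero_iff, Metric.mem_closedBall, dist_eq_norm, sub_sub_cancel_left,
          norm_neg, norm_smul, Real.norm_of_nonneg ht.le]
        exact (mul_le_mul_iff_right₀ ht).symm
      by_cases hz : z ∈ Metric.closedBall (0 : E) R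
      · rw [Set.indicator_of_mem hz, Set.indicator_of_mem (this.1 hz)]; simp
      · rw [Set.indicator_of_notMem hz, Set.indicator_of_notMem (fun h => hz (this.2 h))]; simp
    simp_rw [e1]
    rw [lintegral_sub_smul_eq ht (hu.indicator measurableSet_closedBall),
      lintegral_indicator measurableSet_closedBall]
    calc _ ≤ ENNReal.ofReal (t ^ D)⁻¹ * (l * volume (Metric.closedBall x (t * R))) := by
          gcongr; exact h _ (by positivity)
      _ = _ := by
          rw [Measure.addHaar_closedBall' _ _ (by positivity), mul_pow, ← hD,
            ENNReal.ofReal_mul (by positivity), ENNReal.ofReal_inv_of_pos (by positivity)]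
          have h0 : ENNReal.ofReal (t ^ D) ≠ 0 := by
            rw [Ne, ENNReal.ofReal_eq_zero, not_le]; positivity
          calc _ = (ENNReal.ofReal (t ^ D))⁻¹ * ENNReal.ofReal (t ^ D) *
                (l * (ENNReal.ofReal (R ^ D) * V)) := by ring
            _ = _ := by rw [ENNReal.inv_mul_cancel h0 ENNReal.ofReal_ne_top]; ring
  calc lavg π t u x ≤ ∫⁻ z, u (x - t • z) ∂(volume.withDensity w) := lintegral_mono' hπ le_rfl
    _ = ∫⁻ z, w z * u (x - t • z) := by
        rw [lintegral_withDensity_eq_lintegral_mul _ hwm hux]; rfl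
    _ ≤ ∫⁻ z, ∑' n : ℕ, ENNReal.ofReal (c * (2⁻¹ ^ (D + 1)) ^ n) *
        ((Metric.closedBall (0 : E) (2 ^ (n + 1))).indicator 1 z * u (x - t • z)) := by
        refine lintegral_mono fun z => ?_
        calc _ ≤ (∑' n : ℕ, ENNReal.ofReal (c * (2⁻¹ ^ (D + 1)) ^ n) *
              (Metric.closedBall (0 : E) (2 ^ (n + 1))).indicator 1 z) * u (x - t • z) :=
              mul_le_mul' (hw_le z) le_rfl
          _ = _ := by rw [← ENNReal.tsum_mul_right]; simp only [mul_assoc]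
    _ = ∑' n : ℕ, ENNReal.ofReal (c * (2⁻¹ ^ (D + 1)) ^ n) *
        ∫⁻ z, (Metric.closedBall (0 : E) (2 ^ (n + 1))).indicator 1 z * u (x - t • z) := by
        have hi : ∀ n : ℕ, Measurable fun z : E =>
            (Metric.closedBall (0 : E) (2 ^ (n + 1))).indicator (1 : E → ℝ≥0∞) z * u (x - t • z) :=
          fun n => (measurable_one.indicator measurableSet_closedBall).mul hux
        rw [lintegral_tsum fun n => ((hi n).const_mul _).aemeasurable]
        refine tsum_congr fun n => lintegral_const_mul _ (hi n)
    _ ≤ ∑' n : ℕ, ENNReal.ofReal (c * (2⁻¹ ^ (D + 1)) ^ n) *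
        (ENNReal.ofReal ((2 ^ (n + 1)) ^ D) * V * l) := by
        gcongr with n
        exact hball _ (by positivity)
    _ = ∑' n : ℕ, ENNReal.ofReal (c * 2 ^ D) * 2⁻¹ ^ n * (V * l) := by
        refine tsum_congr fun n => ?_
        rw [← mul_assoc, ← mul_assoc, ← ENNReal.ofReal_mul (by positivity), mul_assoc]
        congr 1
        have e : (2⁻¹ : ℝ≥0∞) = ENNReal.ofReal 2⁻¹ := by
          rw [ENNReal.ofReal_inv_of_pos (by norm_num)]; simp
        rw [e, ← ENNReal.ofReal_pow (by norm_num), ← ENNReal.ofReal_mul (by positivity)]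
        congr 1
        rw [← pow_mul, ← pow_mul, add_mul, one_mul, add_mul, one_mul, pow_add, pow_add,
          mul_comm n D]
        have e3 : (2⁻¹ : ℝ) ^ (D * n) * 2 ^ (D * n) = 1 := by
          rw [← mul_pow]; norm_num
        linear_combination c * 2⁻¹ ^ n * 2 ^ D * e3
    _ = _ := by
        rw [ENNReal.tsum_mul_right, ENNReal.tsum_mul_left, ENNReal.tsum_geometric,
          ENNReal.one_sub_inv_two, inv_inv, pow_succ, ← mul_assoc c,
          ENNReal.ofReal_mul (by positivity : 0 ≤ c * 2 ^ D)]
        simp; ring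

theorem weak_type_closedBall [Nontrivial E] {u : E → ℝ≥0∞} (huf : ∫⁻ y, u y ≠ ∞) {l : ℝ≥0}
    (hl : 0 < l) :
    l * volume {x : E | ∃ r : ℝ, 0 < r ∧ l * volume (Metric.closedBall x r) <
      ∫⁻ y in Metric.closedBall x r, u y} ≤ 5 ^ Module.finrank ℝ E * ∫⁻ y, u y := by
  set D := Module.finrank ℝ E with hD
  have hD0 : D ≠ 0 := Module.finrank_pos.ne'
  set V := volume (Metric.closedBall (0 : E) 1) with hV
  have hV0 : V ≠ 0 := (Metric.measure_closedBall_pos _ _ one_pos).ne'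
  have hVt : V ≠ ∞ := measure_closedBall_lt_top.ne
  set T : Set (E × ℝ) := {q | 0 < q.2 ∧ l * volume (Metric.closedBall q.1 q.2) <
    ∫⁻ y in Metric.closedBall q.1 q.2, u y} with hT
  have hR : ∀ a ∈ T, a.2 ≤ max 1 ((∫⁻ y, u y) / (l * V)).toReal := by
    rintro ⟨x, r⟩ ⟨hr, h⟩
    rcases le_or_gt r 1 with h1 | h1
    · exact le_max_of_le_left h1
    refine le_max_of_le_right ?_
    have h2 := h.le.trans (setLIntegral_le_lintegral _ _)
    have hr : 0 < r := hr
    simp only at h2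
    rw [Measure.addHaar_closedBall' _ _ hr.le, ← hD] at h2
    have hlV : (l : ℝ≥0∞) * V ≠ 0 := mul_ne_zero (by simpa using hl.ne') hV0
    have hlVt : (l : ℝ≥0∞) * V ≠ ∞ := ENNReal.mul_ne_top ENNReal.coe_ne_top hVt
    have h3 : ENNReal.ofReal (r ^ D) ≤ (∫⁻ y, u y) / (l * V) := by
      rw [ENNReal.le_div_iff_mul_le (Or.inl hlV) (Or.inl hlVt)]
      calc _ = l * (ENNReal.ofReal (r ^ D) * V) := by ring
        _ ≤ _ := h2
    have h4 : r ^ D ≤ ((∫⁻ y, u y) / (l * V)).toReal :=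
      (ENNReal.ofReal_le_iff_le_toReal (ENNReal.div_ne_top huf hlV)).1 h3
    exact (le_self_pow₀ h1.le hD0).trans h4
  obtain ⟨S, hST, hSd, hSc⟩ := Vitali.exists_disjoint_subfamily_covering_enlargement_closedBall T
    (fun q => q.1) (fun q => q.2) _ hR 5 (by norm_num)
  have hScount : S.Countable := hSd.countable_of_nonempty_interior fun a ha => by
    refine ⟨a.1, ?_⟩
    apply Metric.ball_subset_interior_closedBall
    exact Metric.mem_ball_self (hST ha).1
  have hcover : {x : E | ∃ r : ℝ, 0 < r ∧ l * volume (Metric.closedBall x r) <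
      ∫⁻ y in Metric.closedBall x r, u y} ⊆ ⋃ a ∈ S, Metric.closedBall a.1 (5 * a.2) := by
    rintro x ⟨r, hr, h⟩
    obtain ⟨b, hb, hsub⟩ := hSc (x, r) ⟨hr, h⟩
    exact Set.mem_biUnion hb (hsub (Metric.mem_closedBall_self hr.le))
  have : Countable S := hScount.to_subtype
  calc _ ≤ l * ∑' a : S, volume (Metric.closedBall a.1.1 (5 * a.1.2)) := by
        refine mul_le_mul' le_rfl ((measure_mono hcover).trans ?_)
        exact measure_biUnion_le _ hScount _
    _ = ∑' a : S, 5 ^ D * (l * volume (Metric.closedBall a.1.1 a.1.2)) := by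
        rw [← ENNReal.tsum_mul_left]
        refine tsum_congr fun a => ?_
        have ha : 0 < a.1.2 := (hST a.2).1
        rw [Measure.addHaar_closedBall' _ _ (by positivity), Measure.addHaar_closedBall' _ _ ha.le,
          mul_pow, ENNReal.ofReal_mul (by positivity), ENNReal.ofReal_pow (by norm_num)]
        simp; ring
    _ ≤ ∑' a : S, 5 ^ D * ∫⁻ y in Metric.closedBall a.1.1 a.1.2, u y := by
        gcongr with a
        exact (hST a.2).2.le
    _ = 5 ^ D * ∫⁻ y in ⋃ a ∈ S, Metric.closedBall a.1 a.2, u y := by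
        rw [ENNReal.tsum_mul_left, lintegral_biUnion hScount
          (fun a _ => measurableSet_closedBall) hSd]
    _ ≤ _ := mul_le_mul' le_rfl (setLIntegral_le_lintegral _ _)

theorem pmax_add_le (π : Measure E) [SFinite π] {u v w : E → ℝ≥0∞} (hu : Measurable u)
    (h : ∀ x, w x ≤ u x + v x) (x : E) : pmax π w x ≤ pmax π u x + pmax π v x := by
  refine iSup_le fun j => ?_
  calc lavg π (dy j) w x ≤ ∫⁻ z, u (x - dy j • z) + v (x - dy j • z) ∂π :=
        lintegral_mono fun z => h _
    _ = lavg π (dy j) u x + lavg π (dy j) v x := lintegral_add_left (hu.comp (by fun_prop)) _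
    _ ≤ _ := add_le_add (lavg_le_pmax _ _ _ _) (lavg_le_pmax _ _ _ _)

theorem pmax_const (π : Measure E) [IsProbabilityMeasure π] (c : ℝ≥0∞) (x : E) :
    pmax π (fun _ => c) x = c := by
  simp [pmax, lavg]

theorem exists_lintegral_pmax_rpow_le [Nontrivial E] {π : Measure E} [IsProbabilityMeasure π]
    {c : ℝ} (hc : 0 ≤ c) (hπ : PolyDecay π c) {p : ℝ} (hp : 1 < p) :
    ∃ K : ℝ≥0, ∀ u : E → ℝ≥0∞, Measurable u →
      ∫⁻ x, pmax π u x ^ p ≤ K * ∫⁻ x, u x ^ p := by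
  set D := Module.finrank ℝ E with hD
  set A₀ : ℝ≥0∞ := ENNReal.ofReal (c * 2 ^ (D + 1)) * volume (Metric.closedBall (0 : E) 1)
    with hA₀
  have hA₀t : A₀ ≠ ∞ := ENNReal.mul_ne_top ENNReal.ofReal_ne_top measure_closedBall_lt_top.ne
  set A : ℝ≥0 := A₀.toNNReal + 1 with hA
  have hA0 : 0 < A := by positivity
  have hweak : ∀ u : E → ℝ≥0∞, Measurable u → ∀ l : ℝ≥0, 0 < l →
      l * volume {x | (l : ℝ≥0∞) < pmax π u x} ≤ A * 5 ^ D * ∫⁻ x, u x := by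
    intro u hu l hl
    by_cases huf : ∫⁻ y, u y = ∞
    · rw [huf, ENNReal.mul_top]
      · exact le_top
      · simp [hA0.ne']
    have h := weak_type_closedBall huf (l := l / A) (by positivity)
    calc l * volume {x | (l : ℝ≥0∞) < pmax π u x} ≤ A * ((l / A : ℝ≥0) * volume {x : E | ∃ r : ℝ,
          0 < r ∧ (l / A : ℝ≥0) * volume (Metric.closedBall x r) <
          ∫⁻ y in Metric.closedBall x r, u y}) := by
          rw [← mul_assoc, ← ENNReal.coe_mul, mul_div_cancel₀ _ hA0.ne']
          refine mul_le_mul' le_rfl (measure_mono fun x hx => ?_)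
          by_contra hcon
          simp only [Set.mem_ofPred_eq, not_exists, not_and, not_lt] at hcon
          have h1 : pmax π u x ≤ A₀ * (l / A : ℝ≥0) := iSup_le fun j =>
            lavg_le_of_closedBall hc hπ (dy_pos j) hu hcon
          have h2 : A₀ * (l / A : ℝ≥0) ≤ l := by
            calc A₀ * (l / A : ℝ≥0) ≤ A * (l / A : ℝ≥0) := by
                  gcongr
                  rw [hA, ENNReal.coe_add, ENNReal.coe_toNNReal hA₀t]
                  exact le_self_add
              _ = l := by rw [← ENNReal.coe_mul, mul_div_cancel₀ _ hA0.ne']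
          exact absurd hx (not_lt.2 (h1.trans h2))
      _ ≤ A * (5 ^ D * ∫⁻ x, u x) := by gcongr
      _ = _ := by ring
  refine ⟨2 * A * 5 ^ D * ((p / (p - 1)).toNNReal * 2 ^ (p - 1)), fun u hu => ?_⟩
  have hpm := measurable_pmax π hu
  refine (lintegral_rpow_le_of_weak hp hu hpm (C := 2 * A * 5 ^ D) fun t ht => ?_).trans_eq ?_
  · set u1 : E → ℝ≥0∞ := fun x => if ENNReal.ofReal t < 2 * u x then u x else 0 with hu1
    have hu1m : Measurable u1 :=
      Measurable.ite (measurableSet_lt measurable_const (by fun_prop)) hu measurable_const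
    set l : ℝ≥0 := (t / 2).toNNReal with hl
    have hl0 : 0 < l := by rw [hl]; exact Real.toNNReal_pos.2 (by positivity)
    have htl : ENNReal.ofReal t = l + l := by
      change _ = ENNReal.ofReal (t / 2) + ENNReal.ofReal (t / 2)
      rw [← ENNReal.ofReal_add (by positivity) (by positivity)]; congr 1; ring
    have hsub : {x | ENNReal.ofReal t < pmax π u x} ⊆ {x | (l : ℝ≥0∞) < pmax π u1 x} := by
      intro x hx
      by_contra hcon
      simp only [Set.mem_ofPred_eq, not_lt] at hcon hx
      have h1 := pmax_add_le π (w := u) (v := fun _ => l) hu1m (fun y => by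
        simp only [hu1]
        split_ifs with h
        · exact le_self_add
        · rw [zero_add]
          rw [not_lt, htl, ← two_mul] at h
          exact (ENNReal.mul_le_mul_iff_right (by norm_num) (by norm_num)).1 h) x
      rw [pmax_const] at h1
      have h2 : pmax π u x ≤ ENNReal.ofReal t := by
        rw [htl]; exact h1.trans (by gcongr)
      exact absurd hx (not_lt.2 h2)
    calc _ ≤ ENNReal.ofReal t * volume {x | (l : ℝ≥0∞) < pmax π u1 x} := by gcongr
      _ = 2 * (l * volume {x | (l : ℝ≥0∞) < pmax π u1 x}) := by rw [htl]; ring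
      _ ≤ 2 * (A * 5 ^ D * ∫⁻ x, u1 x) := mul_le_mul' le_rfl (hweak u1 hu1m l hl0)
      _ = _ := by push_cast; ring
  · congr 1
    push_cast
    rw [ENNReal.coe_rpow_of_nonneg _ (by linarith)]
    rfl

end Maximal

section Poisson

variable {E : Type*} [NormedAddCommGroup E] [InnerProductSpace ℝ E] [FiniteDimensional ℝ E]
  [MeasurableSpace E] [BorelSpace E]

theorem integral_gaussian_mul_exp_inner {v : ℝ} (hv : 0 < v) (ξ : E) :
    ∫ x : E, ((Real.exp (-v * ‖x‖ ^ 2) : ℝ) : ℂ) * cexp (⟪x, ξ⟫ * I) =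
      (((Real.pi / v) ^ ((Module.finrank ℝ E : ℝ) / 2) *
        Real.exp (-(‖ξ‖ ^ 2 / (4 * v))) : ℝ) : ℂ) := by
  have h := GaussianFourier.integral_cexp_neg_mul_sq_norm_add (V := E) (b := v)
    (by simpa using hv) I ξ
  have e : ∀ x : E, cexp (-(v : ℂ) * ‖x‖ ^ 2 + I * ⟪ξ, x⟫) =
      ((Real.exp (-v * ‖x‖ ^ 2) : ℝ) : ℂ) * cexp (⟪x, ξ⟫ * I) := by
    intro x
    rw [Complex.exp_add, real_inner_comm, mul_comm I]
    push_cast; rfl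
  simp_rw [e] at h
  rw [h, Complex.ofReal_mul, Complex.ofReal_cpow (by positivity), Complex.ofReal_exp, I_sq]
  push_cast
  congr 2
  ring

/-- The subordination integral of `exp (-l)`, up to normalisation. -/
def subordInt (l : ℝ) : ℝ := ∫ v in Set.Ioi (0 : ℝ), v ^ (-(1 / 2) : ℝ) *
  (Real.exp (-v) * Real.exp (-(l ^ 2 / (4 * v))))

theorem integral_cauchy_mul_exp_inner (ξ : E) :
    ∫ x : E, (((1 + ‖x‖ ^ 2) ^ (-((Module.finrank ℝ E : ℝ) + 1) / 2) : ℝ) : ℂ) *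
        cexp (⟪x, ξ⟫ * I) =
      (((Real.Gamma (((Module.finrank ℝ E : ℝ) + 1) / 2))⁻¹ *
        Real.pi ^ ((Module.finrank ℝ E : ℝ) / 2) * subordInt ‖ξ‖ : ℝ) : ℂ) := by
  set D : ℝ := (Module.finrank ℝ E : ℝ) with hD
  have hD0 : 0 ≤ D := by positivity
  set a : ℝ := (D + 1) / 2 with ha
  have ha0 : 0 < a := by positivity
  have hΓ : 0 < Real.Gamma a := Real.Gamma_pos_of_pos ha0
  let G : ℝ → E → ℂ := fun v x =>
    ((v ^ (a - 1) * Real.exp (-v) * Real.exp (-v * ‖x‖ ^ 2) : ℝ) : ℂ) * cexp (⟪x, ξ⟫ * I)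
  have hGn : ∀ v ∈ Set.Ioi (0 : ℝ), ∀ x : E, ‖G v x‖ =
      v ^ (a - 1) * Real.exp (-v) * Real.exp (-v * ‖x‖ ^ 2) := by
    intro v hv x
    have hv : 0 < v := hv
    simp only [G]
    rw [norm_mul, norm_exp_ofReal_mul_I, mul_one, Complex.norm_real, Real.norm_eq_abs,
      abs_of_nonneg (by positivity)]
  have hpow : ∀ v ∈ Set.Ioi (0 : ℝ), v ^ (a - 1) * (Real.pi / v) ^ (D / 2) =
      Real.pi ^ (D / 2) * v ^ (-(1 / 2) : ℝ) := by
    intro v hv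
    have hv : 0 < v := hv
    rw [Real.div_rpow Real.pi_pos.le hv.le, div_eq_mul_inv, ← Real.rpow_neg hv.le, mul_left_comm,
      ← Real.rpow_add hv]
    congr 2
    rw [ha]; ring
  have hGx : ∀ v ∈ Set.Ioi (0 : ℝ), ∫ x, G v x = ((Real.pi ^ (D / 2) * (v ^ (-(1 / 2) : ℝ) *
      (Real.exp (-v) * Real.exp (-(‖ξ‖ ^ 2 / (4 * v))))) : ℝ) : ℂ) := by
    intro v hv
    have e : ∀ x, G v x = ((v ^ (a - 1) * Real.exp (-v) : ℝ) : ℂ) *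
        (((Real.exp (-v * ‖x‖ ^ 2) : ℝ) : ℂ) * cexp (⟪x, ξ⟫ * I)) := fun x => by
      simp only [G]; push_cast; ring
    simp_rw [e]
    rw [integral_const_mul, integral_gaussian_mul_exp_inner hv, ← Complex.ofReal_mul]
    congr 1
    linear_combination (Real.exp (-v) * Real.exp (-(‖ξ‖ ^ 2 / (4 * v)))) * hpow v hv
  have hGv : ∀ x, ∫ v in Set.Ioi (0 : ℝ), G v x = (Real.Gamma a : ℂ) *
      ((((1 + ‖x‖ ^ 2) ^ (-(D + 1) / 2) : ℝ) : ℂ) * cexp (⟪x, ξ⟫ * I)) := by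
    intro x
    simp only [G]
    rw [integral_mul_const, integral_complex_ofReal, ← mul_assoc, ← Complex.ofReal_mul]
    congr 2
    have h := Real.integral_rpow_mul_exp_neg_mul_Ioi ha0 (by positivity : 0 < 1 + ‖x‖ ^ 2)
    rw [one_div, Real.inv_rpow (by positivity), ← Real.rpow_neg (by positivity)] at h
    rw [neg_div, ← ha, mul_comm, ← h]
    refine integral_congr_ae (Eventually.of_forall fun v => ?_)
    simp only
    rw [mul_assoc, ← Real.exp_add]
    congr 2; ring
  have hInt : Integrable (Function.uncurry G)
      ((volume.restrict (Set.Ioi (0 : ℝ))).prod (volume : Measure E)) := by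
    have hm : AEStronglyMeasurable (Function.uncurry G)
        ((volume.restrict (Set.Ioi (0 : ℝ))).prod (volume : Measure E)) := by
      apply Measurable.aestronglyMeasurable
      simp only [Function.uncurry_def, G]
      fun_prop
    rw [integrable_prod_iff hm]
    constructor
    · refine (ae_restrict_iff' measurableSet_Ioi).2 (Eventually.of_forall fun v hv => ?_)
      have h := (GaussianFourier.integrable_cexp_neg_mul_sq_norm_add (V := E) (b := v)
        (by simpa using hv) I ξ).const_mul ((v ^ (a - 1) * Real.exp (-v) : ℝ) : ℂ)
      refine h.congr (Eventually.of_forall fun x => ?_)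
      simp only [G, Function.uncurry_apply_pair]
      rw [Complex.exp_add, real_inner_comm, mul_comm I]
      push_cast; ring
    · have h : IntegrableOn (fun v : ℝ => Real.pi ^ (D / 2) *
          (Real.exp (-v) * v ^ ((1 / 2 : ℝ) - 1))) (Set.Ioi 0) :=
        (Real.GammaIntegral_convergent (by norm_num)).const_mul _
      refine h.congr ((ae_restrict_iff' measurableSet_Ioi).2 (Eventually.of_forall fun v hv => ?_))
      simp only [Function.uncurry_apply_pair]
      simp_rw [hGn v hv]
      rw [integral_const_mul, GaussianFourier.integral_rexp_neg_mul_sq_norm hv]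
      have := hpow v hv
      rw [show (1 / 2 : ℝ) - 1 = -(1 / 2) by norm_num]
      linear_combination - Real.exp (-v) * this
  have hswap := integral_integral_swap hInt
  simp_rw [hGv] at hswap
  rw [setIntegral_congr_fun measurableSet_Ioi hGx, integral_const_mul, integral_complex_ofReal,
    integral_const_mul] at hswap
  have hΓ' : (Real.Gamma a : ℂ) ≠ 0 := by exact_mod_cast hΓ.ne'
  rw [mul_assoc, Complex.ofReal_mul, Complex.ofReal_inv]
  rw [eq_inv_mul_iff_mul_eq₀ hΓ', ← hswap, subordInt]

theorem integrable_exp_neg_abs : Integrable fun x : ℝ => ((Real.exp (-|x|) : ℝ) : ℂ) := by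
  suffices h : Integrable fun x : ℝ => Real.exp (-|x|) from h.ofReal
  rw [← integrableOn_univ, ← Set.Iic_union_Ioi (a := (0 : ℝ)), integrableOn_union]
  constructor
  · refine (integrableOn_exp_Iic 0).congr_fun (fun x hx => ?_) measurableSet_Iic
    simp [abs_of_nonpos (Set.mem_Iic.1 hx)]
  · refine (integrableOn_exp_neg_Ioi 0).congr_fun (fun x hx => ?_) measurableSet_Ioi
    simp only
    rw [abs_of_pos (Set.mem_Ioi.1 hx)]

theorem fourier_exp_neg_abs (ξ : ℝ) :
    FourierTransform.fourier (fun x : ℝ => ((Real.exp (-|x|) : ℝ) : ℂ)) ξ =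
      ((2 * (1 + (2 * Real.pi * ξ) ^ 2)⁻¹ : ℝ) : ℂ) := by
  rw [Real.fourier_eq']
  simp only [RCLike.inner_apply, conj_trivial, smul_eq_mul]
  set w : ℝ := 2 * Real.pi * ξ with hw
  have hi : Integrable fun x : ℝ =>
      cexp (((-2 * Real.pi * (ξ * x) : ℝ) : ℂ) * I) * ((Real.exp (-|x|) : ℝ) : ℂ) := by
    refine integrable_exp_neg_abs.bdd_mul (c := 1) (by fun_prop) (Eventually.of_forall fun x => ?_)
    rw [norm_exp_ofReal_mul_I]
  rw [← intervalIntegral.integral_Iic_add_Ioi (b := 0) hi.integrableOn hi.integrableOn]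
  have h1 : ∫ x in Set.Iic (0 : ℝ), cexp (((-2 * Real.pi * (ξ * x) : ℝ) : ℂ) * I) *
      ((Real.exp (-|x|) : ℝ) : ℂ) = 1 / (1 - w * I) := by
    have h3 := integral_exp_mul_complex_Iic (a := 1 - w * I) (by simp) 0
    rw [Complex.ofReal_zero, mul_zero, Complex.exp_zero] at h3
    rw [← h3]
    refine setIntegral_congr_fun measurableSet_Iic fun x hx => ?_
    rw [abs_of_nonpos (Set.mem_Iic.1 hx), Complex.ofReal_exp, ← Complex.exp_add]
    congr 1; rw [hw]; push_cast; ring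
  have h2 : ∫ x in Set.Ioi (0 : ℝ), cexp (((-2 * Real.pi * (ξ * x) : ℝ) : ℂ) * I) *
      ((Real.exp (-|x|) : ℝ) : ℂ) = 1 / (1 + w * I) := by
    have h3 : -1 / (-1 - w * I) = 1 / (1 + w * I) := by
      rw [← neg_div_neg_eq]; congr 1 <;> ring
    have h4 := integral_exp_mul_complex_Ioi (a := -1 - w * I) (by simp) 0
    rw [Complex.ofReal_zero, mul_zero, Complex.exp_zero] at h4
    rw [← h3, ← h4]
    refine setIntegral_congr_fun measurableSet_Ioi fun x hx => ?_
    rw [abs_of_pos (Set.mem_Ioi.1 hx), Complex.ofReal_exp, ← Complex.exp_add]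
    congr 1; rw [hw]; push_cast; ring
  rw [h1, h2]
  have n1 : (1 - w * I : ℂ) ≠ 0 := fun h => by simpa using congrArg Complex.re h
  have n2 : (1 + w * I : ℂ) ≠ 0 := fun h => by simpa using congrArg Complex.re h
  have n3 : (1 + w ^ 2 : ℂ) ≠ 0 := by
    have : (1 + w ^ 2 : ℝ) ≠ 0 := by positivity
    exact_mod_cast this
  push_cast
  field_simp
  linear_combination 2 * w ^ 2 * I_sq

theorem subordInt_eq {l : ℝ} (hl : 0 ≤ l) : subordInt l = Real.sqrt Real.pi * Real.exp (-l) := by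
  have hinv := Continuous.fourierInv_fourier_eq (f := fun x : ℝ => ((Real.exp (-|x|) : ℝ) : ℂ))
    (by fun_prop) integrable_exp_neg_abs ?_
  swap
  · simp_rw [funext fourier_exp_neg_abs]
    exact ((integrable_inv_one_add_sq.comp_mul_left' (by positivity :
      2 * Real.pi ≠ 0)).const_mul 2).ofReal
  have h := congrFun hinv l
  rw [Real.fourierInv_eq', funext fourier_exp_neg_abs] at h
  simp only [RCLike.inner_apply, conj_trivial, smul_eq_mul] at h
  have hc := integral_cauchy_mul_exp_inner (E := ℝ) l
  simp only [RCLike.inner_apply, conj_trivial, Module.finrank_self, Nat.cast_one,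
    Real.norm_eq_abs, sq_abs, abs_of_nonneg hl] at hc
  have hcomp := Measure.integral_comp_mul_left (fun y : ℝ =>
    (((1 + y ^ 2) ^ (-((1 : ℝ) + 1) / 2) : ℝ) : ℂ) * cexp (((l * y : ℝ) : ℂ) * I)) (2 * Real.pi)
  have e : ∀ x : ℝ, cexp (((2 * Real.pi * (l * x) : ℝ) : ℂ) * I) *
      ((2 * (1 + (2 * Real.pi * x) ^ 2)⁻¹ : ℝ) : ℂ) = 2 *
      ((((1 + (2 * Real.pi * x) ^ 2) ^ (-((1 : ℝ) + 1) / 2) : ℝ) : ℂ) *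
        cexp (((l * (2 * Real.pi * x) : ℝ) : ℂ) * I)) := by
    intro x
    rw [show (-((1 : ℝ) + 1) / 2) = -1 by norm_num, Real.rpow_neg_one]
    push_cast; ring_nf
  simp_rw [e] at h
  rw [integral_const_mul, hcomp, hc] at h
  simp only [abs_of_nonneg hl] at h
  rw [abs_of_pos (by positivity), Complex.real_smul] at h
  norm_num [Real.Gamma_one] at h
  have h2 : (2 * ((Real.pi⁻¹ * (1 / 2)) * (Real.pi ^ ((1 : ℝ) / 2) * subordInt l))) =
      Real.exp (-l) := by
    rw [← Complex.ofReal_inj, Complex.ofReal_exp, Complex.ofReal_neg, ← h]; push_cast; ring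
  rw [← h2, Real.sqrt_eq_rpow]
  have : Real.pi ^ ((1 : ℝ) / 2) * Real.pi ^ ((1 : ℝ) / 2) = Real.pi := by
    rw [← Real.sqrt_eq_rpow, Real.mul_self_sqrt Real.pi_pos.le]
  have hp := Real.pi_pos.ne'
  field_simp
  linear_combination (-subordInt l) * this

/-- The density of the Poisson kernel at height one. -/
def poissonDensity (x : E) : ℝ :=
  Real.Gamma (((Module.finrank ℝ E : ℝ) + 1) / 2) *
    Real.pi ^ (-((Module.finrank ℝ E : ℝ) + 1) / 2) *
    (1 + ‖x‖ ^ 2) ^ (-((Module.finrank ℝ E : ℝ) + 1) / 2)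

theorem poissonDensity_pos (x : E) : 0 < poissonDensity x := by
  have := Real.Gamma_pos_of_pos (by positivity : 0 < ((Module.finrank ℝ E : ℝ) + 1) / 2)
  unfold poissonDensity
  positivity

theorem continuous_poissonDensity : Continuous (poissonDensity : E → ℝ) := by
  unfold poissonDensity
  refine continuous_const.mul (Continuous.rpow_const (by fun_prop) fun x => Or.inl ?_)
  positivity

theorem integrable_poissonDensity : Integrable (poissonDensity : E → ℝ) := by
  refine Integrable.const_mul ?_ _
  exact integrable_rpow_neg_one_add_norm_sq (by simp)

theorem integral_poissonDensity_mul_exp_inner (ξ : E) :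
    ∫ x : E, (poissonDensity x : ℂ) * cexp (⟪x, ξ⟫ * I) = (Real.exp (-‖ξ‖) : ℝ) := by
  have hΓ := Real.Gamma_pos_of_pos (by positivity : 0 < ((Module.finrank ℝ E : ℝ) + 1) / 2)
  unfold poissonDensity
  have e : ∀ (a b : ℝ) (z : ℂ), ((a * b : ℝ) : ℂ) * z = (a : ℂ) * ((b : ℂ) * z) := fun a b z => by
    push_cast; ring
  simp_rw [e]
  rw [integral_const_mul, integral_const_mul, integral_cauchy_mul_exp_inner,
    subordInt_eq (norm_nonneg _),
    ← Complex.ofReal_mul, ← Complex.ofReal_mul]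
  congr 1
  have h1 : Real.pi ^ (-((Module.finrank ℝ E : ℝ) + 1) / 2) *
      Real.pi ^ ((Module.finrank ℝ E : ℝ) / 2) * Real.sqrt Real.pi = 1 := by
    rw [Real.sqrt_eq_rpow, ← Real.rpow_add Real.pi_pos, ← Real.rpow_add Real.pi_pos,
      ← Real.rpow_zero Real.pi]
    congr 1; ring
  have h2 := mul_inv_cancel₀ hΓ.ne'
  generalize (Real.Gamma (((Module.finrank ℝ E : ℝ) + 1) / 2))⁻¹ = y at h2 ⊢
  linear_combination (Real.exp (-‖ξ‖) * Real.Gamma (((Module.finrank ℝ E : ℝ) + 1) / 2) * y) * h1 +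
    Real.exp (-‖ξ‖) * h2

/-- The Poisson measure at height one. -/
def poissonMeasure (E : Type*) [NormedAddCommGroup E] [InnerProductSpace ℝ E]
    [FiniteDimensional ℝ E] [MeasurableSpace E] [BorelSpace E] : Measure E :=
  volume.withDensity fun x => ENNReal.ofReal (poissonDensity x)

theorem integral_poissonMeasure {F : Type*} [NormedAddCommGroup F] [NormedSpace ℝ F] (f : E → F) :
    ∫ x, f x ∂poissonMeasure E = ∫ x, poissonDensity x • f x := by
  have h := integral_withDensity_eq_integral_smul (μ := (volume : Measure E))
    (f := fun x => (poissonDensity x).toNNReal) (by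
      exact continuous_poissonDensity.measurable.real_toNNReal) f
  rw [poissonMeasure]
  refine h.trans (integral_congr_ae (Eventually.of_forall fun x => ?_))
  simp only [NNReal.smul_def, Real.coe_toNNReal _ (poissonDensity_pos x).le]

theorem lintegral_poissonMeasure {f : E → ℝ≥0∞} (hf : Measurable f) :
    ∫⁻ x, f x ∂poissonMeasure E = ∫⁻ x, ENNReal.ofReal (poissonDensity x) * f x :=
  lintegral_withDensity_eq_lintegral_mul _
    continuous_poissonDensity.measurable.ennreal_ofReal hf

theorem integral_poissonDensity : ∫ x : E, poissonDensity x = 1 := by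
  have h := integral_poissonDensity_mul_exp_inner (0 : E)
  simp only [inner_zero_right, Complex.ofReal_zero, zero_mul, Complex.exp_zero, mul_one,
    norm_zero, neg_zero, Real.exp_zero, integral_complex_ofReal] at h
  exact_mod_cast h

instance : IsProbabilityMeasure (poissonMeasure E) := by
  refine ⟨?_⟩
  rw [poissonMeasure, withDensity_apply _ MeasurableSet.univ, Measure.restrict_univ,
    ← ofReal_integral_eq_lintegral_ofReal integrable_poissonDensity
      (Eventually.of_forall fun x => (poissonDensity_pos x).le), integral_poissonDensity]
  simp

theorem charFun_poissonMeasure (ξ : E) : charFun (poissonMeasure E) ξ = (Real.exp (-‖ξ‖) : ℝ) := by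
  rw [charFun_apply, integral_poissonMeasure, ← integral_poissonDensity_mul_exp_inner]
  simp

theorem poissonMeasure_conv : (poissonMeasure E).conv (poissonMeasure E) =
    (poissonMeasure E).map fun z => (2 : ℝ) • z := by
  have : IsProbabilityMeasure ((poissonMeasure E).map fun z => (2 : ℝ) • z) :=
    Measure.isProbabilityMeasure_map (by fun_prop)
  refine Measure.ext_of_charFun (funext fun ξ => ?_)
  rw [charFun_conv, charFun_map_smul, charFun_poissonMeasure, charFun_poissonMeasure,
    ← Complex.ofReal_mul, ← Real.exp_add, norm_smul]
  congr 2
  norm_num; ring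

theorem poissonMeasure_map_neg : ((poissonMeasure E).map fun z => -z) = poissonMeasure E := by
  have : IsProbabilityMeasure ((poissonMeasure E).map fun z => (-1 : ℝ) • z) :=
    Measure.isProbabilityMeasure_map (by fun_prop)
  have e : (fun z : E => -z) = fun z => (-1 : ℝ) • z := by ext z; simp
  rw [e]
  refine Measure.ext_of_charFun (funext fun ξ => ?_)
  rw [charFun_map_smul, charFun_poissonMeasure, charFun_poissonMeasure, norm_smul]
  simp

theorem one_add_norm_rpow_le_poissonDensity : ∃ c : ℝ, 0 < c ∧ ∀ x : E,
    (1 + ‖x‖) ^ (-((Module.finrank ℝ E : ℝ) + 1)) ≤ c * poissonDensity x := by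
  have hΓ := Real.Gamma_pos_of_pos (by positivity : 0 < ((Module.finrank ℝ E : ℝ) + 1) / 2)
  set A := Real.Gamma (((Module.finrank ℝ E : ℝ) + 1) / 2) *
    Real.pi ^ (-((Module.finrank ℝ E : ℝ) + 1) / 2) with hA
  have hA0 : 0 < A := by positivity
  refine ⟨A⁻¹, by positivity, fun x => ?_⟩
  rw [poissonDensity, ← hA, inv_mul_cancel_left₀ hA0.ne',
    show -((Module.finrank ℝ E : ℝ) + 1) = 2 * (-((Module.finrank ℝ E : ℝ) + 1) / 2) by ring,
    Real.rpow_mul (by positivity), mul_div_cancel_left₀ _ (by norm_num : (2 : ℝ) ≠ 0)]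
  refine Real.rpow_le_rpow_of_nonpos (by positivity) ?_ ?_
  · rw [Real.rpow_two]; nlinarith [norm_nonneg x]
  · have : (0 : ℝ) ≤ Module.finrank ℝ E := by positivity
    linarith

theorem polyDecay_poissonMeasure : ∃ c : ℝ, 0 ≤ c ∧ PolyDecay (poissonMeasure E) c := by
  have hΓ := Real.Gamma_pos_of_pos (by positivity : 0 < ((Module.finrank ℝ E : ℝ) + 1) / 2)
  set A := Real.Gamma (((Module.finrank ℝ E : ℝ) + 1) / 2) *
    Real.pi ^ (-((Module.finrank ℝ E : ℝ) + 1) / 2) with hA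
  set e := ((Module.finrank ℝ E : ℝ) + 1) / 2 with he
  have he0 : 0 ≤ e := by positivity
  refine ⟨A * 2 ^ e, by positivity, withDensity_mono (Eventually.of_forall fun x => ?_)⟩
  refine ENNReal.ofReal_le_ofReal ?_
  rw [poissonDensity, ← he, ← hA, mul_assoc A]
  refine mul_le_mul_of_nonneg_left ?_ (by positivity : 0 ≤ A)
  have h : (1 + ‖x‖) ^ 2 / 2 ≤ 1 + ‖x‖ ^ 2 := by nlinarith [sq_nonneg (1 - ‖x‖)]
  calc _ ≤ ((1 + ‖x‖) ^ 2 / 2) ^ (-((Module.finrank ℝ E : ℝ) + 1) / 2) :=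
        Real.rpow_le_rpow_of_nonpos (by positivity) h (by rw [neg_div]; linarith)
    _ = _ := by
        rw [neg_div, ← he, Real.div_rpow (by positivity) (by norm_num),
          Real.rpow_neg (by norm_num : (0 : ℝ) ≤ 2),
          div_inv_eq_mul, mul_comm, ← Real.rpow_natCast, ← Real.rpow_mul (by positivity)]
        congr 2
        rw [he]; push_cast; ring

end Poisson

section Kernel

open scoped FourierTransform ContDiff

variable {E : Type*} [NormedAddCommGroup E] [InnerProductSpace ℝ E] [FiniteDimensional ℝ E]
  [MeasurableSpace E] [BorelSpace E]

theorem integral_mul_fourierInv_sub_smul {κ G : E → ℂ} (hκ : Integrable κ) (hG : Integrable G)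
    (t : ℝ) (x : E) :
    ∫ z, κ z * 𝓕⁻ G (x - t • z) = 𝓕⁻ (fun ξ => 𝓕 κ (t • ξ) * G ξ) x := by
  simp_rw [Real.fourierInv_eq', Real.fourier_eq', smul_eq_mul]
  have hInt : Integrable (Function.uncurry fun (z ξ : E) =>
      κ z * (cexp (((2 * Real.pi * ⟪ξ, x - t • z⟫ : ℝ) : ℂ) * I) * G ξ)) (volume.prod volume) := by
    have h := (hκ.mul_prod hG).bdd_mul (c := 1)
      (f := fun q : E × E => cexp (((2 * Real.pi * ⟪q.2, x - t • q.1⟫ : ℝ) : ℂ) * I))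
      (by fun_prop) (Eventually.of_forall fun q => by rw [norm_exp_ofReal_mul_I])
    refine h.congr (Eventually.of_forall fun q => ?_)
    simp only [Function.uncurry_def]
    ring
  have hswap := integral_integral_swap hInt
  simp_rw [integral_const_mul] at hswap
  rw [hswap]
  refine integral_congr_ae (Eventually.of_forall fun ξ => ?_)
  simp only
  rw [← mul_assoc, ← integral_const_mul, ← integral_mul_const]
  refine integral_congr_ae (Eventually.of_forall fun z => ?_)
  simp only
  have e : cexp (((2 * Real.pi * ⟪ξ, x - t • z⟫ : ℝ) : ℂ) * I) =
      cexp (((2 * Real.pi * ⟪ξ, x⟫ : ℝ) : ℂ) * I) *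
        cexp (((-2 * Real.pi * ⟪z, t • ξ⟫ : ℝ) : ℂ) * I) := by
    rw [← Complex.exp_add, inner_sub_right, inner_smul_right, inner_smul_right,
      real_inner_comm z ξ]
    congr 1; push_cast; ring
  rw [e]; ring

theorem avg_poissonMeasure_fourierInv {G : E → ℂ} (hG : Integrable G) (t : ℝ) (ht : 0 ≤ t) (x : E) :
    avg (poissonMeasure E) t (𝓕⁻ G) x =
      𝓕⁻ (fun ξ => (Real.exp (-(2 * Real.pi * t * ‖ξ‖)) : ℂ) * G ξ) x := by
  have h := integral_mul_fourierInv_sub_smul (integrable_poissonDensity (E := E)).ofReal hG t x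
  have e : ∀ ξ : E, 𝓕 (fun z : E => ((poissonDensity z : ℝ) : ℂ)) (t • ξ) =
      (Real.exp (-(2 * Real.pi * t * ‖ξ‖)) : ℝ) := by
    intro ξ
    have h2 := integral_poissonDensity_mul_exp_inner ((-(2 * Real.pi * t)) • ξ)
    rw [Real.fourier_eq']
    rw [norm_smul, norm_neg, Real.norm_eq_abs, abs_of_nonneg (by positivity)] at h2
    rw [← h2]
    refine integral_congr_ae (Eventually.of_forall fun z => ?_)
    simp only [smul_eq_mul]
    rw [mul_comm, inner_smul_right, inner_smul_right]
    congr 3; ring_nf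
  have e2 : (RCLike.ofReal : ℝ → ℂ) = Complex.ofReal := rfl
  simp only [e2, e] at h
  rw [avg, integral_poissonMeasure, ← h]
  simp

theorem exists_norm_fourierInv_slice_le {N : E × ℝ → ℂ} (hN : ContDiff ℝ ∞ N)
    (hc : HasCompactSupport N) :
    ∃ C : ℝ, 0 ≤ C ∧ ∀ (ε : ℝ) (z : E),
      ‖𝓕⁻ (fun η => N (η, ε)) z‖ ≤ C * poissonDensity z := by
  set n := Module.finrank ℝ E + 1 with hn
  obtain ⟨R, hR⟩ : ∃ R : ℝ, ∀ (η : E) (ε : ℝ), R < ‖η‖ → (η, ε) ∉ tsupport N := by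
    obtain ⟨R, hR⟩ := hc.isCompact.isBounded.exists_norm_le
    refine ⟨R, fun η ε h hmem => ?_⟩
    have h1 := hR _ hmem
    have h2 : ‖η‖ ≤ ‖((η, ε) : E × ℝ)‖ := norm_fst_le (η, ε)
    linarith
  have hB : ∀ k : ℕ, ∃ B : ℝ, ∀ q, ‖iteratedFDeriv ℝ k N q‖ ≤ B := fun k =>
    (hc.iteratedFDeriv k).exists_bound_of_continuous
      (hN.continuous_iteratedFDeriv (m := k) (by exact_mod_cast le_top))
  choose B hB using hB
  have hf : ∀ ε : ℝ, ContDiff ℝ ∞ fun η : E => N (η, ε) := fun ε => hN.comp (by fun_prop)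
  have hfc : ∀ ε : ℝ, HasCompactSupport fun η : E => N (η, ε) := fun ε => by
    refine HasCompactSupport.of_support_subset_isCompact (isCompact_closedBall (0 : E) R) ?_
    intro η hη
    by_contra hcon
    rw [mem_closedBall_zero_iff, not_le] at hcon
    exact hR η ε hcon (subset_tsupport _ hη)
  have hfB : ∀ (ε : ℝ) (k : ℕ) (η : E),
      ‖iteratedFDeriv ℝ k (fun η : E => N (η, ε)) η‖ ≤ B k := by
    intro ε k η
    have e : (fun η : E => N (η, ε)) =
        (fun q => N (q + (0, ε))) ∘ (ContinuousLinearMap.inl ℝ E ℝ) := by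
      ext η; simp
    have h1 : ContDiff ℝ ∞ (fun q => N (q + (0, ε))) := hN.comp (by fun_prop)
    rw [e, ContinuousLinearMap.iteratedFDeriv_comp_right _ h1 _ (i := k) (by exact_mod_cast le_top),
      iteratedFDeriv_comp_add_right]
    refine (ContinuousMultilinearMap.norm_compContinuousLinearMap_le _ _).trans ?_
    have h2 : ∏ _i : Fin k, ‖ContinuousLinearMap.inl ℝ E ℝ‖ ≤ 1 :=
      Finset.prod_le_one (fun _ _ => by positivity)
        fun _ _ => ContinuousLinearMap.norm_inl_le_one ℝ E ℝ
    calc _ ≤ _ * 1 := mul_le_mul_of_nonneg_left h2 (norm_nonneg _)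
      _ ≤ B k := by rw [mul_one]; exact hB _ _
  set V := (volume (Metric.closedBall (0 : E) R)).toReal with hV
  have hInt : ∀ (ε : ℝ) (k m : ℕ), Integrable fun η : E =>
      ‖η‖ ^ k * ‖iteratedFDeriv ℝ m (fun η : E => N (η, ε)) η‖ := fun ε k m => by
    have hcont := (hf ε).continuous_iteratedFDeriv (m := m) (by exact_mod_cast le_top)
    exact ((by fun_prop : Continuous fun η : E => ‖η‖ ^ k *
      ‖iteratedFDeriv ℝ m (fun η : E => N (η, ε)) η‖)).integrable_of_hasCompactSupport
        (((hfc ε).iteratedFDeriv m).norm.mul_left)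
  have hI : ∀ (ε : ℝ) (m : ℕ), ∫ η : E, ‖η‖ ^ 0 *
      ‖iteratedFDeriv ℝ m (fun η : E => N (η, ε)) η‖ ≤ B m * V := by
    intro ε m
    have h0 : ∀ η, η ∉ Metric.closedBall (0 : E) R → ‖η‖ ^ 0 *
        ‖iteratedFDeriv ℝ m (fun η : E => N (η, ε)) η‖ = 0 := by
      intro η hη
      rw [mem_closedBall_zero_iff, not_le] at hη
      have : η ∉ tsupport fun η : E => N (η, ε) := fun hmem => by
        refine hR η ε hη ?_
        have hcl : Continuous fun η : E => (η, ε) := by fun_prop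
        exact (closure_mono (fun a ha => ha) |>.trans
          (hcl.closure_preimage_subset (Function.support N))) hmem
      rw [image_eq_zero_of_notMem_tsupport (fun h => this
        (tsupport_iteratedFDeriv_subset (𝕜 := ℝ) m h)), norm_zero, mul_zero]
    rw [← setIntegral_eq_integral_of_forall_compl_eq_zero h0]
    have h1 := norm_setIntegral_le_of_norm_le_const (μ := volume) (s := Metric.closedBall (0 : E) R)
      (f := fun η : E => ‖η‖ ^ 0 * ‖iteratedFDeriv ℝ m (fun η : E => N (η, ε)) η‖) (C := B m)
      measure_closedBall_lt_top (fun η _ => by simpa using hfB ε m η)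
    exact (le_abs_self _).trans h1
  have hdecay : ∀ (m : ℕ) (ε : ℝ) (z : E), ‖z‖ ^ m * ‖𝓕⁻ (fun η => N (η, ε)) z‖ ≤
      2 ^ m * ∑ p ∈ Finset.range (m + 1), B p * V := by
    intro m ε z
    have h := Real.pow_mul_norm_iteratedFDeriv_fourier_le (K := 0) (N := ⊤)
      (by exact_mod_cast hf ε) (fun k m _ _ => hInt ε k m) (k := 0) (n := m) le_rfl le_top (-z)
    rw [norm_iteratedFDeriv_zero, ← Real.fourierInv_eq_fourier_neg, norm_neg] at h
    refine h.trans ?_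
    simp only [pow_zero, one_mul, Nat.cast_zero, mul_zero, zero_add, Finset.range_one,
      Finset.singleton_product, Finset.sum_map, Function.Embedding.coeFn_mk]
    gcongr with p
    simpa using hI ε p
  obtain ⟨c, hc0, hc⟩ := one_add_norm_rpow_le_poissonDensity (E := E)
  set S : ℕ → ℝ := fun m => 2 ^ m * ∑ p ∈ Finset.range (m + 1), B p * V with hS
  have hB0 : ∀ k, 0 ≤ B k := fun k => (norm_nonneg _).trans (hB k 0)
  have hS0 : ∀ m, 0 ≤ S m := fun m => by
    have : 0 ≤ V := ENNReal.toReal_nonneg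
    have : 0 ≤ ∑ p ∈ Finset.range (m + 1), B p * V :=
      Finset.sum_nonneg fun p _ => mul_nonneg (hB0 p) this
    positivity
  refine ⟨2 ^ n * (S 0 + S n) * c, by have := hS0 0; have := hS0 n; positivity, fun ε z => ?_⟩
  have h1 : (1 + ‖z‖) ^ n * ‖𝓕⁻ (fun η => N (η, ε)) z‖ ≤ 2 ^ n * (S 0 + S n) := by
    have h2 : (1 + ‖z‖) ^ n ≤ 2 ^ n * (‖z‖ ^ 0 + ‖z‖ ^ n) := by
      have := add_pow_le (zero_le_one' ℝ) (norm_nonneg z) n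
      refine this.trans ?_
      rw [one_pow, pow_zero]
      gcongr
      · norm_num
      · omega
    calc _ ≤ 2 ^ n * (‖z‖ ^ 0 + ‖z‖ ^ n) * ‖𝓕⁻ (fun η => N (η, ε)) z‖ := by gcongr
      _ = 2 ^ n * (‖z‖ ^ 0 * ‖𝓕⁻ (fun η => N (η, ε)) z‖ +
          ‖z‖ ^ n * ‖𝓕⁻ (fun η => N (η, ε)) z‖) := by ring
      _ ≤ _ := by
        gcongr
        · exact hdecay 0 ε z
        · exact hdecay n ε z
  have h3 : (1 + ‖z‖) ^ (-((Module.finrank ℝ E : ℝ) + 1)) = ((1 + ‖z‖) ^ n)⁻¹ := by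
    rw [Real.rpow_neg (by positivity), ← Real.rpow_natCast, hn]; push_cast; rfl
  have h4 := hc z
  rw [h3] at h4
  calc ‖𝓕⁻ (fun η => N (η, ε)) z‖ ≤ 2 ^ n * (S 0 + S n) * ((1 + ‖z‖) ^ n)⁻¹ := by
        rw [← div_eq_mul_inv, le_div_iff₀ (by positivity), mul_comm]; exact h1
    _ ≤ 2 ^ n * (S 0 + S n) * (c * poissonDensity z) := by
        have := hS0 0; have := hS0 n
        gcongr
    _ = _ := by ring

end Kernel

section Multiplier

open scoped FourierTransform ContDiff SchwartzMap

variable {E : Type*} [NormedAddCommGroup E] [InnerProductSpace ℝ E] [FiniteDimensional ℝ E]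
  [MeasurableSpace E] [BorelSpace E]

/-- The Fourier multiplier operator with real symbol `m` acting on Schwartz functions. -/
def fmul (m : E → ℝ) (f : 𝓢(E, ℂ)) : 𝓢(E, ℂ) :=
  SchwartzMap.fourierMultiplierCLM ℂ (fun ξ => (m ξ : ℂ)) f

theorem Function.HasTemperateGrowth.complex_ofReal {m : E → ℝ} (hm : m.HasTemperateGrowth) :
    (fun ξ => (m ξ : ℂ)).HasTemperateGrowth :=
  Complex.hasTemperateGrowth_ofReal.comp hm

theorem fourier_fmul {m : E → ℝ} (hm : m.HasTemperateGrowth) (f : 𝓢(E, ℂ)) (ξ : E) :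
    𝓕 (fmul m f) ξ = m ξ * 𝓕 f ξ := by
  rw [fmul, SchwartzMap.fourierMultiplierCLM_apply, FourierTransform.fourier_fourierInv_eq,
    SchwartzMap.smulLeftCLM_apply_apply hm.complex_ofReal, smul_eq_mul]

theorem fmul_apply {m : E → ℝ} (hm : m.HasTemperateGrowth) (f : 𝓢(E, ℂ)) (x : E) :
    fmul m f x = 𝓕⁻ (fun ξ => m ξ * 𝓕 f ξ) x := by
  rw [fmul, SchwartzMap.fourierMultiplierCLM_apply, SchwartzMap.fourierInv_coe]
  refine congrFun (congrArg _ (funext fun ξ => ?_)) x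
  rw [SchwartzMap.smulLeftCLM_apply_apply hm.complex_ofReal, smul_eq_mul]

theorem fmul_fmul {m₁ m₂ : E → ℝ} (h₁ : m₁.HasTemperateGrowth) (h₂ : m₂.HasTemperateGrowth)
    (f : 𝓢(E, ℂ)) : fmul m₁ (fmul m₂ f) = fmul (fun ξ => m₁ ξ * m₂ ξ) f := by
  rw [fmul, fmul, SchwartzMap.fourierMultiplierCLM_fourierMultiplierCLM_apply h₁.complex_ofReal
    h₂.complex_ofReal, fmul]
  congr 1
  ext ξ
  simp [Pi.mul_def]

theorem fmul_one (f : 𝓢(E, ℂ)) : fmul (fun _ => 1) f = f := by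
  simp [fmul]

theorem SchwartzMap.exists_norm_le (f : 𝓢(E, ℂ)) : ∃ M, ∀ x, ‖f x‖ ≤ M :=
  ⟨_, fun x => SchwartzMap.norm_le_seminorm ℝ f x⟩

theorem sq_lintegral_le {α : Type*} [MeasurableSpace α] {μ : Measure α} [IsProbabilityMeasure μ]
    {u : α → ℝ≥0∞} (hu : AEMeasurable u μ) : (∫⁻ x, u x ∂μ) ^ 2 ≤ ∫⁻ x, u x ^ 2 ∂μ := by
  have h := lintegral_rpow_inv_le (μ := μ) (r := 2) (by norm_num) (hu.pow_const 2)
  have e : ∀ y : ℝ≥0∞, (y ^ 2) ^ (1 / 2 : ℝ) = y := fun y => by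
    rw [← ENNReal.rpow_natCast, ← ENNReal.rpow_mul]; norm_num
  simp_rw [e] at h
  calc (∫⁻ x, u x ∂μ) ^ 2 ≤ ((∫⁻ x, u x ^ 2 ∂μ) ^ (1 / 2 : ℝ)) ^ 2 := by gcongr
    _ = _ := by rw [← ENNReal.rpow_natCast, ← ENNReal.rpow_mul]; norm_num

theorem enorm_integral_mul_le {κ u : E → ℂ} {C : ℝ} (hC : 0 ≤ C)
    (hκ : ∀ z, ‖κ z‖ ≤ C * poissonDensity z) (hu : Measurable u) :
    ‖∫ z, κ z * u z‖ₑ ≤ ENNReal.ofReal C * ∫⁻ z, ‖u z‖ₑ ∂(poissonMeasure E) := by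
  rw [lintegral_poissonMeasure hu.enorm,
    ← lintegral_const_mul' _ _ ENNReal.ofReal_ne_top]
  refine (enorm_integral_le_lintegral_enorm _).trans (lintegral_mono fun z => ?_)
  rw [enorm_mul, ← mul_assoc, ← ENNReal.ofReal_mul hC]
  gcongr
  rw [← ofReal_norm]
  exact ENNReal.ofReal_le_ofReal (hκ z)

/-- A smooth compactly supported symbol is the Fourier transform of an integrable kernel. -/
theorem integrable_fourierInv_and_fourier_fourierInv {m : E → ℂ} (hm : ContDiff ℝ ∞ m)
    (hc : HasCompactSupport m) : Integrable (𝓕⁻ m) ∧ 𝓕 (𝓕⁻ m) = m := by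
  set M : 𝓢(E, ℂ) := hc.toSchwartzMap hm with hM
  have e : (M : E → ℂ) = m := by ext; simp [hM]
  constructor
  · rw [← e, ← SchwartzMap.fourierInv_coe]
    exact (𝓕⁻ M).integrable
  · rw [← e, ← SchwartzMap.fourierInv_coe, ← SchwartzMap.fourier_coe,
      FourierTransform.fourier_fourierInv_eq]

theorem exists_norm_fourierInv_le {m : E → ℂ} (hm : ContDiff ℝ ∞ m) (hc : HasCompactSupport m) :
    ∃ C : ℝ, 0 ≤ C ∧ ∀ z, ‖𝓕⁻ m z‖ ≤ C * poissonDensity z := by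
  let b : ContDiffBump (0 : ℝ) := ⟨1, 2, by norm_num, by norm_num⟩
  have hN : ContDiff ℝ ∞ fun q : E × ℝ => m q.1 * ((b q.2 : ℝ) : ℂ) :=
    (hm.comp contDiff_fst).mul (Complex.ofRealCLM.contDiff.comp (b.contDiff.comp contDiff_snd))
  have hNc : HasCompactSupport fun q : E × ℝ => m q.1 * ((b q.2 : ℝ) : ℂ) := by
    refine HasCompactSupport.intro (hc.isCompact.prod b.hasCompactSupport.isCompact) ?_
    rintro ⟨η, ε⟩ h
    simp only [Set.mem_prod, not_and_or] at h
    rcases h with h | h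
    · simp [image_eq_zero_of_notMem_tsupport h]
    · simp [image_eq_zero_of_notMem_tsupport h]
  obtain ⟨C, hC, h⟩ := exists_norm_fourierInv_slice_le hN hNc
  refine ⟨C, hC, fun z => ?_⟩
  have h0 : b 0 = 1 := b.one_of_mem_closedBall (by simp [b])
  simpa [h0] using h 0 z

/-- A dilated smooth compactly supported multiplier is dominated by the Poisson average at the
corresponding scale. -/
theorem exists_enorm_fourierInv_smul_le {m : E → ℝ} (hm : ContDiff ℝ ∞ m)
    (hc : HasCompactSupport m) : ∃ C : ℝ≥0, ∀ (f : 𝓢(E, ℂ)) (t : ℝ) (x : E),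
      ‖𝓕⁻ (fun ξ => (m (t • ξ) : ℂ) * 𝓕 f ξ) x‖ₑ ≤
        C * lavg (poissonMeasure E) t (fun y => ‖f y‖ₑ) x := by
  have hm' : ContDiff ℝ ∞ fun ξ => (m ξ : ℂ) := Complex.ofRealCLM.contDiff.comp hm
  have hc' : HasCompactSupport fun ξ => (m ξ : ℂ) := hc.comp_left (g := Complex.ofReal) rfl
  obtain ⟨C, hC, h⟩ := exists_norm_fourierInv_le hm' hc'
  obtain ⟨hi, hF⟩ := integrable_fourierInv_and_fourier_fourierInv hm' hc'
  refine ⟨C.toNNReal, fun f t x => ?_⟩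
  have key := integral_mul_fourierInv_sub_smul hi (𝓕 f).integrable t x
  rw [hF, ← SchwartzMap.fourierInv_coe, FourierTransform.fourierInv_fourier_eq] at key
  rw [← key]
  exact enorm_integral_mul_le hC h
    (f.continuous.measurable.comp (by fun_prop : Measurable fun z : E => x - t • z))

end Multiplier

section LittlewoodPaley

open scoped FourierTransform ContDiff SchwartzMap

variable {E : Type*} [NormedAddCommGroup E] [InnerProductSpace ℝ E] [FiniteDimensional ℝ E]
  [MeasurableSpace E] [BorelSpace E]

/-- A smooth even cutoff, equal to `1` on the unit ball and supported in the ball of radius `2`. -/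
def cutoff (ξ : E) : ℝ := (⟨1, 2, one_pos, one_lt_two⟩ : ContDiffBump (0 : E)) ξ

theorem contDiff_cutoff : ContDiff ℝ ∞ (cutoff : E → ℝ) := ContDiffBump.contDiff _

theorem hasCompactSupport_cutoff : HasCompactSupport (cutoff : E → ℝ) :=
  ContDiffBump.hasCompactSupport _

theorem cutoff_of_le {ξ : E} (h : ‖ξ‖ ≤ 1) : cutoff ξ = 1 :=
  ContDiffBump.one_of_mem_closedBall _ (by simpa using h)

theorem cutoff_of_ge {ξ : E} (h : 2 ≤ ‖ξ‖) : cutoff ξ = 0 :=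
  ContDiffBump.zero_of_le_dist _ (by simpa using h)

theorem contDiff_cutoff_smul (t : ℝ) : ContDiff ℝ ∞ fun ξ : E => cutoff (t • ξ) :=
  contDiff_cutoff.comp (contDiff_id.const_smul t)

theorem hasTemperateGrowth_cutoff_smul (t : ℝ) :
    (fun ξ : E => cutoff (t • ξ)).HasTemperateGrowth :=
  (hasCompactSupport_cutoff.hasTemperateGrowth contDiff_cutoff).comp
    (t • ContinuousLinearMap.id ℝ E).hasTemperateGrowth

/-- The symbol of the Bessel operator of order `σ`. -/
def besselSym (σ : ℝ) (ξ : E) : ℝ := (1 + ‖(2 * Real.pi) • ξ‖ ^ 2) ^ (σ / 2)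

theorem hasTemperateGrowth_besselSym (σ : ℝ) : (besselSym σ : E → ℝ).HasTemperateGrowth :=
  (Function.hasTemperateGrowth_one_add_norm_sq_rpow E (σ / 2)).comp
    ((2 * Real.pi) • ContinuousLinearMap.id ℝ E).hasTemperateGrowth

theorem besselSym_neg (σ : ℝ) (ξ : E) : besselSym σ (-ξ) = besselSym σ ξ := by
  simp [besselSym]

theorem besselSym_mul (σ τ : ℝ) (ξ : E) :
    besselSym σ ξ * besselSym τ ξ = besselSym (σ + τ) ξ := by
  rw [besselSym, besselSym, besselSym, ← Real.rpow_add (by positivity)]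
  congr 1; ring

theorem besselSym_zero (ξ : E) : besselSym 0 ξ = 1 := by simp [besselSym]

/-- The dyadic partition of unity in frequency. -/
def lpBump : ℕ → E → ℝ
  | 0, ξ => cutoff ξ
  | j + 1, ξ => cutoff (dy (j + 1) • ξ) - cutoff (dy j • ξ)

theorem sum_lpBump (n : ℕ) (ξ : E) :
    ∑ j ∈ Finset.range (n + 1), lpBump j ξ = cutoff (dy n • ξ) := by
  induction n with
  | zero => simp [lpBump, dy]
  | succ n ih => rw [Finset.sum_range_succ, ih, lpBump]; ring

theorem hasTemperateGrowth_lpBump (j : ℕ) : (lpBump j : E → ℝ).HasTemperateGrowth := by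
  cases j with
  | zero => exact hasCompactSupport_cutoff.hasTemperateGrowth contDiff_cutoff
  | succ j => exact (hasTemperateGrowth_cutoff_smul _).sub (hasTemperateGrowth_cutoff_smul _)

theorem norm_dy_smul (j : ℕ) (ξ : E) : ‖dy j • ξ‖ = dy j * ‖ξ‖ := by
  rw [norm_smul, Real.norm_of_nonneg (dy_pos j).le]

theorem lpBump_of_ge {j : ℕ} {ξ : E} (h : 2 ≤ dy j * ‖ξ‖) : lpBump j ξ = 0 := by
  cases j with
  | zero => exact cutoff_of_ge (by simpa [dy] using h)
  | succ j =>
    have := two_mul_dy_succ j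
    have h1 := dy_pos (j + 1)
    have h2 : 0 ≤ dy (j + 1) * ‖ξ‖ := by positivity
    rw [lpBump, cutoff_of_ge (by rwa [norm_dy_smul]),
      cutoff_of_ge (by rw [norm_dy_smul, ← this]; linarith), sub_zero]

/-- The symbol `2^{-jσ} ⟨ξ⟩^σ ψ_j(ξ)`. -/
def lpSym (σ : ℝ) (j : ℕ) (ξ : E) : ℝ := dy j ^ σ * (besselSym σ ξ * lpBump j ξ)

theorem hasTemperateGrowth_lpSym (σ : ℝ) (j : ℕ) : (lpSym σ j : E → ℝ).HasTemperateGrowth :=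
  (Function.HasTemperateGrowth.const _).mul
    ((hasTemperateGrowth_besselSym σ).mul (hasTemperateGrowth_lpBump j))

theorem lpSym_of_ge {σ : ℝ} {j : ℕ} {ξ : E} (h : 2 ≤ dy j * ‖ξ‖) : lpSym σ j ξ = 0 := by
  rw [lpSym, lpBump_of_ge h, mul_zero, mul_zero]

/-- The rescaled symbol of a Littlewood-Paley piece, divided by the Poisson symbol. -/
def lpProfile (σ : ℝ) (q : E × ℝ) : ℂ :=
  (((q.2 ^ 2 + ‖(2 * Real.pi) • q.1‖ ^ 2) ^ (σ / 2) * (cutoff q.1 - cutoff ((2 : ℝ) • q.1)) *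
    Real.exp (2 * Real.pi * ‖q.1‖) *
    (⟨1, 2, one_pos, one_lt_two⟩ : ContDiffBump (0 : ℝ)) q.2 : ℝ) : ℂ)

theorem lpProfile_zero (σ ε : ℝ) : lpProfile σ ((0 : E), ε) = 0 := by simp [lpProfile]

theorem contDiff_lpProfile (σ : ℝ) : ContDiff ℝ ∞ (lpProfile σ : E × ℝ → ℂ) := by
  refine Complex.ofRealCLM.contDiff.comp (contDiff_iff_contDiffAt.2 fun q => ?_)
  by_cases hq : q.1 = 0
  · have h : ∀ᶠ y : E × ℝ in nhds q, ‖y.1‖ < 1 / 2 := by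
      refine (continuous_fst.norm.tendsto q).eventually_lt_const ?_
      simp [hq]
    refine (contDiffAt_const (c := (0 : ℝ))).congr_of_eventuallyEq ?_
    filter_upwards [h] with y hy
    have h1 : cutoff y.1 = 1 := cutoff_of_le (by linarith)
    have h2 : cutoff ((2 : ℝ) • y.1) = 1 := cutoff_of_le (by
      rw [norm_smul]; norm_num; linarith)
    simp only [h1, h2, sub_self, mul_zero, zero_mul]
    exact zero_mul _
  · have hfst : ContDiffAt ℝ ∞ (fun y : E × ℝ => y.1) q := contDiffAt_fst
    have hpos : q.2 ^ 2 + ‖(2 * Real.pi) • q.1‖ ^ 2 ≠ 0 := by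
      have : 0 < ‖(2 * Real.pi) • q.1‖ := by
        rw [norm_pos_iff]
        exact smul_ne_zero (by positivity) hq
      positivity
    refine ((ContDiffAt.mul ?_ ?_).mul ?_).mul ?_
    · exact ((contDiffAt_snd.pow 2).add ((hfst.const_smul _).norm_sq ℝ)).rpow_const_of_ne hpos
    · exact (contDiff_cutoff.contDiffAt.comp q hfst).sub
        ((contDiff_cutoff_smul 2).contDiffAt.comp q hfst)
    · exact Real.contDiff_exp.contDiffAt.comp q (contDiffAt_const.mul (hfst.norm ℝ hq))
    · exact (ContDiffBump.contDiff _).contDiffAt.comp q contDiffAt_snd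

theorem hasCompactSupport_lpProfile (σ : ℝ) :
    HasCompactSupport (lpProfile σ : E × ℝ → ℂ) := by
  refine HasCompactSupport.intro ((isCompact_closedBall (0 : E) 2).prod
    (isCompact_closedBall (0 : ℝ) 2)) ?_
  rintro ⟨η, ε⟩ h
  simp only [Set.mem_prod, not_and_or, mem_closedBall_zero_iff, not_le] at h
  rcases h with h | h
  · have h1 : cutoff η = 0 := cutoff_of_ge h.le
    have h2 : cutoff ((2 : ℝ) • η) = 0 := cutoff_of_ge (by
      rw [norm_smul]; norm_num; linarith)
    simp [lpProfile, h1, h2]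
  · have : (⟨1, 2, one_pos, one_lt_two⟩ : ContDiffBump (0 : ℝ)) ε = 0 :=
      ContDiffBump.zero_of_le_dist _ (by simpa using h.le)
    simp [lpProfile, this]

theorem lpProfile_mul_exp (σ : ℝ) (j : ℕ) (ξ : E) :
    lpProfile σ (dy (j + 1) • ξ, dy (j + 1)) *
      (Real.exp (-(2 * Real.pi * dy (j + 1) * ‖ξ‖)) : ℂ) = lpSym σ (j + 1) ξ := by
  have ht := dy_pos (j + 1)
  have hb : (⟨1, 2, one_pos, one_lt_two⟩ : ContDiffBump (0 : ℝ)) (dy (j + 1)) = 1 := by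
    refine ContDiffBump.one_of_mem_closedBall _ ?_
    simpa [abs_of_pos ht] using dy_le_one (j + 1)
  have hs : (2 : ℝ) • dy (j + 1) • ξ = dy j • ξ := by rw [smul_smul, two_mul_dy_succ]
  have he : Real.exp (2 * Real.pi * ‖dy (j + 1) • ξ‖) *
      Real.exp (-(2 * Real.pi * dy (j + 1) * ‖ξ‖)) = 1 := by
    rw [← Real.exp_add, norm_dy_smul]
    ring_nf
    exact Real.exp_zero
  have hJ : (dy (j + 1) ^ 2 + ‖(2 * Real.pi) • dy (j + 1) • ξ‖ ^ 2) ^ (σ / 2) =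
      dy (j + 1) ^ σ * besselSym σ ξ := by
    have : dy (j + 1) ^ 2 + ‖(2 * Real.pi) • dy (j + 1) • ξ‖ ^ 2 =
        dy (j + 1) ^ 2 * (1 + ‖(2 * Real.pi) • ξ‖ ^ 2) := by
      rw [smul_comm, norm_dy_smul]; ring
    rw [this, Real.mul_rpow (by positivity) (by positivity), besselSym, ← Real.rpow_natCast,
      ← Real.rpow_mul ht.le]
    congr 2
    push_cast; ring
  rw [lpProfile, ← ofReal_mul]
  congr 1
  simp only [hb, hs, hJ, mul_one]
  rw [mul_assoc, he, lpSym, lpBump]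
  ring

/-- Littlewood-Paley pieces of positive frequency are controlled by the oscillation of the Poisson
extension. -/
theorem exists_enorm_fmul_lpSym_le_osc (σ : ℝ) : ∃ C : ℝ≥0, ∀ (f : 𝓢(E, ℂ)) (j : ℕ) (x : E),
    ‖fmul (lpSym σ (j + 1)) f x‖ₑ ≤ C * osc (poissonMeasure E) f j x := by
  obtain ⟨C, hC, h⟩ := exists_norm_fourierInv_slice_le (contDiff_lpProfile (E := E) σ)
    (hasCompactSupport_lpProfile σ)
  refine ⟨C.toNNReal, fun f j x => ?_⟩
  set t := dy (j + 1) with ht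
  have ht0 : 0 < t := dy_pos (j + 1)
  have hm : ContDiff ℝ ∞ fun η : E => lpProfile σ (η, t) :=
    (contDiff_lpProfile σ).comp (contDiff_id.prodMk contDiff_const)
  have hmc : HasCompactSupport fun η : E => lpProfile σ (η, t) := by
    refine HasCompactSupport.intro ((hasCompactSupport_lpProfile (E := E) σ).isCompact.image
      continuous_fst) fun η hη => ?_
    by_contra hne
    exact hη ⟨(η, t), subset_tsupport _ hne, rfl⟩
  obtain ⟨hi, hF⟩ := integrable_fourierInv_and_fourier_fourierInv hm hmc
  set κ := 𝓕⁻ fun η : E => lpProfile σ (η, t) with hκ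
  set G : E → ℂ := fun ξ => (Real.exp (-(2 * Real.pi * t * ‖ξ‖)) : ℂ) * 𝓕 f ξ with hG
  have hGi : Integrable G := by
    refine (𝓕 f).integrable.bdd_mul (c := 1) (by fun_prop) (Eventually.of_forall fun ξ => ?_)
    rw [norm_real, Real.norm_of_nonneg (Real.exp_pos _).le, Real.exp_le_one_iff]
    have := Real.pi_pos
    have : 0 ≤ 2 * Real.pi * t * ‖ξ‖ := by positivity
    linarith
  have havg : ∀ y, avg (poissonMeasure E) t f y = 𝓕⁻ G y := fun y => by
    have := avg_poissonMeasure_fourierInv (𝓕 f).integrable t ht0.le y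
    rwa [← SchwartzMap.fourierInv_coe, FourierTransform.fourierInv_fourier_eq] at this
  obtain ⟨M, hM⟩ := f.exists_norm_le
  have hmeas : Measurable fun z => avg (poissonMeasure E) t f (x - t • z) :=
    (measurable_avg _ t f.continuous.measurable).comp
      (by fun_prop : Measurable fun z : E => x - t • z)
  have hκ0 : ∫ z, κ z = 0 := by
    have := congrFun hF 0
    rw [lpProfile_zero, Real.fourier_eq'] at this
    simpa using this
  have key : fmul (lpSym σ (j + 1)) f x = ∫ z, κ z *
      (avg (poissonMeasure E) t f (x - t • z) - avg (poissonMeasure E) (dy j) f x) := by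
    have h1 := integral_mul_fourierInv_sub_smul hi hGi t x
    rw [hF] at h1
    simp_rw [mul_sub]
    rw [integral_sub _ (hi.mul_const _), integral_mul_const, hκ0, zero_mul, sub_zero]
    · simp_rw [havg]
      rw [h1, fmul_apply (hasTemperateGrowth_lpSym _ _)]
      refine congrFun (congrArg _ (funext fun ξ => ?_)) x
      rw [hG, ← mul_assoc, lpProfile_mul_exp]
    · refine hi.mul_bdd (c := M) hmeas.aestronglyMeasurable (Eventually.of_forall fun z => ?_)
      exact norm_avg_le _ _ hM _
  rw [key]
  exact enorm_integral_mul_le hC (h t) (hmeas.sub_const _)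

theorem enorm_sq_le_lavg {a : ℂ} {C : ℝ≥0} {t : ℝ} {u : E → ℂ} (hu : Measurable u) {x : E}
    (h : ‖a‖ₑ ≤ C * lavg (poissonMeasure E) t (fun y => ‖u y‖ₑ) x) :
    ‖a‖ₑ ^ 2 ≤ (C ^ 2 : ℝ≥0) * lavg (poissonMeasure E) t (fun y => ‖u y‖ₑ ^ 2) x := by
  calc ‖a‖ₑ ^ 2 ≤ (C * lavg (poissonMeasure E) t (fun y => ‖u y‖ₑ) x) ^ 2 := by gcongr
    _ = (C ^ 2 : ℝ≥0) * lavg (poissonMeasure E) t (fun y => ‖u y‖ₑ) x ^ 2 := by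
      rw [mul_pow]; norm_cast
    _ ≤ _ := by
      refine mul_le_mul' le_rfl (sq_lintegral_le ?_)
      exact (hu.enorm.comp (by fun_prop : Measurable fun z : E => x - t • z)).aemeasurable

theorem exists_enorm_fmul_lpSym_sq_le (σ : ℝ) : ∃ C : ℝ≥0, ∀ (f : 𝓢(E, ℂ)) (j : ℕ) (x : E),
    ‖fmul (lpSym σ (j + 1)) f x‖ₑ ^ 2 ≤ C * lavg (poissonMeasure E) (dy j)
      (fun y => ‖fmul (lpSym σ (j + 1)) f y‖ₑ ^ 2) x := by
  have hm : ContDiff ℝ ∞ fun ξ : E => cutoff ((4⁻¹ : ℝ) • ξ) := contDiff_cutoff_smul _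
  have hc : HasCompactSupport fun ξ : E => cutoff ((4⁻¹ : ℝ) • ξ) :=
    hasCompactSupport_cutoff.comp_smul (by norm_num)
  obtain ⟨C, h⟩ := exists_enorm_fourierInv_smul_le hm hc
  refine ⟨C ^ 2, fun f j x => ?_⟩
  refine enorm_sq_le_lavg (SchwartzMap.continuous _).measurable ?_
  convert h (fmul (lpSym σ (j + 1)) f) (dy j) x using 2
  rw [fmul_apply (hasTemperateGrowth_lpSym _ _)]
  refine congrFun (congrArg _ (funext fun ξ => ?_)) x
  rw [fourier_fmul (hasTemperateGrowth_lpSym _ _), ← mul_assoc]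
  congr 1
  by_cases hξ : 2 ≤ dy (j + 1) * ‖ξ‖
  · simp [lpSym_of_ge hξ]
  · have : ‖(4⁻¹ : ℝ) • dy j • ξ‖ ≤ 1 := by
      rw [norm_smul, norm_dy_smul, ← two_mul_dy_succ]
      norm_num
      linarith
    rw [cutoff_of_le this]; simp

theorem exists_enorm_fmul_lpSym_zero_le (σ : ℝ) : ∃ C : ℝ≥0, ∀ (f : 𝓢(E, ℂ)) (x : E),
    ‖fmul (lpSym σ 0) f x‖ₑ ≤ C * pmax (poissonMeasure E) (fun y => ‖f y‖ₑ) x := by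
  have hm : ContDiff ℝ ∞ fun ξ : E => lpSym σ 0 ξ := by
    refine contDiff_const.mul (ContDiff.mul ?_ contDiff_cutoff)
    exact (hasTemperateGrowth_besselSym σ).1
  have hc : HasCompactSupport fun ξ : E => lpSym σ 0 ξ :=
    HasCompactSupport.mul_left (HasCompactSupport.mul_left hasCompactSupport_cutoff)
  obtain ⟨C, h⟩ := exists_enorm_fourierInv_smul_le hm hc
  refine ⟨C, fun f x => ?_⟩
  have h1 := h f (dy 0) x
  have e : dy 0 = 1 := by simp [dy]
  simp_rw [e, one_smul] at h1
  rw [← fmul_apply (hasTemperateGrowth_lpSym _ _), ← e] at h1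
  exact h1.trans (mul_le_mul' le_rfl (lavg_le_pmax _ _ _ _))

/-- Low frequency truncations are dominated by the maximal function. -/
theorem exists_enorm_fmul_cutoff_le : ∃ C : ℝ≥0, ∀ (f : 𝓢(E, ℂ)) (j : ℕ) (x : E),
    ‖fmul (fun ξ => cutoff (dy j • ξ)) f x‖ₑ ≤
      C * pmax (poissonMeasure E) (fun y => ‖f y‖ₑ) x := by
  obtain ⟨C, h⟩ := exists_enorm_fourierInv_smul_le (E := E) contDiff_cutoff
    hasCompactSupport_cutoff
  refine ⟨C, fun f j x => ?_⟩
  rw [fmul_apply (hasTemperateGrowth_cutoff_smul _)]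
  exact (h f (dy j) x).trans (mul_le_mul' le_rfl (lavg_le_pmax _ _ _ _))

/-- The Littlewood-Paley square function estimate. -/
theorem exists_lintegral_sum_lpSym_le [Nontrivial E] (σ : ℝ) {p : ℝ} (hp : 1 < p) :
    ∃ C : ℝ≥0, ∀ (f : 𝓢(E, ℂ)) (n : ℕ),
      ∫⁻ x, (∑ j ∈ Finset.range n, ‖fmul (lpSym σ j) f x‖ₑ ^ 2) ^ (p / 2) ≤
        C * ∫⁻ x, ‖f x‖ₑ ^ p := by
  obtain ⟨c, hc, hdec⟩ := polyDecay_poissonMeasure (E := E)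
  have hK := fun (p : ℝ) (hp : 1 < p) => exists_lintegral_pmax_rpow_le hc hdec hp
  obtain ⟨C₁, h₁⟩ := exists_enorm_fmul_lpSym_le_osc (E := E) σ
  obtain ⟨C₂, h₂⟩ := exists_enorm_fmul_lpSym_sq_le (E := E) σ
  obtain ⟨C₀, h₀⟩ := exists_enorm_fmul_lpSym_zero_le (E := E) σ
  obtain ⟨C, hS⟩ := lintegral_square_function_le (π := poissonMeasure E) poissonMeasure_conv
    poissonMeasure_map_neg hK hp (C₁ + C₂)
  obtain ⟨K, hKp⟩ := hK p hp
  have hp0 : 0 < p / 2 := by linarith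
  refine ⟨((2 : ℝ≥0) ^ (p / 2)) * (C + C₀ ^ p * K), fun f n => ?_⟩
  obtain ⟨M, hM⟩ := f.exists_norm_le
  have hfm : Measurable fun y => ‖f y‖ₑ := f.continuous.measurable.enorm
  have hmain := hS f M (fun j => fmul (lpSym σ (j + 1)) f) f.continuous.measurable hM
    (fun j => (SchwartzMap.continuous _).measurable)
    (fun j x => (h₁ f j x).trans (by gcongr; simp))
    (fun j x => (h₂ f j x).trans (by gcongr; simp)) n
  have hzero : ∫⁻ x, (‖fmul (lpSym σ 0) f x‖ₑ ^ 2) ^ (p / 2) ≤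
      (C₀ ^ p * K : ℝ≥0) * ∫⁻ x, ‖f x‖ₑ ^ p := by
    calc ∫⁻ x, (‖fmul (lpSym σ 0) f x‖ₑ ^ 2) ^ (p / 2)
        ≤ ∫⁻ x, (C₀ : ℝ≥0∞) ^ p * pmax (poissonMeasure E) (fun y => ‖f y‖ₑ) x ^ p := by
          refine lintegral_mono fun x => ?_
          rw [← ENNReal.rpow_natCast, ← ENNReal.rpow_mul, ← ENNReal.mul_rpow_of_nonneg _ _
            (by linarith : (0 : ℝ) ≤ p)]
          have : ((2 : ℕ) : ℝ) * (p / 2) = p := by push_cast; ring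
          rw [this]
          exact ENNReal.rpow_le_rpow (h₀ f x) (by linarith)
      _ = (C₀ : ℝ≥0∞) ^ p * ∫⁻ x, pmax (poissonMeasure E) (fun y => ‖f y‖ₑ) x ^ p :=
          lintegral_const_mul _ ((measurable_pmax _ hfm).pow_const p)
      _ ≤ (C₀ : ℝ≥0∞) ^ p * (K * ∫⁻ x, ‖f x‖ₑ ^ p) := mul_le_mul' le_rfl (hKp _ hfm)
      _ = _ := by
        rw [← mul_assoc, ENNReal.coe_mul, ENNReal.coe_rpow_of_nonneg _ (by linarith : 0 ≤ p)]
  have hsum : ∀ a b : ℝ≥0∞, (a + b) ^ (p / 2) ≤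
      ((2 : ℝ≥0) ^ (p / 2) : ℝ≥0) * (a ^ (p / 2) + b ^ (p / 2)) := fun a b => by
    rw [ENNReal.coe_rpow_of_nonneg _ hp0.le]
    calc (a + b) ^ (p / 2) ≤ ((2 : ℝ≥0) * max a b) ^ (p / 2) := by
          refine ENNReal.rpow_le_rpow ?_ hp0.le
          push_cast
          rw [two_mul]
          exact add_le_add (le_max_left _ _) (le_max_right _ _)
      _ = ((2 : ℝ≥0) : ℝ≥0∞) ^ (p / 2) * max a b ^ (p / 2) :=
          ENNReal.mul_rpow_of_nonneg _ _ hp0.le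
      _ ≤ _ := by
        gcongr
        rcases max_choice a b with h | h <;> rw [h]
        · exact le_self_add
        · exact le_add_self
  have hmeas : ∀ j, Measurable fun x => ‖fmul (lpSym σ j) f x‖ₑ ^ 2 := fun j =>
    (SchwartzMap.continuous _).measurable.enorm.pow_const 2
  calc ∫⁻ x, (∑ j ∈ Finset.range n, ‖fmul (lpSym σ j) f x‖ₑ ^ 2) ^ (p / 2)
      ≤ ∫⁻ x, ((2 : ℝ≥0) ^ (p / 2) : ℝ≥0) *
          ((∑ j ∈ Finset.range n, ‖fmul (lpSym σ (j + 1)) f x‖ₑ ^ 2) ^ (p / 2) +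
            (‖fmul (lpSym σ 0) f x‖ₑ ^ 2) ^ (p / 2)) := by
        refine lintegral_mono fun x => le_trans ?_ (hsum _ _)
        refine ENNReal.rpow_le_rpow ?_ hp0.le
        rw [← Finset.sum_range_succ' (fun j => ‖fmul (lpSym σ j) f x‖ₑ ^ 2)]
        exact Finset.sum_le_sum_of_subset (Finset.range_mono n.le_succ)
    _ = ((2 : ℝ≥0) ^ (p / 2) : ℝ≥0) *
          ((∫⁻ x, (∑ j ∈ Finset.range n, ‖fmul (lpSym σ (j + 1)) f x‖ₑ ^ 2) ^ (p / 2)) +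
            ∫⁻ x, (‖fmul (lpSym σ 0) f x‖ₑ ^ 2) ^ (p / 2)) := by
        rw [lintegral_const_mul' _ _ ENNReal.coe_ne_top,
          lintegral_add_right _ ((hmeas 0).pow_const _)]
    _ ≤ ((2 : ℝ≥0) ^ (p / 2) : ℝ≥0) * (C * (∫⁻ x, ‖f x‖ₑ ^ p) +
          (C₀ ^ p * K : ℝ≥0) * ∫⁻ x, ‖f x‖ₑ ^ p) :=
        mul_le_mul' le_rfl (add_le_add hmain hzero)
    _ = _ := by
      rw [← add_mul, ← mul_assoc]
      norm_cast

end LittlewoodPaley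

section Paraproduct

open scoped FourierTransform ContDiff SchwartzMap

variable {E : Type*} [NormedAddCommGroup E] [InnerProductSpace ℝ E] [FiniteDimensional ℝ E]
  [MeasurableSpace E] [BorelSpace E]

/-- The pointwise product of two Schwartz functions. -/
def smulS (f g : 𝓢(E, ℂ)) : 𝓢(E, ℂ) := SchwartzMap.pairing (ContinuousLinearMap.mul ℂ ℂ) f g

theorem smulS_apply (f g : 𝓢(E, ℂ)) (x : E) : smulS f g x = f x * g x := rfl

theorem SchwartzMap.integrable_mul (f g : 𝓢(E, ℂ)) : Integrable fun x => f x * g x :=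
  (smulS f g).integrable

theorem SchwartzMap.integrable_mul_mul (f g h : 𝓢(E, ℂ)) :
    Integrable fun x => f x * g x * h x :=
  (smulS (smulS f g) h).integrable

theorem integral_mul_eq_integral_fourier (w h : 𝓢(E, ℂ)) :
    ∫ x, w x * h x = ∫ ξ, 𝓕⁻ w ξ * 𝓕 h ξ := by
  rw [← SchwartzMap.integral_fourier_mul_eq, FourierTransform.fourier_fourierInv_eq]

theorem integral_mul_fmul {m : E → ℝ} (hm : m.HasTemperateGrowth) (heven : ∀ ξ, m (-ξ) = m ξ)
    (w h : 𝓢(E, ℂ)) : ∫ x, w x * fmul m h x = ∫ x, fmul m w x * h x := by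
  rw [integral_mul_eq_integral_fourier w, integral_mul_eq_integral_fourier (fmul m w)]
  refine integral_congr_ae (Eventually.of_forall fun ξ => ?_)
  have h1 : ∀ v : 𝓢(E, ℂ), 𝓕⁻ v ξ = 𝓕 v (-ξ) := fun v => by
    rw [SchwartzMap.fourierInv_coe, SchwartzMap.fourier_coe, Real.fourierInv_eq_fourier_neg]
  simp only [h1, fourier_fmul hm, heven]
  ring

theorem fourierInv_smulS_apply (u v : 𝓢(E, ℂ)) (ξ : E) :
    𝓕⁻ (smulS u v) ξ = ∫ t, 𝓕⁻ u t * 𝓕⁻ v (ξ - t) := by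
  have h : 𝓕⁻ (smulS u v) =
      SchwartzMap.convolution (ContinuousLinearMap.mul ℂ ℂ) (𝓕⁻ u) (𝓕⁻ v) := by
    simp [SchwartzMap.convolution, smulS]
  rw [h, SchwartzMap.convolution_apply]
  rfl

theorem fourierInv_eq_zero {u : 𝓢(E, ℂ)} {R : ℝ} (hu : ∀ ξ, R ≤ ‖ξ‖ → 𝓕 u ξ = 0) {ξ : E}
    (h : R ≤ ‖ξ‖) : 𝓕⁻ u ξ = 0 := by
  rw [SchwartzMap.fourierInv_coe, Real.fourierInv_eq_fourier_neg, ← SchwartzMap.fourier_coe]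
  exact hu _ (by rwa [norm_neg])

/-- The product of two band-limited functions does not interact with higher frequencies. -/
theorem integral_mul_mul_fmul {m : E → ℝ} (hm : m.HasTemperateGrowth) {R : ℝ} {u v : 𝓢(E, ℂ)}
    (hu : ∀ ξ, R ≤ ‖ξ‖ → 𝓕 u ξ = 0) (hv : ∀ ξ, R ≤ ‖ξ‖ → 𝓕 v ξ = 0)
    (hm1 : ∀ ξ, ‖ξ‖ ≤ 2 * R → m ξ = 1) (h : 𝓢(E, ℂ)) :
    ∫ x, u x * v x * h x = ∫ x, u x * v x * fmul m h x := by
  have e := integral_mul_eq_integral_fourier (smulS u v)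
  simp only [smulS_apply] at e
  rw [e, e]
  refine integral_congr_ae (Eventually.of_forall fun ξ => ?_)
  simp only [fourier_fmul hm]
  by_cases hξ : ‖ξ‖ ≤ 2 * R
  · rw [hm1 ξ hξ, ofReal_one, one_mul]
  · have : 𝓕⁻ (smulS u v) ξ = 0 := by
      rw [fourierInv_smulS_apply]
      refine integral_eq_zero_of_ae (Eventually.of_forall fun t => ?_)
      rcases le_or_gt R ‖t‖ with ht | ht
      · simp [fourierInv_eq_zero hu ht]
      · have : R ≤ ‖ξ - t‖ := by
          have := norm_sub_norm_le ξ t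
          linarith
        simp [fourierInv_eq_zero hv this]
    rw [this, zero_mul, zero_mul]

theorem sum_fmul_lpBump (f : 𝓢(E, ℂ)) (n : ℕ) (x : E) :
    ∑ j ∈ Finset.range (n + 1), fmul (lpBump j) f x = fmul (fun ξ => cutoff (dy n • ξ)) f x := by
  have h := SchwartzMap.fourierMultiplierCLM_sum ℂ (s := Finset.range (n + 1))
    (g := fun j (ξ : E) => ((lpBump j ξ : ℝ) : ℂ))
    fun j _ => (hasTemperateGrowth_lpBump j).complex_ofReal
  have h2 : (fun ξ : E => ∑ j ∈ Finset.range (n + 1), ((lpBump j ξ : ℝ) : ℂ)) =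
      fun ξ => ((cutoff (dy n • ξ) : ℝ) : ℂ) := by
    ext ξ; rw [← sum_lpBump]; push_cast; rfl
  rw [h2] at h
  rw [fmul, h]
  simp [fmul]

theorem sum_mul_sum_telescope (a b : ℕ → ℂ) (n : ℕ) :
    (∑ j ∈ Finset.range (n + 1), a j) * ∑ j ∈ Finset.range (n + 1), b j =
      ∑ j ∈ Finset.range (n + 1), a j * ∑ i ∈ Finset.range (j + 1), b i +
        ∑ j ∈ Finset.range n, (∑ i ∈ Finset.range (j + 1), a i) * b (j + 1) := by
  induction n with
  | zero => simp
  | succ n ih =>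
    rw [Finset.sum_range_succ a, Finset.sum_range_succ b, add_mul, mul_add, ih,
      Finset.sum_range_succ (fun j => a j * _) (n + 1),
      Finset.sum_range_succ (fun j => (∑ i ∈ Finset.range (j + 1), a i) * b (j + 1)) n,
      Finset.sum_range_succ b (n + 1)]
    ring

theorem cutoff_dy_of_ge {j : ℕ} {ξ : E} (h : 2 ≤ dy j * ‖ξ‖) : cutoff (dy j • ξ) = 0 :=
  cutoff_of_ge (by rwa [norm_dy_smul])

theorem dy_add_two (j : ℕ) : dy (j + 2) = dy j / 4 := by
  have h1 := two_mul_dy_succ j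
  have h2 := two_mul_dy_succ (j + 1)
  linarith

theorem enorm_integral_paraproduct_le (f g h : 𝓢(E, ℂ)) (j : ℕ) {m₁ m₂ : E → ℝ}
    (hm₁ : m₁.HasTemperateGrowth) (hm₂ : m₂.HasTemperateGrowth)
    (h₁ : ∀ ξ, 2 ≤ dy j * ‖ξ‖ → m₁ ξ = 0) (h₂ : ∀ ξ, 2 ≤ dy j * ‖ξ‖ → m₂ ξ = 0) :
    ‖∫ x, fmul m₁ f x * fmul m₂ g x * h x‖ₑ ≤
      ∫⁻ x, ‖fmul m₁ f x‖ₑ * ‖fmul m₂ g x‖ₑ *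
        ∑ k ∈ Finset.range (j + 3), ‖fmul (lpBump k) h x‖ₑ := by
  have hd := dy_pos j
  have e : ∀ ξ : E, 2 / dy j ≤ ‖ξ‖ → 2 ≤ dy j * ‖ξ‖ := fun ξ hξ => by
    rwa [div_le_iff₀ hd, mul_comm] at hξ
  rw [integral_mul_mul_fmul (R := 2 / dy j) (hasTemperateGrowth_cutoff_smul (dy (j + 2)))]
  · refine (enorm_integral_le_lintegral_enorm _).trans (lintegral_mono fun x => ?_)
    rw [enorm_mul, enorm_mul, ← sum_fmul_lpBump]
    gcongr
    exact enorm_sum_le _ _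
  · intro ξ hξ
    rw [fourier_fmul hm₁, h₁ ξ (e ξ hξ), ofReal_zero, zero_mul]
  · intro ξ hξ
    rw [fourier_fmul hm₂, h₂ ξ (e ξ hξ), ofReal_zero, zero_mul]
  · intro ξ hξ
    refine cutoff_of_le ?_
    rw [norm_dy_smul, dy_add_two]
    have : dy j * ‖ξ‖ ≤ dy j * (2 * (2 / dy j)) := by gcongr
    have e2 : dy j * (2 * (2 / dy j)) = 4 := by field_simp; norm_num
    linarith

/-- Frequency decomposition of a trilinear integral. -/
theorem enorm_integral_cutoff_mul_le : ∃ C : ℝ≥0, ∀ (f g h : 𝓢(E, ℂ)) (n : ℕ),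
    ‖∫ x, fmul (fun ξ => cutoff (dy n • ξ)) f x * fmul (fun ξ => cutoff (dy n • ξ)) g x * h x‖ₑ ≤
      (∫⁻ x, (∑ j ∈ Finset.range (n + 1), ‖fmul (lpBump j) f x‖ₑ *
          ∑ k ∈ Finset.range (j + 3), ‖fmul (lpBump k) h x‖ₑ) *
            (C * pmax (poissonMeasure E) (fun y => ‖g y‖ₑ) x)) +
      ∫⁻ x, (∑ j ∈ Finset.range (n + 1), ‖fmul (lpBump j) g x‖ₑ *
          ∑ k ∈ Finset.range (j + 3), ‖fmul (lpBump k) h x‖ₑ) *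
            (C * pmax (poissonMeasure E) (fun y => ‖f y‖ₑ) x) := by
  obtain ⟨C, hC⟩ := exists_enorm_fmul_cutoff_le (E := E)
  refine ⟨C, fun f g h n => ?_⟩
  have hm : ∀ u : 𝓢(E, ℂ), Measurable fun x => ‖u x‖ₑ := fun u => u.continuous.measurable.enorm
  have hΦ : ∀ (u v : 𝓢(E, ℂ)) (j : ℕ), Measurable fun x => ‖fmul (lpBump j) u x‖ₑ *
      (∑ k ∈ Finset.range (j + 3), ‖fmul (lpBump k) h x‖ₑ) *
        (C * pmax (poissonMeasure E) (fun y => ‖v y‖ₑ) x) := fun u v j =>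
    ((hm _).mul (Finset.measurable_fun_sum _ fun k _ => hm _)).mul
      ((measurable_pmax _ (hm v)).const_mul _)
  have hsplit : ∫ x, fmul (fun ξ => cutoff (dy n • ξ)) f x *
        fmul (fun ξ => cutoff (dy n • ξ)) g x * h x =
      ∑ j ∈ Finset.range (n + 1), (∫ x, fmul (lpBump j) f x *
        fmul (fun ξ => cutoff (dy j • ξ)) g x * h x) +
      ∑ j ∈ Finset.range n, ∫ x, fmul (fun ξ => cutoff (dy j • ξ)) f x *
        fmul (lpBump (j + 1)) g x * h x := by
    rw [← integral_finsetSum _ fun j _ => SchwartzMap.integrable_mul_mul _ _ _,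
      ← integral_finsetSum _ fun j _ => SchwartzMap.integrable_mul_mul _ _ _,
      ← integral_add (integrable_finsetSum _ fun j _ => SchwartzMap.integrable_mul_mul _ _ _)
        (integrable_finsetSum _ fun j _ => SchwartzMap.integrable_mul_mul _ _ _)]
    refine integral_congr_ae (Eventually.of_forall fun x => ?_)
    simp only [← sum_fmul_lpBump]
    rw [sum_mul_sum_telescope, add_mul, Finset.sum_mul, Finset.sum_mul]
  rw [hsplit]
  refine (enorm_add_le _ _).trans (add_le_add ?_ ?_)
  · refine (enorm_sum_le _ _).trans ?_
    simp_rw [Finset.sum_mul]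
    rw [lintegral_finsetSum _ fun j _ => hΦ f g j]
    refine Finset.sum_le_sum fun j _ => ?_
    refine (enorm_integral_paraproduct_le f g h j (hasTemperateGrowth_lpBump j)
      (hasTemperateGrowth_cutoff_smul _) (fun ξ => lpBump_of_ge) fun ξ => cutoff_dy_of_ge).trans
      (lintegral_mono fun x => ?_)
    rw [mul_right_comm]
    exact mul_le_mul' le_rfl (hC g j x)
  · refine (enorm_sum_le _ _).trans ?_
    simp_rw [Finset.sum_mul]
    rw [lintegral_finsetSum _ fun j _ => hΦ g f j, Finset.sum_range_succ']
    refine le_add_right (Finset.sum_le_sum fun j _ => ?_)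
    refine (enorm_integral_paraproduct_le f g h (j + 1) (hasTemperateGrowth_cutoff_smul _)
      (hasTemperateGrowth_lpBump (j + 1)) (fun ξ hξ => cutoff_dy_of_ge ?_)
      fun ξ => lpBump_of_ge).trans (lintegral_mono fun x => ?_)
    · have := two_mul_dy_succ j
      have h2 := (dy_pos (j + 1)).le
      have : dy (j + 1) * ‖ξ‖ ≤ dy j * ‖ξ‖ := by gcongr; linarith
      linarith
    · rw [mul_comm ‖fmul (fun ξ => cutoff (dy j • ξ)) f x‖ₑ, mul_right_comm]
      exact mul_le_mul' le_rfl (hC f j x)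

end Paraproduct

theorem ENNReal.sum_mul_sum_geometric_le (q : ℝ≥0∞) (a b : ℕ → ℝ≥0∞) (n : ℕ) :
    ∑ j ∈ Finset.range n, a j * ∑ k ∈ Finset.range (j + 3), q ^ (j + 2 - k) * b k ≤
      (1 - q)⁻¹ * ((∑ j ∈ Finset.range n, a j ^ 2) ^ (1 / 2 : ℝ) *
        (∑ k ∈ Finset.range (n + 2), b k ^ 2) ^ (1 / 2 : ℝ)) := by
  have h1 : ∀ j ∈ Finset.range n, a j * ∑ k ∈ Finset.range (j + 3), q ^ (j + 2 - k) * b k =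
      ∑ l ∈ Finset.range (n + 2), q ^ l * (a j * if l < j + 3 then b (j + 2 - l) else 0) := by
    intro j hj
    rw [Finset.mem_range] at hj
    rw [← Finset.sum_range_reflect, Finset.mul_sum]
    have hsub : Finset.range (j + 3) ⊆ Finset.range (n + 2) :=
      Finset.range_mono (by omega)
    rw [← Finset.sum_subset hsub]
    · refine Finset.sum_congr rfl fun l hl => ?_
      rw [Finset.mem_range] at hl
      have e : j + 2 - (j + 3 - 1 - l) = l := by omega
      have e' : j + 3 - 1 - l = j + 2 - l := by omega
      rw [if_pos hl, e, e', mul_left_comm]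
    · intro l _ hl
      rw [Finset.mem_range] at hl
      rw [if_neg hl, mul_zero, mul_zero]
  rw [Finset.sum_congr rfl h1, Finset.sum_comm]
  simp_rw [← Finset.mul_sum]
  calc ∑ l ∈ Finset.range (n + 2), q ^ l *
        ∑ j ∈ Finset.range n, a j * (if l < j + 3 then b (j + 2 - l) else 0)
      ≤ ∑ l ∈ Finset.range (n + 2), q ^ l * ((∑ j ∈ Finset.range n, a j ^ 2) ^ (1 / 2 : ℝ) *
        (∑ k ∈ Finset.range (n + 2), b k ^ 2) ^ (1 / 2 : ℝ)) := by
        refine Finset.sum_le_sum fun l _ => mul_le_mul' le_rfl ?_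
        refine (ENNReal.inner_le_Lp_mul_Lq _ _ _ Real.HolderConjugate.two_two).trans ?_
        simp only [ENNReal.rpow_ofNat]
        refine mul_le_mul' le_rfl (ENNReal.rpow_le_rpow ?_ (by norm_num))
        have h2 : ∀ j, (if l < j + 3 then b (j + 2 - l) else 0) ^ 2 =
            if l < j + 3 then b (j + 2 - l) ^ 2 else 0 := fun j => by split_ifs <;> simp
        simp_rw [h2]
        rw [← Finset.sum_filter]
        have hinj : Set.InjOn (fun j => j + 2 - l)
            ((Finset.range n).filter fun j => l < j + 3) := by
          intro i hi j hj hij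
          simp only [Finset.coe_filter, Finset.mem_range, Set.mem_ofPred_eq] at hi hj hij
          omega
        rw [← Finset.sum_image (f := fun k => b k ^ 2) hinj]
        refine Finset.sum_le_sum_of_subset fun k hk => ?_
        simp only [Finset.mem_image, Finset.mem_filter, Finset.mem_range] at hk ⊢
        omega
    _ ≤ _ := by
      rw [← Finset.sum_mul]
      refine mul_le_mul' ?_ le_rfl
      rw [← ENNReal.tsum_geometric]
      exact ENNReal.sum_le_tsum _

section Trilinear

open scoped FourierTransform SchwartzMap

variable {E : Type*} [NormedAddCommGroup E] [InnerProductSpace ℝ E] [FiniteDimensional ℝ E]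
  [MeasurableSpace E] [BorelSpace E]

theorem fmul_const_mul {m : E → ℝ} (hm : m.HasTemperateGrowth) (c : ℝ) (f : 𝓢(E, ℂ)) (x : E) :
    fmul (fun ξ => c * m ξ) f x = c * fmul m f x := by
  have h := SchwartzMap.fourierMultiplierCLM_smul (F := ℂ) hm.complex_ofReal (c : ℂ)
  have e : ((c : ℂ) • fun ξ : E => (m ξ : ℂ)) = fun ξ => ((c * m ξ : ℝ) : ℂ) := by
    ext ξ; simp
  rw [e] at h
  rw [fmul, h]
  simp [fmul]

theorem fmul_besselSym_neg_fmul (s : ℝ) (f : 𝓢(E, ℂ)) :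
    fmul (besselSym (-s)) (fmul (besselSym s) f) = f := by
  rw [fmul_fmul (hasTemperateGrowth_besselSym _) (hasTemperateGrowth_besselSym _)]
  simp_rw [besselSym_mul, neg_add_cancel, besselSym_zero]
  exact fmul_one f

theorem enorm_fmul_lpBump_eq (σ : ℝ) (j : ℕ) (f : 𝓢(E, ℂ)) (x : E) :
    ‖fmul (lpBump j) (fmul (besselSym σ) f) x‖ₑ =
      ENNReal.ofReal (dy j ^ (-σ)) * ‖fmul (lpSym σ j) f x‖ₑ := by
  have h1 : fmul (lpBump j) (fmul (besselSym σ) f) x =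
      (dy j ^ (-σ) : ℝ) * fmul (lpSym σ j) f x := by
    rw [← fmul_const_mul (hasTemperateGrowth_lpSym σ j),
      fmul_fmul (hasTemperateGrowth_lpBump j) (hasTemperateGrowth_besselSym σ)]
    congr 2
    ext ξ
    rw [lpSym, ← mul_assoc, ← Real.rpow_add (dy_pos j)]
    simp [mul_comm]
  rw [h1, enorm_mul]
  congr 1
  rw [← ofReal_norm, norm_real, Real.norm_of_nonneg (Real.rpow_nonneg (dy_pos j).le _)]

/-- A Littlewood-Paley square function. -/
def sqFun (σ : ℝ) (n : ℕ) (f : 𝓢(E, ℂ)) (x : E) : ℝ≥0∞ :=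
  (∑ j ∈ Finset.range n, ‖fmul (lpSym σ j) f x‖ₑ ^ 2) ^ (1 / 2 : ℝ)

theorem measurable_sqFun (σ : ℝ) (n : ℕ) (f : 𝓢(E, ℂ)) : Measurable (sqFun σ n f) :=
  (Finset.measurable_fun_sum _ fun _ _ =>
    (SchwartzMap.continuous _).measurable.enorm.pow_const 2).pow_const _

theorem exists_sqFun_norm_le [Nontrivial E] (σ : ℝ) {p : ℝ} (hp : 1 < p) :
    ∃ C : ℝ≥0, ∀ (f : 𝓢(E, ℂ)) (n : ℕ),
      (∫⁻ x, sqFun σ n f x ^ p) ^ (1 / p) ≤ C * (∫⁻ x, ‖f x‖ₑ ^ p) ^ (1 / p) := by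
  obtain ⟨C, hC⟩ := exists_lintegral_sum_lpSym_le (E := E) σ hp
  have hp0 : 0 ≤ 1 / p := by positivity
  refine ⟨C ^ (1 / p), fun f n => ?_⟩
  rw [ENNReal.coe_rpow_of_nonneg _ hp0, ← ENNReal.mul_rpow_of_nonneg _ _ hp0]
  refine ENNReal.rpow_le_rpow (le_trans (le_of_eq ?_) (hC f n)) hp0
  refine lintegral_congr fun x => ?_
  rw [sqFun, ← ENNReal.rpow_mul]
  congr 1; ring

theorem sum_mul_sum_lpBump_le {s : ℝ} (hs : 0 < s) : ∃ C : ℝ≥0, ∀ (f h : 𝓢(E, ℂ)) (n : ℕ) (x : E),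
    ∑ j ∈ Finset.range n, ‖fmul (lpBump j) f x‖ₑ *
        ∑ k ∈ Finset.range (j + 3), ‖fmul (lpBump k) (fmul (besselSym s) h) x‖ₑ ≤
      C * (sqFun (-s) n (fmul (besselSym s) f) x * sqFun s (n + 2) h x) := by
  set q : ℝ := (2⁻¹ : ℝ) ^ s with hq
  have hq0 : 0 < q := by positivity
  have hq1 : q < 1 := Real.rpow_lt_one (by norm_num) (by norm_num) hs
  have hdy : ∀ j, dy j ^ s = q ^ j := fun j => by
    rw [dy, hq, ← Real.rpow_natCast, ← Real.rpow_natCast, ← Real.rpow_mul (by norm_num),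
      ← Real.rpow_mul (by norm_num), mul_comm]
  have hw : ∀ j k, k < j + 3 → ENNReal.ofReal (dy j ^ s) * ENNReal.ofReal (dy k ^ (-s)) =
      ENNReal.ofReal (q⁻¹ ^ 2) * ENNReal.ofReal q ^ (j + 2 - k) := fun j k hk => by
    rw [← ENNReal.ofReal_mul (by rw [hdy]; positivity), ← ENNReal.ofReal_pow hq0.le,
      ← ENNReal.ofReal_mul (by positivity), Real.rpow_neg (dy_pos k).le, hdy, hdy]
    congr 1
    have : q ^ (j + 2 - k) * q ^ k = q ^ j * q ^ 2 := by
      rw [← pow_add, ← pow_add]; congr 1; omega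
    field_simp
    linarith
  have hne : (1 - ENNReal.ofReal q)⁻¹ ≠ ∞ := by
    rw [Ne, ENNReal.inv_eq_top, tsub_eq_zero_iff_le, not_le, ← ENNReal.ofReal_one]
    exact (ENNReal.ofReal_lt_ofReal_iff one_pos).2 hq1
  refine ⟨(q⁻¹ ^ 2).toNNReal * ((1 - ENNReal.ofReal q)⁻¹).toNNReal, fun f h n x => ?_⟩
  have hf : ∀ j, ‖fmul (lpBump j) f x‖ₑ = ENNReal.ofReal (dy j ^ s) *
      ‖fmul (lpSym (-s) j) (fmul (besselSym s) f) x‖ₑ := fun j => by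
    have := enorm_fmul_lpBump_eq (-s) j (fmul (besselSym s) f) x
    rwa [fmul_besselSym_neg_fmul, neg_neg] at this
  have hsum : ∑ j ∈ Finset.range n, ‖fmul (lpBump j) f x‖ₑ *
        ∑ k ∈ Finset.range (j + 3), ‖fmul (lpBump k) (fmul (besselSym s) h) x‖ₑ =
      ENNReal.ofReal (q⁻¹ ^ 2) * ∑ j ∈ Finset.range n,
        ‖fmul (lpSym (-s) j) (fmul (besselSym s) f) x‖ₑ *
        ∑ k ∈ Finset.range (j + 3), ENNReal.ofReal q ^ (j + 2 - k) *
          ‖fmul (lpSym s k) h x‖ₑ := by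
    rw [Finset.mul_sum]
    refine Finset.sum_congr rfl fun j _ => ?_
    rw [hf j, Finset.mul_sum, Finset.mul_sum, Finset.mul_sum]
    refine Finset.sum_congr rfl fun k hk => ?_
    rw [enorm_fmul_lpBump_eq, mul_mul_mul_comm, hw j k (Finset.mem_range.1 hk)]
    ring
  rw [hsum, ENNReal.coe_mul, ENNReal.coe_toNNReal hne, mul_assoc]
  exact mul_le_mul' le_rfl (ENNReal.sum_mul_sum_geometric_le _ _ _ _)

/-- The trilinear form behind the fractional Leibniz rule is controlled by square functions and
maximal functions. -/
theorem enorm_integral_cutoff_mul_fmul_le {s : ℝ} (hs : 0 < s) :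
    ∃ C : ℝ≥0, ∀ (f g h : 𝓢(E, ℂ)) (n : ℕ),
      ‖∫ x, fmul (fun ξ => cutoff (dy n • ξ)) f x * fmul (fun ξ => cutoff (dy n • ξ)) g x *
          fmul (besselSym s) h x‖ₑ ≤
        C * ((∫⁻ x, sqFun s (n + 3) h x * (sqFun (-s) (n + 1) (fmul (besselSym s) f) x *
            pmax (poissonMeasure E) (fun y => ‖g y‖ₑ) x)) +
          ∫⁻ x, sqFun s (n + 3) h x * (sqFun (-s) (n + 1) (fmul (besselSym s) g) x *
            pmax (poissonMeasure E) (fun y => ‖f y‖ₑ) x)) := by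
  obtain ⟨C₁, h₁⟩ := enorm_integral_cutoff_mul_le (E := E)
  obtain ⟨C₂, h₂⟩ := sum_mul_sum_lpBump_le (E := E) hs
  refine ⟨C₂ * C₁, fun f g h n => (h₁ f g (fmul (besselSym s) h) n).trans ?_⟩
  have key : ∀ u v : 𝓢(E, ℂ), ∫⁻ x, (∑ j ∈ Finset.range (n + 1), ‖fmul (lpBump j) u x‖ₑ *
      ∑ k ∈ Finset.range (j + 3), ‖fmul (lpBump k) (fmul (besselSym s) h) x‖ₑ) *
        (C₁ * pmax (poissonMeasure E) (fun y => ‖v y‖ₑ) x) ≤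
      (C₂ * C₁ : ℝ≥0) * ∫⁻ x, sqFun s (n + 3) h x * (sqFun (-s) (n + 1) (fmul (besselSym s) u) x *
            pmax (poissonMeasure E) (fun y => ‖v y‖ₑ) x) := by
    intro u v
    rw [← lintegral_const_mul' _ _ ENNReal.coe_ne_top]
    refine lintegral_mono fun x => ?_
    refine (mul_le_mul' (h₂ u h (n + 1) x) le_rfl).trans (le_of_eq ?_)
    rw [ENNReal.coe_mul]
    ring
  rw [mul_add]
  exact add_le_add (key f g) (key g f)

theorem enorm_le_eLpNorm_top (g : 𝓢(E, ℂ)) (y : E) : ‖g y‖ₑ ≤ eLpNorm g ∞ volume := by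
  by_contra! h
  have hopen : IsOpen {y | eLpNorm g ∞ volume < ‖g y‖ₑ} :=
    isOpen_lt continuous_const g.continuous.enorm
  have hnull : volume {y | eLpNorm g ∞ volume < ‖g y‖ₑ} = 0 := by
    have := ae_le_eLpNormEssSup (f := (g : E → ℂ)) (μ := volume)
    rw [← eLpNorm_exponent_top, ae_iff] at this
    simpa only [not_le] using this
  have := hopen.measure_eq_zero_iff volume |>.1 hnull
  exact (this ▸ h : y ∈ (∅ : Set E))

theorem exists_mul_pmax_norm_le [Nontrivial E] {p p' : ℝ} {r : ℝ≥0∞} (hp : 1 < p) (hp' : 1 < p')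
    (hr : 1 < r) (h : 1 / ENNReal.ofReal p = 1 / ENNReal.ofReal p' + 1 / r) :
    ∃ K : ℝ≥0, ∀ (g : 𝓢(E, ℂ)) (B : E → ℝ≥0∞), Measurable B →
      (∫⁻ x, (B x * pmax (poissonMeasure E) (fun y => ‖g y‖ₑ) x) ^ p) ^ (1 / p) ≤
        K * ((∫⁻ x, B x ^ p') ^ (1 / p') * eLpNorm g r volume) := by
  have hp0 : 0 < p := by linarith
  have hp0' : 0 < p' := by linarith
  rcases eq_or_ne r ∞ with rfl | hr'
  · have hpp : p = p' := by
      simp only [one_div, ENNReal.inv_top, add_zero, inv_inj] at h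
      exact (ENNReal.ofReal_eq_ofReal_iff hp0.le hp0'.le).1 h
    subst hpp
    refine ⟨1, fun g B hB => ?_⟩
    have hle : ∀ x, pmax (poissonMeasure E) (fun y => ‖g y‖ₑ) x ≤ eLpNorm g ∞ volume := fun x => by
      rw [← pmax_const (poissonMeasure E) (eLpNorm g ∞ volume) x]
      exact iSup_mono fun j => lintegral_mono fun z => enorm_le_eLpNorm_top g _
    have hinv : 0 ≤ 1 / p := by positivity
    calc (∫⁻ x, (B x * pmax (poissonMeasure E) (fun y => ‖g y‖ₑ) x) ^ p) ^ (1 / p)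
        ≤ (∫⁻ x, (B x) ^ p * eLpNorm g ∞ volume ^ p) ^ (1 / p) := by
          refine ENNReal.rpow_le_rpow (lintegral_mono fun x => ?_) hinv
          rw [ENNReal.mul_rpow_of_nonneg _ _ hp0.le]
          exact mul_le_mul' le_rfl (ENNReal.rpow_le_rpow (hle x) hp0.le)
      _ = _ := by
        rw [lintegral_mul_const _ (hB.pow_const p), ENNReal.mul_rpow_of_nonneg _ _ hinv,
          ← ENNReal.rpow_mul _ p, mul_one_div_cancel hp0.ne', ENNReal.rpow_one,
          ENNReal.coe_one, one_mul]
  · set q := r.toReal with hq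
    have hrq : r = ENNReal.ofReal q := (ENNReal.ofReal_toReal hr').symm
    have hq1 : 1 < q := by
      rw [hrq, ← ENNReal.ofReal_one] at hr
      exact (ENNReal.ofReal_lt_ofReal_iff_of_nonneg zero_le_one).1 hr
    have hq0 : 0 < q := by linarith
    have hreal : 1 / p = 1 / p' + 1 / q := by
      rw [hrq, one_div, one_div, one_div, ← ENNReal.ofReal_inv_of_pos hp0,
        ← ENNReal.ofReal_inv_of_pos hp0', ← ENNReal.ofReal_inv_of_pos hq0,
        ← ENNReal.ofReal_add (by positivity) (by positivity)] at h
      simpa only [one_div] using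
        (ENNReal.ofReal_eq_ofReal_iff (by positivity) (by positivity)).1 h
    have hlt : p < p' := by
      have : 0 < 1 / q := by positivity
      exact (one_div_lt_one_div hp0' hp0).1 (by linarith)
    obtain ⟨c, hc, hdec⟩ := polyDecay_poissonMeasure (E := E)
    obtain ⟨K, hK⟩ := exists_lintegral_pmax_rpow_le hc hdec hq1
    refine ⟨K ^ (1 / q), fun g B hB => ?_⟩
    have hgm : Measurable fun y => ‖g y‖ₑ := g.continuous.measurable.enorm
    refine (ENNReal.lintegral_Lp_mul_le_Lq_mul_Lr hp0 hlt hreal volume hB.aemeasurable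
      (measurable_pmax _ hgm).aemeasurable).trans ?_
    have hinv : 0 ≤ 1 / q := by positivity
    have hnorm : eLpNorm g r volume = (∫⁻ x, ‖g x‖ₑ ^ q) ^ (1 / q) := by
      rw [eLpNorm_eq_lintegral_rpow_enorm_toReal (by rintro rfl; simp at hr) hr']
    rw [mul_left_comm, hnorm, ENNReal.coe_rpow_of_nonneg _ hinv,
      ← ENNReal.mul_rpow_of_nonneg _ _ hinv]
    exact mul_le_mul' le_rfl (ENNReal.rpow_le_rpow (hK _ hgm) hinv)

end Trilinear

section Duality

open scoped FourierTransform SchwartzMap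

variable {E : Type*} [NormedAddCommGroup E] [InnerProductSpace ℝ E] [FiniteDimensional ℝ E]
  [MeasurableSpace E] [BorelSpace E]

theorem eLpNorm_ofReal_eq {F : E → ℂ} {p : ℝ} (hp : 0 < p) :
    eLpNorm F (ENNReal.ofReal p) volume = (∫⁻ x, ‖F x‖ₑ ^ p) ^ (1 / p) := by
  rw [eLpNorm_eq_lintegral_rpow_enorm_toReal (by simpa using hp) ENNReal.ofReal_ne_top,
    ENNReal.toReal_ofReal hp.le]

theorem enorm_integral_mul_le_eLpNorm {p q : ℝ} (hpq : p.HolderConjugate q) {u v : E → ℂ}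
    (hu : AEMeasurable u) (hv : AEMeasurable v) :
    ‖∫ x, u x * v x‖ₑ ≤
      eLpNorm u (ENNReal.ofReal p) volume * eLpNorm v (ENNReal.ofReal q) volume := by
  rw [eLpNorm_ofReal_eq hpq.pos, eLpNorm_ofReal_eq hpq.symm.pos]
  refine (enorm_integral_le_lintegral_enorm _).trans ?_
  simp_rw [enorm_mul]
  exact ENNReal.lintegral_mul_le_Lp_mul_Lq volume hpq hu.enorm hv.enorm

/-- The function extremal for Hölder's inequality with `u`. -/
def dualFun (p : ℝ) (u : E → ℂ) (x : E) : ℂ :=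
  (starRingEnd ℂ) (u x) * ((‖u x‖ ^ (p - 2) : ℝ) : ℂ)

theorem enorm_dualFun {p : ℝ} (hp : 1 < p) (u : E → ℂ) (x : E) :
    ‖dualFun p u x‖ₑ = ‖u x‖ₑ ^ (p - 1) := by
  rw [← ofReal_norm, ← ofReal_norm, ENNReal.ofReal_rpow_of_nonneg (norm_nonneg _) (by linarith)]
  congr 1
  rw [dualFun, norm_mul, RCLike.norm_conj, norm_real, Real.norm_of_nonneg (by positivity)]
  rcases eq_or_ne (u x) 0 with h | h
  · rw [h, norm_zero, zero_mul, Real.zero_rpow (by linarith)]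
  · have h' : 0 < ‖u x‖ := norm_pos_iff.2 h
    calc ‖u x‖ * ‖u x‖ ^ (p - 2) = ‖u x‖ ^ (1 : ℝ) * ‖u x‖ ^ (p - 2) := by rw [Real.rpow_one]
      _ = _ := by rw [← Real.rpow_add h']; ring_nf

theorem mul_dualFun {p : ℝ} (hp : 1 < p) (u : E → ℂ) (x : E) :
    u x * dualFun p u x = ((‖u x‖ ^ p : ℝ) : ℂ) := by
  rw [dualFun, ← mul_assoc, mul_conj', ← ofReal_pow, ← ofReal_mul]
  congr 1
  rcases eq_or_ne (u x) 0 with h | h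
  · simp [h, Real.zero_rpow (show p ≠ 0 by linarith)]
  · have h' : 0 < ‖u x‖ := norm_pos_iff.2 h
    rw [← Real.rpow_natCast, ← Real.rpow_add h']
    congr 1; push_cast; ring

theorem eLpNorm_dualFun {p q : ℝ} (hpq : p.HolderConjugate q) (u : E → ℂ) :
    eLpNorm (dualFun p u) (ENNReal.ofReal q) volume = (∫⁻ x, ‖u x‖ₑ ^ p) ^ (1 / q) := by
  rw [eLpNorm_ofReal_eq hpq.symm.pos]
  congr 1
  refine lintegral_congr fun x => ?_
  rw [enorm_dualFun hpq.lt, ← ENNReal.rpow_mul, hpq.sub_one_mul_conj]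

theorem ENNReal.rpow_one_div_le_of_le_mul_rpow {p q : ℝ} (hpq : p.HolderConjugate q)
    {I B : ℝ≥0∞} (hI : I ≠ ∞) (h : I ≤ B * I ^ (1 / q)) : I ^ (1 / p) ≤ B := by
  rcases eq_or_ne I 0 with h0 | h0
  · rw [h0, ENNReal.zero_rpow_of_pos (by have := hpq.pos; positivity)]; exact zero_le
  · have e : I = I ^ (1 / p) * I ^ (1 / q) := by
      rw [← ENNReal.rpow_add _ _ h0 hI, one_div, one_div, hpq.inv_add_inv_eq_one,
        ENNReal.rpow_one]
    have hq := hpq.symm.pos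
    nth_rewrite 1 [e] at h
    refine (ENNReal.mul_le_mul_iff_left ?_ ?_).1 h
    · simp [ENNReal.rpow_eq_zero_iff, h0, hI]
    · simp [ENNReal.rpow_eq_top_iff, h0, hI]

theorem SchwartzMap.eLpNorm_le_of_duality {p q : ℝ} (hpq : p.HolderConjugate q) (u : 𝓢(E, ℂ))
    {B : ℝ≥0∞} (h : ∀ v : 𝓢(E, ℂ),
      ‖∫ x, u x * v x‖ₑ ≤ B * eLpNorm v (ENNReal.ofReal q) volume) :
    eLpNorm u (ENNReal.ofReal p) volume ≤ B := by
  rcases eq_or_ne B ∞ with rfl | hB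
  · exact le_top
  have hp := hpq.pos
  have hq := hpq.symm.lt
  have hLu : eLpNorm u (ENNReal.ofReal p) volume ≠ ∞ := (u.memLp _ _).2.ne
  have hI : (∫⁻ x, ‖u x‖ₑ ^ p) ≠ ∞ := by
    rw [eLpNorm_ofReal_eq hp] at hLu
    intro hI
    rw [hI, ENNReal.top_rpow_of_pos (by positivity)] at hLu
    exact hLu rfl
  have hum : Measurable u := u.continuous.measurable
  have hφm : Measurable (dualFun p u) := by unfold dualFun; fun_prop
  have hφ : MemLp (dualFun p u) (ENNReal.ofReal q) volume := by
    refine ⟨hφm.aestronglyMeasurable, ?_⟩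
    rw [eLpNorm_dualFun hpq]
    exact ENNReal.rpow_lt_top_of_nonneg (by positivity) hI
  have hInt : Integrable fun x => ‖u x‖ ^ p := by
    refine ⟨(hum.norm.pow_const p).aestronglyMeasurable, ?_⟩
    rw [HasFiniteIntegral]
    refine lt_of_eq_of_lt (lintegral_congr fun x => ?_) hI.lt_top
    rw [Real.enorm_of_nonneg (by positivity), ← ofReal_norm,
      ENNReal.ofReal_rpow_of_nonneg (norm_nonneg _) hp.le]
  have hpair : ‖∫ x, u x * dualFun p u x‖ₑ = ∫⁻ x, ‖u x‖ₑ ^ p := by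
    simp_rw [mul_dualFun hpq.lt]
    rw [integral_complex_ofReal, ← ofReal_norm, norm_real,
      Real.norm_of_nonneg (integral_nonneg fun x => by positivity),
      ofReal_integral_eq_lintegral_ofReal hInt (ae_of_all _ fun x => by positivity)]
    refine lintegral_congr fun x => ?_
    rw [← ofReal_norm, ENNReal.ofReal_rpow_of_nonneg (norm_nonneg _) hp.le]
  have key : ∀ n : ℕ, (∫⁻ x, ‖u x‖ₑ ^ p) ≤
      B * ((∫⁻ x, ‖u x‖ₑ ^ p) ^ (1 / q) + ENNReal.ofReal (1 / ((n : ℝ) + 1))) +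
        eLpNorm u (ENNReal.ofReal p) volume * ENNReal.ofReal (1 / ((n : ℝ) + 1)) := by
    intro n
    have hq1 : 1 ≤ ENNReal.ofReal q := by rw [ENNReal.one_le_ofReal]; exact hq.le
    obtain ⟨g, hg₁, hg₂, hg₃⟩ := MemLp.exist_eLpNorm_sub_le ENNReal.ofReal_ne_top hq1 hφ
      (show 0 < 1 / ((n : ℝ) + 1) by positivity)
    set v : 𝓢(E, ℂ) := hg₁.toSchwartzMap hg₂ with hv
    have hvg : (v : E → ℂ) = g := by ext; simp [hv]
    rw [← hvg] at hg₃
    have hvm : Measurable v := v.continuous.measurable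
    have hi1 : Integrable fun x => u x * v x := SchwartzMap.integrable_mul u v
    have hi2 : Integrable fun x => u x * dualFun p u x := by
      simp_rw [mul_dualFun hpq.lt]; exact hInt.ofReal
    have e : ∫ x, u x * dualFun p u x =
        (∫ x, u x * v x) + ∫ x, u x * (dualFun p u - v) x := by
      rw [← integral_add hi1]
      · refine integral_congr_ae (ae_of_all _ fun x => ?_)
        simp only [Pi.sub_apply]; ring
      · simp only [Pi.sub_apply, mul_sub]
        exact hi2.sub hi1
    rw [← hpair, e]
    refine (enorm_add_le _ _).trans (add_le_add ((h v).trans ?_) ?_)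
    · gcongr
      have e2 : (v : E → ℂ) = dualFun p u - (dualFun p u - v) := by
        rw [sub_sub_cancel]
      rw [← e, hpair, ← eLpNorm_dualFun hpq]
      nth_rewrite 1 [e2]
      refine (eLpNorm_sub_le hφm.aestronglyMeasurable (hφm.sub hvm).aestronglyMeasurable
        hq1).trans ?_
      gcongr
    · refine (enorm_integral_mul_le_eLpNorm hpq hum.aemeasurable
        (hφm.sub hvm).aemeasurable).trans ?_
      gcongr
  have hlim : Tendsto (fun n : ℕ => ENNReal.ofReal (1 / ((n : ℝ) + 1))) atTop (nhds 0) := by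
    have := (ENNReal.continuous_ofReal.tendsto 0).comp tendsto_one_div_add_atTop_nhds_zero_nat
    rwa [ENNReal.ofReal_zero] at this
  have hlim2 : Tendsto (fun n : ℕ =>
      B * ((∫⁻ x, ‖u x‖ₑ ^ p) ^ (1 / q) + ENNReal.ofReal (1 / ((n : ℝ) + 1))) +
        eLpNorm u (ENNReal.ofReal p) volume * ENNReal.ofReal (1 / ((n : ℝ) + 1))) atTop
      (nhds (B * ((∫⁻ x, ‖u x‖ₑ ^ p) ^ (1 / q) + 0) +
        eLpNorm u (ENNReal.ofReal p) volume * 0)) :=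
    (ENNReal.Tendsto.const_mul (hlim.const_add _) (Or.inr hB)).add
      (ENNReal.Tendsto.const_mul hlim (Or.inr hLu))
  have hfin := ge_of_tendsto' hlim2 key
  rw [mul_zero, add_zero, add_zero] at hfin
  rw [eLpNorm_ofReal_eq hp]
  exact ENNReal.rpow_one_div_le_of_le_mul_rpow hpq hI hfin

end Duality

section KatoPonce

open scoped FourierTransform SchwartzMap

variable {E : Type*} [NormedAddCommGroup E] [InnerProductSpace ℝ E] [FiniteDimensional ℝ E]
  [MeasurableSpace E] [BorelSpace E]

theorem norm_fourierInv_integrand_cutoff_le (f : 𝓢(E, ℂ)) (n : ℕ) (x ξ : E) :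
    ‖Complex.exp (((2 * Real.pi * ⟪ξ, x⟫ : ℝ) : ℂ) * I) • ((cutoff (dy n • ξ) : ℂ) * 𝓕 f ξ)‖ ≤
      ‖𝓕 f ξ‖ := by
  rw [norm_smul, norm_exp_ofReal_mul_I, one_mul, norm_mul, norm_real]
  refine mul_le_of_le_one_left (norm_nonneg _) ?_
  rw [cutoff, Real.norm_of_nonneg (ContDiffBump.nonneg _)]
  exact ContDiffBump.le_one _

theorem norm_fmul_cutoff_le (f : 𝓢(E, ℂ)) (n : ℕ) (x : E) :
    ‖fmul (fun ξ => cutoff (dy n • ξ)) f x‖ ≤ ∫ ξ, ‖𝓕 f ξ‖ := by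
  rw [fmul_apply (hasTemperateGrowth_cutoff_smul _), Real.fourierInv_eq']
  exact norm_integral_le_of_norm_le (𝓕 f).integrable.norm
    (ae_of_all _ fun ξ => norm_fourierInv_integrand_cutoff_le f n x ξ)

theorem tendsto_fmul_cutoff (f : 𝓢(E, ℂ)) (x : E) :
    Tendsto (fun n => fmul (fun ξ => cutoff (dy n • ξ)) f x) atTop (nhds (f x)) := by
  have e : f x = 𝓕⁻ (fun ξ => 𝓕 f ξ) x := by
    rw [← SchwartzMap.fourierInv_coe, FourierTransform.fourierInv_fourier_eq]
  rw [e, Real.fourierInv_eq']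
  simp_rw [fmul_apply (hasTemperateGrowth_cutoff_smul _), Real.fourierInv_eq']
  refine tendsto_integral_of_dominated_convergence (fun ξ => ‖𝓕 f ξ‖) (fun n => ?_)
    (𝓕 f).integrable.norm (fun n => ae_of_all _ fun ξ =>
      norm_fourierInv_integrand_cutoff_le f n x ξ) (ae_of_all _ fun ξ => ?_)
  · have h1 : Continuous fun ξ : E => cutoff (dy n • ξ) := (contDiff_cutoff_smul _).continuous
    have h2 := (𝓕 f).continuous
    exact Continuous.aestronglyMeasurable (by fun_prop)
  · have hdy : Tendsto dy atTop (nhds 0) :=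
      tendsto_pow_atTop_nhds_zero_of_lt_one (by norm_num) (by norm_num)
    have h0 : Tendsto (fun n => cutoff (dy n • ξ)) atTop (nhds 1) := by
      have h1 := (contDiff_cutoff (E := E)).continuous.tendsto 0
      rw [cutoff_of_le (by simp)] at h1
      refine h1.comp ?_
      simpa using hdy.smul_const ξ
    have h2 := (((Complex.continuous_ofReal.tendsto 1).comp h0).mul_const (𝓕 f ξ)).const_smul
      (Complex.exp (((2 * Real.pi * ⟪ξ, x⟫ : ℝ) : ℂ) * I))
    simpa using h2

theorem tendsto_integral_cutoff_mul (f g k : 𝓢(E, ℂ)) :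
    Tendsto (fun n => ∫ x, fmul (fun ξ => cutoff (dy n • ξ)) f x *
      fmul (fun ξ => cutoff (dy n • ξ)) g x * k x) atTop (nhds (∫ x, f x * g x * k x)) := by
  refine tendsto_integral_of_dominated_convergence
    (fun x => (∫ ξ, ‖𝓕 f ξ‖) * (∫ ξ, ‖𝓕 g ξ‖) * ‖k x‖)
    (fun n => (SchwartzMap.integrable_mul_mul _ _ _).aestronglyMeasurable)
    (k.integrable.norm.const_mul _) (fun n => ae_of_all _ fun x => ?_) (ae_of_all _ fun x => ?_)
  · rw [norm_mul, norm_mul]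
    gcongr
    · exact norm_fmul_cutoff_le f n x
    · exact norm_fmul_cutoff_le g n x
  · exact ((tendsto_fmul_cutoff f x).mul (tendsto_fmul_cutoff g x)).mul_const _

theorem exists_lintegral_sqFun_mul_le [Nontrivial E] (s : ℝ) {p q p' : ℝ} {r : ℝ≥0∞}
    (hpq : p.HolderConjugate q) (hp' : 1 < p') (hr : 1 < r)
    (h : 1 / ENNReal.ofReal p = 1 / ENNReal.ofReal p' + 1 / r) :
    ∃ K : ℝ≥0, ∀ (u v w : 𝓢(E, ℂ)) (m n : ℕ),
      ∫⁻ x, sqFun s m w x * (sqFun (-s) n u x * pmax (poissonMeasure E) (fun y => ‖v y‖ₑ) x) ≤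
        K * (eLpNorm u (ENNReal.ofReal p') volume * eLpNorm v r volume) *
          eLpNorm w (ENNReal.ofReal q) volume := by
  obtain ⟨K, hK⟩ := exists_mul_pmax_norm_le (E := E) hpq.lt hp' hr h
  obtain ⟨C₁, h₁⟩ := exists_sqFun_norm_le (E := E) s hpq.symm.lt
  obtain ⟨C₂, h₂⟩ := exists_sqFun_norm_le (E := E) (-s) hp'
  refine ⟨C₁ * (K * C₂), fun u v w m n => ?_⟩
  have hmeas : Measurable fun x =>
      sqFun (-s) n u x * pmax (poissonMeasure E) (fun y => ‖v y‖ₑ) x :=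
    (measurable_sqFun _ _ _).mul (measurable_pmax _ v.continuous.measurable.enorm)
  calc _ ≤ (∫⁻ x, sqFun s m w x ^ q) ^ (1 / q) * (∫⁻ x, (sqFun (-s) n u x *
          pmax (poissonMeasure E) (fun y => ‖v y‖ₑ) x) ^ p) ^ (1 / p) :=
        ENNReal.lintegral_mul_le_Lp_mul_Lq volume hpq.symm
          (measurable_sqFun _ _ _).aemeasurable hmeas.aemeasurable
    _ ≤ (C₁ * eLpNorm w (ENNReal.ofReal q) volume) *
          (K * ((C₂ * eLpNorm u (ENNReal.ofReal p') volume) * eLpNorm v r volume)) := by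
        rw [eLpNorm_ofReal_eq hpq.symm.pos, eLpNorm_ofReal_eq (by linarith : 0 < p')]
        refine mul_le_mul' (h₁ w m) ((hK v _ (measurable_sqFun _ _ _)).trans ?_)
        gcongr
        exact h₂ u n
    _ = _ := by push_cast; ring

/-- The Kato–Ponce inequality for Schwartz functions on a Euclidean space, in terms of Fourier
multipliers. -/
theorem exists_eLpNorm_fmul_besselSym_smulS_le [Nontrivial E] {s : ℝ} (hs : 0 < s)
    {p p₂ p₃ : ℝ} {r₁ r₄ : ℝ≥0∞} (hp : 1 < p) (hp₂ : 1 < p₂) (hp₃ : 1 < p₃)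
    (hr₁ : 1 < r₁) (hr₄ : 1 < r₄)
    (h₁ : 1 / ENNReal.ofReal p = 1 / ENNReal.ofReal p₂ + 1 / r₁)
    (h₂ : 1 / ENNReal.ofReal p = 1 / ENNReal.ofReal p₃ + 1 / r₄) :
    ∃ C : ℝ≥0, ∀ f g : 𝓢(E, ℂ),
      eLpNorm (fmul (besselSym s) (smulS f g)) (ENNReal.ofReal p) volume ≤
        C * (eLpNorm f r₁ volume * eLpNorm (fmul (besselSym s) g) (ENNReal.ofReal p₂) volume +
          eLpNorm (fmul (besselSym s) f) (ENNReal.ofReal p₃) volume * eLpNorm g r₄ volume) := by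
  have hpq := Real.HolderConjugate.conjExponent hp
  obtain ⟨C, hC⟩ := enorm_integral_cutoff_mul_fmul_le (E := E) hs
  obtain ⟨K₁, hK₁⟩ := exists_lintegral_sqFun_mul_le (E := E) s hpq hp₂ hr₁ h₁
  obtain ⟨K₂, hK₂⟩ := exists_lintegral_sqFun_mul_le (E := E) s hpq hp₃ hr₄ h₂
  refine ⟨C * (K₁ + K₂), fun f g => SchwartzMap.eLpNorm_le_of_duality hpq _ fun v => ?_⟩
  have e : ∫ x, fmul (besselSym s) (smulS f g) x * v x =
      ∫ x, f x * g x * fmul (besselSym s) v x :=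
    (integral_mul_fmul (hasTemperateGrowth_besselSym s) (besselSym_neg s) (smulS f g) v).symm
  rw [e]
  refine le_of_tendsto' (tendsto_integral_cutoff_mul f g (fmul (besselSym s) v)).enorm
    fun n => (hC f g v n).trans ?_
  set L := eLpNorm v (ENNReal.ofReal p.conjExponent) volume
  set X := eLpNorm f r₁ volume * eLpNorm (fmul (besselSym s) g) (ENNReal.ofReal p₂) volume
  set Y := eLpNorm (fmul (besselSym s) f) (ENNReal.ofReal p₃) volume * eLpNorm g r₄ volume
  have k₁ := hK₁ (fmul (besselSym s) g) f v (n + 3) (n + 1)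
  have k₂ := hK₂ (fmul (besselSym s) f) g v (n + 3) (n + 1)
  rw [mul_comm (eLpNorm (fmul (besselSym s) g) _ _)] at k₁
  calc _ ≤ (C : ℝ≥0∞) * (K₂ * Y * L + K₁ * X * L) := by gcongr
    _ ≤ C * ((K₁ + K₂) * Y * L + (K₁ + K₂) * X * L) := by
        gcongr
        · exact le_add_self
        · exact le_self_add
    _ = _ := by push_cast; ring

end KatoPonce

section Euclidean

open scoped FourierTransform SchwartzMap

theorem FT_two_pi_smul (d : ℕ) (f : Ed d → ℂ) (η : Ed d) :
    FT d f ((2 * Real.pi) • η) = 𝓕 f η := by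
  rw [FT, Real.fourier_eq']
  refine integral_congr_ae (ae_of_all _ fun x => ?_)
  simp only [inner_smul_right, smul_eq_mul]
  congr 2
  push_cast; ring

theorem FTinv_eq_fourierInv (d : ℕ) (G : Ed d → ℂ) (x : Ed d) :
    FTinv d G x = 𝓕⁻ (fun η => G ((2 * Real.pi) • η)) x := by
  have h := Measure.integral_comp_smul (volume : Measure (Ed d))
    (fun ξ => Complex.exp (Complex.I * (⟪x, ξ⟫ : ℝ)) * G ξ) (2 * Real.pi)
  rw [finrank_euclideanSpace_fin, abs_of_pos (by positivity), real_smul, ofReal_inv] at h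
  rw [FTinv, ← h, Real.fourierInv_eq']
  refine integral_congr_ae (ae_of_all _ fun ξ => ?_)
  simp only [inner_smul_right, smul_eq_mul, real_inner_comm ξ x]
  congr 2
  push_cast; ring

theorem besselD_eq_fmul (d : ℕ) (s : ℝ) (f : 𝓢(Ed d, ℂ)) :
    besselD d s f = fmul (besselSym s) f := by
  ext x
  rw [besselD, FTinv_eq_fourierInv, fmul_apply (hasTemperateGrowth_besselSym s)]
  simp_rw [FT_two_pi_smul, SchwartzMap.fourier_coe]
  rfl

end Euclidean

/-- Kato–Ponce inequality. For `d ≥ 1`, `s ≥ 0`, `1 < r < ∞` and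
`1/r = 1/r₁ + 1/r₂ = 1/r₃ + 1/r₄` with `r₂, r₃ ∈ (1,∞)` and `r₁, r₄ ∈ (1,∞]`, there is
`C > 0` such that for all Schwartz `f, g`:
`‖⟨D⟩^s(fg)‖_{L^r} ≤ C(‖f‖_{L^{r₁}}‖⟨D⟩^s g‖_{L^{r₂}} + ‖⟨D⟩^s f‖_{L^{r₃}}‖g‖_{L^{r₄}})`. -/
theorem kato_ponce
    (d : ℕ) (hd : 1 ≤ d) (s : ℝ) (hs : 0 ≤ s) (r r₁ r₂ r₃ r₄ : ℝ≥0∞)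
    (hr : 1 < r) (hr' : r < ∞)
    (hr₁ : 1 < r₁) (hr₂ : 1 < r₂) (hr₂' : r₂ < ∞)
    (hr₃ : 1 < r₃) (hr₃' : r₃ < ∞) (hr₄ : 1 < r₄)
    (hsum1 : 1 / r = 1 / r₁ + 1 / r₂) (hsum2 : 1 / r = 1 / r₃ + 1 / r₄) :
    ∃ C : ℝ, 0 < C ∧
      ∀ f g : SchwartzMap (Ed d) ℂ,
        eLpNorm (besselD d s (fun x => f x * g x)) r volume ≤
          ENNReal.ofReal C *
            (eLpNorm (fun x => f x) r₁ volume *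
                eLpNorm (besselD d s (fun x => g x)) r₂ volume +
              eLpNorm (besselD d s (fun x => f x)) r₃ volume *
                eLpNorm (fun x => g x) r₄ volume) := by
  have hfg : ∀ f g : SchwartzMap (Ed d) ℂ,
      besselD d s (fun x => f x * g x) = fmul (besselSym s) (smulS f g) :=
    fun f g => besselD_eq_fmul d s (smulS f g)
  simp_rw [hfg, besselD_eq_fmul]
  rcases hs.eq_or_lt with rfl | hs
  · have h0 : (besselSym 0 : Ed d → ℝ) = fun _ => 1 := funext besselSym_zero
    refine ⟨1, one_pos, fun f g => ?_⟩
    simp_rw [h0, fmul_one, ENNReal.ofReal_one, one_mul]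
    have : ENNReal.HolderTriple r₁ r₂ r := ⟨by simpa only [one_div] using hsum1.symm⟩
    exact (eLpNorm_smul_le_mul_eLpNorm (f := g) (φ := f) (p := r₁) (q := r₂) (r := r)
      g.continuous.aestronglyMeasurable f.continuous.aestronglyMeasurable).trans le_self_add
  · have : Nonempty (Fin d) := ⟨⟨0, hd⟩⟩
    have htoReal : ∀ t : ℝ≥0∞, 1 < t → t < ∞ → ∃ p : ℝ, 1 < p ∧ t = ENNReal.ofReal p :=
      fun t h1 h2 => ⟨t.toReal, by
        rwa [← ENNReal.toReal_one, ENNReal.toReal_lt_toReal ENNReal.one_ne_top h2.ne],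
        (ENNReal.ofReal_toReal h2.ne).symm⟩
    obtain ⟨p, hp, rfl⟩ := htoReal r hr hr'
    obtain ⟨p₂, hp₂, rfl⟩ := htoReal r₂ hr₂ hr₂'
    obtain ⟨p₃, hp₃, rfl⟩ := htoReal r₃ hr₃ hr₃'
    obtain ⟨C, hC⟩ := exists_eLpNorm_fmul_besselSym_smulS_le (E := Ed d) hs hp hp₂ hp₃ hr₁ hr₄
      (by rw [hsum1, add_comm]) hsum2
    refine ⟨C + 1, by positivity, fun f g => (hC f g).trans ?_⟩
    refine mul_le_mul' ?_ le_rfl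
    rw [ENNReal.ofReal_add C.coe_nonneg zero_le_one, ENNReal.ofReal_coe_nnreal]
    exact le_self_add
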